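/- arXiv:1310.5071 — 3 statements merged into one kernel-verified Lean document; each statement's English description precedes it below -/
import Mathlib

section
/- If G is any finite group of monomial automorphisms of D, then the fixed ring D^G = {r ∈ D : g(r) = r for all g ∈ G} is isomorphic to D = k_q(x,y) as a k-algebra (for the same q). -/
/-- `D`, together with the distinguished nonzero elements `x`, `y` satisfying
`x * y = q • (y * x)`, is the `q`-division ring `k_q(x,y)`: the Ore division ring of fractions
of the quantum plane `k_q[x,y]`.  The quantum plane sits inside `D` as the `k`-subalgebra
generated by `x` and `y`; linear independence of the monomials `yⁱxʲ` says that this subalgebra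
really is the quantum plane, and `exists_frac` says that `D` is its ring of (left) fractions. -/
structure IsQDivisionRing (k : Type*) [Field k] (D : Type*) [DivisionRing D] [Algebra k D]
    (q : k) (x y : D) : Prop where
  x_ne_zero : x ≠ 0
  y_ne_zero : y ≠ 0
  rel : x * y = algebraMap k D q * (y * x)
  monomials_linearIndependent :
    LinearIndependent k fun p : ℕ × ℕ => y ^ p.1 * x ^ p.2
  exists_frac : ∀ d : D, ∃ s t : D, s ∈ Algebra.adjoin k ({x, y} : Set D) ∧
    t ∈ Algebra.adjoin k ({x, y} : Set D) ∧ t ≠ 0 ∧ d = t⁻¹ * s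

/-- A `k`-algebra automorphism `ψ` of `D` is a *monomial automorphism* (with respect to the
generators `x`, `y` and the chosen square root `q̂` of `q`) if for some matrix
`(a b; c d) ∈ SL₂(ℤ)` it sends `y ↦ q̂^{ac} yᵃxᶜ` and `x ↦ q̂^{bd} yᵇxᵈ`. -/
def IsMonomialAut (k : Type*) [Field k] {D : Type*} [DivisionRing D] [Algebra k D]
    (qh : k) (x y : D) (ψ : D ≃ₐ[k] D) : Prop :=
  ∃ a b c d : ℤ, a * d - b * c = 1 ∧
    ψ y = algebraMap k D (qh ^ (a * c)) * (y ^ a * x ^ c) ∧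
    ψ x = algebraMap k D (qh ^ (b * d)) * (y ^ b * x ^ d)

namespace QuantumTorus

open Submodule

variable {k : Type*} [Field k] {D : Type*} [DivisionRing D] [Algebra k D]

/-- The family `e` is the basis of normalised monomials of a quantum torus inside `D`. -/
structure IsTorus (h : k) (e : ℤ × ℤ → D) : Prop where
  h_ne_zero : h ≠ 0
  mul : ∀ u w, e u * e w = h ^ (u.2 * w.1 - u.1 * w.2) • e (u + w)
  linearIndependent : LinearIndependent k e

/-- A quantum torus in `D` whose division ring of left fractions is `D`. -/
structure IsFrame (h : k) (e : ℤ × ℤ → D) : Prop extends IsTorus h e where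
  frac : ∀ d : D, ∃ t ∈ span k (Set.range e), t ≠ 0 ∧ t * d ∈ span k (Set.range e)

/-- The normalised monomials in a pair of elements. -/
def monomial (h : k) (y x : D) (v : ℤ × ℤ) : D := h ^ (v.1 * v.2) • (y ^ v.1 * x ^ v.2)

section Basic

variable {h : k} {e : ℤ × ℤ → D}

theorem IsTorus.ne_zero (he : IsTorus h e) (v : ℤ × ℤ) : e v ≠ 0 :=
  he.linearIndependent.ne_zero v

theorem IsTorus.one (he : IsTorus h e) : e 0 = 1 := by
  have h1 := he.mul 0 0
  simp only [Prod.fst_zero, Prod.snd_zero, mul_zero, sub_zero, zpow_zero, one_smul,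
    add_zero] at h1
  exact mul_left_cancel₀ (he.ne_zero 0) (by rw [h1, mul_one])

theorem IsTorus.inv (he : IsTorus h e) (v : ℤ × ℤ) : (e v)⁻¹ = e (-v) := by
  have : v.2 * (-v).1 - v.1 * (-v).2 = 0 := by simp; ring
  refine inv_eq_of_mul_eq_one_right ?_
  rw [he.mul]
  rw [this, add_neg_cancel, he.one, zpow_zero, one_smul]

theorem zpow_comm_of_rel {q : k} {y x : D} (hr : x * y = q • (y * x)) (i j : ℤ) :
    x ^ j * y ^ i = q ^ (i * j) • (y ^ i * x ^ j) := by
  have smul_zpow (c : k) (z : D) (n : ℤ) : (c • z) ^ n = c ^ n • z ^ n := by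
    rw [Algebra.smul_def, Commute.mul_zpow (Algebra.commute_algebraMap_left c z),
      Algebra.smul_def, map_zpow₀]
  have h1 : SemiconjBy x y (q • y) := by
    rw [SemiconjBy, hr, smul_mul_assoc]
  have h2 := h1.zpow_right₀ i
  rw [smul_zpow, SemiconjBy] at h2
  have h3 : SemiconjBy (y ^ i) (q ^ i • x) x := by
    rw [SemiconjBy, h2, smul_mul_assoc, mul_smul_comm]
  have h4 := h3.zpow_right₀ j
  rw [smul_zpow, SemiconjBy] at h4
  rw [← h4, mul_smul_comm, ← zpow_mul]

theorem monomial_mul (hh : h ≠ 0) {y x : D} (hx : x ≠ 0) (hy : y ≠ 0)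
    (hr : x * y = h ^ 2 • (y * x)) (u w : ℤ × ℤ) :
    monomial h y x u * monomial h y x w =
      h ^ (u.2 * w.1 - u.1 * w.2) • monomial h y x (u + w) := by
  have hc := zpow_comm_of_rel hr w.1 u.2
  have : y ^ u.1 * x ^ u.2 * (y ^ w.1 * x ^ w.2) =
      (h ^ 2) ^ (w.1 * u.2) • (y ^ (u.1 + w.1) * x ^ (u.2 + w.2)) := by
    rw [zpow_add₀ hy, zpow_add₀ hx, mul_assoc, ← mul_assoc (x ^ u.2), hc]
    simp [mul_assoc]
  simp only [monomial, smul_mul_smul_comm, this, smul_smul, Prod.fst_add, Prod.snd_add]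
  congr 1
  rw [← zpow_natCast h 2, ← zpow_mul, ← zpow_add₀ hh, ← zpow_add₀ hh, ← zpow_add₀ hh]
  congr 1
  push_cast
  ring

theorem IsTorus.rel (he : IsTorus h e) :
    e (0, 1) * e (1, 0) = h ^ 2 • (e (1, 0) * e (0, 1)) := by
  rw [he.mul, he.mul, smul_smul]
  simp
  rw [← zpow_natCast h 2, ← zpow_neg_one, ← zpow_add₀ he.h_ne_zero]
  norm_num

theorem IsTorus.zpow (he : IsTorus h e) (v : ℤ × ℤ) (n : ℤ) : e v ^ n = e (n • v) := by
  have hz (n : ℕ) : e v ^ n = e (n • v) := by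
    induction n with
    | zero => simp [he.one]
    | succ n ih =>
      rw [pow_succ, ih, he.mul, succ_nsmul]
      have : (n • v).2 * v.1 - (n • v).1 * v.2 = 0 := by simp; ring
      rw [this, zpow_zero, one_smul]
  cases n with
  | ofNat n => simp [hz]
  | negSucc n => rw [zpow_negSucc, hz, he.inv, negSucc_zsmul]

theorem IsTorus.eq_monomial (he : IsTorus h e) : e = monomial h (e (1, 0)) (e (0, 1)) := by
  funext v
  rw [monomial, he.zpow, he.zpow, he.mul, smul_smul, ← zpow_add₀ he.h_ne_zero]
  simp

/-- Two homomorphisms agreeing on the two generators agree on all monomials. -/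
theorem map_monomial {D' : Type*} [DivisionRing D'] [Algebra k D'] (F : D →ₐ[k] D') (y x : D)
    (v : ℤ × ℤ) : F (monomial h y x v) = monomial h (F y) (F x) v := by
  simp [monomial, map_zpow₀]

theorem IsTorus.span_mul_mem (he : IsTorus h e) {s t : D} (hs : s ∈ span k (Set.range e))
    (ht : t ∈ span k (Set.range e)) : s * t ∈ span k (Set.range e) := by
  have : s * t ∈ span k (Set.range e) * span k (Set.range e) := mul_mem_mul hs ht
  rw [span_mul_span] at this
  refine span_le.2 ?_ this
  rintro _ ⟨_, ⟨u, rfl⟩, _, ⟨w, rfl⟩, rfl⟩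
  simp only [he.mul]
  exact smul_mem _ _ (subset_span ⟨_, rfl⟩)

theorem IsFrame.comp (he : IsFrame h e) {u w : ℤ × ℤ} (hdet : u.1 * w.2 - u.2 * w.1 = 1) :
    IsFrame h (fun v => e (v.1 • u + v.2 • w)) := by
  have hinv (v : ℤ × ℤ) : (v.1 * w.2 - v.2 * w.1) • u + (u.1 * v.2 - u.2 * v.1) • w = v := by
    ext
    · simp; linear_combination v.1 * hdet
    · simp; linear_combination v.2 * hdet
  have hr : Set.range (fun v : ℤ × ℤ => e (v.1 • u + v.2 • w)) = Set.range e := by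
    ext d
    constructor
    · rintro ⟨v, rfl⟩
      exact ⟨_, rfl⟩
    · rintro ⟨v, rfl⟩
      exact ⟨(v.1 * w.2 - v.2 * w.1, u.1 * v.2 - u.2 * v.1), by simp only [hinv]⟩
  refine ⟨⟨he.h_ne_zero, fun v v' => ?_, ?_⟩, ?_⟩
  · rw [he.mul]
    congr 2
    · simp
      linear_combination (v.2 * v'.1 - v.1 * v'.2) * hdet
    · simp only [Prod.fst_add, Prod.snd_add]
      module
  · refine he.linearIndependent.comp (fun v : ℤ × ℤ => v.1 • u + v.2 • w) fun v v' hv => ?_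
    have h1 := congrArg Prod.fst hv
    have h2 := congrArg Prod.snd hv
    simp at h1 h2
    ext
    · linear_combination w.2 * h1 - w.1 * h2 - (v.1 - v'.1) * hdet
    · linear_combination u.1 * h2 - u.2 * h1 - (v.2 - v'.2) * hdet
  · rw [hr]
    exact he.frac

theorem isFrame_monomial {x y : D} (hh : h ≠ 0) (hD : IsQDivisionRing k D (h ^ 2) x y) :
    IsFrame h (monomial h y x) := by
  have hrel : x * y = h ^ 2 • (y * x) := by rw [hD.rel, Algebra.smul_def]
  have hmul := monomial_mul hh hD.x_ne_zero hD.y_ne_zero hrel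
  have hnat : LinearIndependent k fun p : ℕ × ℕ => monomial h y x ((p.1 : ℤ), (p.2 : ℤ)) := by
    have := hD.monomials_linearIndependent.units_smul
      (fun p => (Units.mk0 h hh) ^ ((p.1 : ℤ) * p.2))
    convert this using 1
    funext p
    simp [monomial, Units.smul_def]
  have hT : IsTorus h (monomial h y x) := by
    refine ⟨hh, hmul, ?_⟩
    rw [linearIndependent_iff']
    intro s g hg i hi
    obtain ⟨N, hN⟩ : ∃ N : ℤ, ∀ v ∈ s, 0 ≤ v.1 + N ∧ 0 ≤ v.2 + N := by
      refine ⟨∑ v ∈ s, (|v.1| + |v.2|), fun v hv => ?_⟩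
      have := Finset.single_le_sum (f := fun v : ℤ × ℤ => |v.1| + |v.2|)
        (fun v _ => by positivity) hv
      have h1 := neg_abs_le v.1
      have h2 := neg_abs_le v.2
      have h3 := abs_nonneg v.1
      have h4 := abs_nonneg v.2
      constructor <;> linarith
    have hli := hnat.comp (fun v : s => ((v.1.1 + N).toNat, (v.1.2 + N).toNat)) (by
      rintro ⟨v, hv⟩ ⟨w, hw⟩ hvw
      have h1 := hN v hv
      have h2 := hN w hw
      simp only [Prod.mk.injEq] at hvw
      ext <;> simp <;> omega)
    have hsum : ∑ v : s, (g v.1 * h ^ (v.1.2 * N - v.1.1 * N)) •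
        monomial h y x (v.1 + (N, N)) = 0 := by
      have h2 := congrArg (· * monomial h y x (N, N)) hg
      simp only [Finset.sum_mul, smul_mul_assoc, hmul, smul_smul, zero_mul] at h2
      rw [← Finset.sum_attach] at h2
      exact h2
    have := (linearIndependent_iff'.1 hli) Finset.univ
      (fun v => g v.1 * h ^ (v.1.2 * N - v.1.1 * N)) (by
        rw [← hsum]
        refine Finset.sum_congr rfl fun v _ => ?_
        have h1 := hN v.1 v.2
        simp only [Function.comp_apply, Int.toNat_of_nonneg h1.1, Int.toNat_of_nonneg h1.2]
        rfl) ⟨i, hi⟩ (Finset.mem_univ _)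
    exact (mul_eq_zero.1 this).resolve_right (zpow_ne_zero _ hh)
  refine ⟨hT, fun d => ?_⟩
  obtain ⟨s, t, hs, ht, ht0, rfl⟩ := hD.exists_frac d
  have hle : ∀ z ∈ Algebra.adjoin k ({x, y} : Set D), z ∈ span k (Set.range (monomial h y x)) := by
    intro z hz
    induction hz using Algebra.adjoin_induction with
    | mem z hz =>
      rcases hz with rfl | rfl
      · exact subset_span ⟨(0, 1), by simp [monomial]⟩
      · exact subset_span ⟨(1, 0), by simp [monomial]⟩
    | algebraMap r =>
      rw [Algebra.algebraMap_eq_smul_one, ← hT.one]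
      exact smul_mem _ _ (subset_span ⟨_, rfl⟩)
    | add a b _ _ ha hb => exact add_mem ha hb
    | mul a b _ _ ha hb => exact hT.span_mul_mem ha hb
  exact ⟨t, hle t ht, ht0, by rw [mul_inv_cancel_left₀ ht0]; exact hle s hs⟩

end Basic

section Extension

variable {h : k} {e e' : ℤ × ℤ → D}

/-- The multiplication of the quantum torus on coefficient vectors. -/
noncomputable def tmul (h : k) (a b : ℤ × ℤ →₀ k) : ℤ × ℤ →₀ k :=
  a.sum fun u r => b.sum fun w s =>
    Finsupp.single (u + w) (r * s * h ^ (u.2 * w.1 - u.1 * w.2))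

theorem IsTorus.lc_tmul (he : IsTorus h e) (a b : ℤ × ℤ →₀ k) :
    Finsupp.linearCombination k e (tmul h a b) =
      Finsupp.linearCombination k e a * Finsupp.linearCombination k e b := by
  simp only [tmul, Finsupp.sum, map_sum, Finsupp.linearCombination_single]
  simp only [Finsupp.linearCombination_apply, Finsupp.sum, Finset.sum_mul_sum,
    smul_mul_smul_comm, he.mul, smul_smul]

theorem IsTorus.lc_eq_zero (he : IsTorus h e) {a : ℤ × ℤ →₀ k} :
    Finsupp.linearCombination k e a = 0 ↔ a = 0 := by
  constructor
  · exact fun ha => linearIndependent_iff.1 he.linearIndependent a ha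
  · rintro rfl
    simp

theorem IsTorus.tmul_ne_zero (he : IsTorus h e) {a b : ℤ × ℤ →₀ k} (ha : a ≠ 0) (hb : b ≠ 0) :
    tmul h a b ≠ 0 := by
  rw [Ne, ← he.lc_eq_zero, he.lc_tmul, mul_eq_zero, he.lc_eq_zero, he.lc_eq_zero]
  tauto

theorem IsFrame.exists_lc (he : IsFrame h e) (d : D) : ∃ a b : ℤ × ℤ →₀ k, a ≠ 0 ∧
    Finsupp.linearCombination k e a * d = Finsupp.linearCombination k e b := by
  obtain ⟨t, ht, ht0, hd⟩ := he.frac d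
  rw [← Finsupp.range_linearCombination] at ht hd
  obtain ⟨a, rfl⟩ := ht
  obtain ⟨b, hb⟩ := hd
  exact ⟨a, b, fun h0 => ht0 (he.lc_eq_zero.2 h0), hb.symm⟩

/-- The left Ore condition. -/
theorem IsFrame.ore (he : IsFrame h e) (b : ℤ × ℤ →₀ k) {a : ℤ × ℤ →₀ k} (ha : a ≠ 0) :
    ∃ t s, t ≠ 0 ∧ tmul h t b = tmul h s a := by
  obtain ⟨t, s, ht, hs⟩ := he.exists_lc
    (Finsupp.linearCombination k e b * (Finsupp.linearCombination k e a)⁻¹)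
  refine ⟨t, s, ht, he.linearIndependent ?_⟩
  rw [he.lc_tmul, he.lc_tmul, ← hs, mul_assoc, inv_mul_cancel_right₀]
  rwa [Ne, he.lc_eq_zero]

/-- `d` and `d'` are given by the same left fraction of Laurent polynomials. -/
def FracRel (e e' : ℤ × ℤ → D) (d d' : D) : Prop :=
  ∃ a b : ℤ × ℤ →₀ k, a ≠ 0 ∧
    Finsupp.linearCombination k e a * d = Finsupp.linearCombination k e b ∧
    Finsupp.linearCombination k e' a * d' = Finsupp.linearCombination k e' b

theorem FracRel.unique (he : IsFrame h e) (he' : IsTorus h e') {d d₁ d₂ : D}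
    (h₁ : FracRel (k := k) e e' d d₁) (h₂ : FracRel (k := k) e e' d d₂) : d₁ = d₂ := by
  obtain ⟨a₁, b₁, ha₁, hd₁, hd₁'⟩ := h₁
  obtain ⟨a₂, b₂, ha₂, hd₂, hd₂'⟩ := h₂
  obtain ⟨t, s, ht, hts⟩ := he.ore a₁ ha₂
  have hb : tmul h t b₁ = tmul h s b₂ := by
    apply he.linearIndependent
    rw [he.lc_tmul, he.lc_tmul, ← hd₁, ← hd₂, ← mul_assoc, ← mul_assoc, ← he.lc_tmul,
      ← he.lc_tmul, hts]
  have h0 : Finsupp.linearCombination k e' (tmul h t a₁) ≠ 0 := by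
    rw [Ne, he'.lc_eq_zero]
    exact he'.tmul_ne_zero ht ha₁
  refine mul_left_cancel₀ h0 ?_
  conv_rhs => rw [hts]
  rw [he'.lc_tmul, he'.lc_tmul, mul_assoc, mul_assoc, hd₁', hd₂', ← he'.lc_tmul,
    ← he'.lc_tmul, hb]

theorem FracRel.exists_right (he : IsFrame h e) (he' : IsTorus h e') (d : D) :
    ∃ d', FracRel (k := k) e e' d d' := by
  obtain ⟨a, b, ha, hab⟩ := he.exists_lc d
  refine ⟨(Finsupp.linearCombination k e' a)⁻¹ * Finsupp.linearCombination k e' b, a, b, ha,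
    hab, ?_⟩
  rw [mul_inv_cancel_left₀]
  rwa [Ne, he'.lc_eq_zero]

theorem FracRel.lc (he : IsFrame h e) (he' : IsTorus h e') (b : ℤ × ℤ →₀ k) :
    FracRel (k := k) e e' (Finsupp.linearCombination k e b)
      (Finsupp.linearCombination k e' b) :=
  ⟨Finsupp.single 0 1, b, by simp, by simp [he.one], by simp [he'.one]⟩

theorem FracRel.add (he : IsFrame h e) (he' : IsTorus h e') {d₁ d₂ d₁' d₂' : D}
    (h₁ : FracRel (k := k) e e' d₁ d₁') (h₂ : FracRel (k := k) e e' d₂ d₂') :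
    FracRel (k := k) e e' (d₁ + d₂) (d₁' + d₂') := by
  obtain ⟨a₁, b₁, ha₁, hd₁, hd₁'⟩ := h₁
  obtain ⟨a₂, b₂, ha₂, hd₂, hd₂'⟩ := h₂
  obtain ⟨t, s, ht, hts⟩ := he.ore a₁ ha₂
  refine ⟨tmul h t a₁, tmul h t b₁ + tmul h s b₂, he.tmul_ne_zero ht ha₁, ?_, ?_⟩
  · rw [mul_add, map_add]
    congr 1
    · rw [he.lc_tmul, he.lc_tmul, mul_assoc, hd₁]
    · rw [hts, he.lc_tmul, he.lc_tmul, mul_assoc, hd₂]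
  · rw [mul_add, map_add]
    congr 1
    · rw [he'.lc_tmul, he'.lc_tmul, mul_assoc, hd₁']
    · rw [hts, he'.lc_tmul, he'.lc_tmul, mul_assoc, hd₂']

theorem FracRel.mul (he : IsFrame h e) (he' : IsTorus h e') {d₁ d₂ d₁' d₂' : D}
    (h₁ : FracRel (k := k) e e' d₁ d₁') (h₂ : FracRel (k := k) e e' d₂ d₂') :
    FracRel (k := k) e e' (d₁ * d₂) (d₁' * d₂') := by
  obtain ⟨a₁, b₁, ha₁, hd₁, hd₁'⟩ := h₁
  obtain ⟨a₂, b₂, ha₂, hd₂, hd₂'⟩ := h₂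
  obtain ⟨t, s, ht, hts⟩ := he.ore b₁ ha₂
  refine ⟨tmul h t a₁, tmul h s b₂, he.tmul_ne_zero ht ha₁, ?_, ?_⟩
  · rw [he.lc_tmul, he.lc_tmul, mul_assoc, ← mul_assoc _ d₁, hd₁, ← hd₂, ← mul_assoc,
      ← mul_assoc, ← he.lc_tmul, ← he.lc_tmul, hts]
  · rw [he'.lc_tmul, he'.lc_tmul, mul_assoc, ← mul_assoc _ d₁', hd₁', ← hd₂', ← mul_assoc,
      ← mul_assoc, ← he'.lc_tmul, ← he'.lc_tmul, hts]

/-- A quantum torus in `D` extends to an endomorphism of `D`. -/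
theorem IsFrame.exists_algHom (he : IsFrame h e) (he' : IsTorus h e') :
    ∃ F : D →ₐ[k] D, ∀ v, F (e v) = e' v := by
  choose F hF using FracRel.exists_right he he'
  have huniq {d d' : D} (hd : FracRel (k := k) e e' d d') : F d = d' := (hF d).unique he he' hd
  have hmon (v : ℤ × ℤ) : F (e v) = e' v := by
    have := FracRel.lc he he' (Finsupp.single v 1)
    simp only [Finsupp.linearCombination_single, one_smul] at this
    exact huniq this
  have hsc (r : k) : F (algebraMap k D r) = algebraMap k D r := by
    have := FracRel.lc he he' (Finsupp.single 0 r)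
    simp only [Finsupp.linearCombination_single, he.one, he'.one,
      ← Algebra.algebraMap_eq_smul_one] at this
    exact huniq this
  refine ⟨{ toFun := F
            map_one' := by simpa using hsc 1
            map_mul' := fun a b => huniq ((hF a).mul he he' (hF b))
            map_zero' := by simpa using hsc 0
            map_add' := fun a b => huniq ((hF a).add he he' (hF b))
            commutes' := hsc }, hmon⟩

/-- Subalgebras closed under inverses and containing the generators are everything. -/
theorem IsFrame.eq_top (he : IsFrame h e) (C : Subalgebra k D) (hC : ∀ d ∈ C, d⁻¹ ∈ C)
    (h1 : e (1, 0) ∈ C) (h2 : e (0, 1) ∈ C) : C = ⊤ := by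
  have hz (d : D) (hd : d ∈ C) (n : ℤ) : d ^ n ∈ C := by
    cases n with
    | ofNat n => simpa using pow_mem hd n
    | negSucc n => rw [zpow_negSucc]; exact hC _ (pow_mem hd _)
  have hspan : ∀ s ∈ span k (Set.range e), s ∈ C := by
    intro s hs
    refine (span_le (p := Subalgebra.toSubmodule C)).2 ?_ hs
    rintro _ ⟨v, rfl⟩
    rw [he.eq_monomial]
    exact C.smul_mem (mul_mem (hz _ h1 _) (hz _ h2 _)) _
  refine eq_top_iff.2 fun d _ => ?_
  obtain ⟨t, ht, ht0, hd⟩ := he.frac d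
  rw [← inv_mul_cancel_left₀ ht0 d]
  exact mul_mem (hC _ (hspan _ ht)) (hspan _ hd)

theorem IsFrame.algHom_ext (he : IsFrame h e) {F F' : D →ₐ[k] D}
    (h1 : F (e (1, 0)) = F' (e (1, 0))) (h2 : F (e (0, 1)) = F' (e (0, 1))) : F = F' := by
  have := he.eq_top (AlgHom.equalizer F F') (fun d hd => by
    rw [AlgHom.mem_equalizer] at hd ⊢
    rw [map_inv₀, map_inv₀, hd]) h1 h2
  ext d
  have hd : d ∈ AlgHom.equalizer F F' := this ▸ Algebra.mem_top
  exact hd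

end Extension

section Lead

variable {h : k} {e : ℤ × ℤ → D}

/-- The lexicographic order on exponents in which the second coordinate dominates. -/
def Below (v w : ℤ × ℤ) : Prop := v.2 < w.2 ∨ v.2 = w.2 ∧ v.1 < w.1

theorem Below.add_left {v w : ℤ × ℤ} (u : ℤ × ℤ) (hvw : Below v w) : Below (u + v) (u + w) := by
  simp only [Below, Prod.fst_add, Prod.snd_add] at *
  omega

theorem below_trichotomy (v w : ℤ × ℤ) : Below v w ∨ v = w ∨ Below w v := by
  simp only [Below, Prod.ext_iff]
  omega

variable (k e) in
/-- The span of the monomials strictly below `α`. -/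
def Fil (α : ℤ × ℤ) : Submodule k D := span k (e '' {v | Below v α})

variable (k e) in
/-- `α` is the leading exponent of the Laurent polynomial `s`. -/
def Top (s : D) (α : ℤ × ℤ) : Prop := ∃ c : k, c ≠ 0 ∧ s - c • e α ∈ Fil k e α

theorem mem_fil {v α : ℤ × ℤ} (hv : Below v α) : e v ∈ Fil k e α :=
  subset_span ⟨v, hv, rfl⟩

theorem fil_mono {α β : ℤ × ℤ} (hab : ¬ Below β α) : Fil k e α ≤ Fil k e β := by
  refine span_mono (Set.image_mono fun v hv => ?_)
  simp only [Below, Set.mem_ofPred_eq] at *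
  omega

theorem IsTorus.mul_mem_fil (he : IsTorus h e) {α β : ℤ × ℤ} {r : D} (hr : r ∈ Fil k e β) :
    e α * r ∈ Fil k e (α + β) := by
  induction hr using span_induction with
  | mem x hx =>
    obtain ⟨v, hv, rfl⟩ := hx
    rw [he.mul]
    exact smul_mem _ _ (mem_fil (hv.add_left α))
  | zero => simp
  | add x y _ _ hx hy => rw [mul_add]; exact add_mem hx hy
  | smul c x _ hx => rw [mul_smul_comm]; exact smul_mem _ _ hx

theorem IsTorus.fil_mul_mem (he : IsTorus h e) {α β : ℤ × ℤ} {r : D} (hr : r ∈ Fil k e α) :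
    r * e β ∈ Fil k e (α + β) := by
  induction hr using span_induction with
  | mem x hx =>
    obtain ⟨v, hv, rfl⟩ := hx
    rw [he.mul, add_comm α, add_comm v]
    exact smul_mem _ _ (mem_fil (hv.add_left β))
  | zero => simp
  | add x y _ _ hx hy => rw [add_mul]; exact add_mem hx hy
  | smul c x _ hx => rw [smul_mul_assoc]; exact smul_mem _ _ hx

theorem IsTorus.fil_mul_fil_mem (he : IsTorus h e) {α β : ℤ × ℤ} {r s : D}
    (hr : r ∈ Fil k e α) (hs : s ∈ Fil k e β) : r * s ∈ Fil k e (α + β) := by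
  induction hr using span_induction with
  | mem x hx =>
    obtain ⟨v, hv, rfl⟩ := hx
    refine fil_mono ?_ (he.mul_mem_fil (α := v) hs)
    simp only [Below, Set.mem_ofPred_eq, Prod.fst_add, Prod.snd_add] at *
    omega
  | zero => simp
  | add x y _ _ hx hy => rw [add_mul]; exact add_mem hx hy
  | smul c x _ hx => rw [smul_mul_assoc]; exact smul_mem _ _ hx

theorem IsTorus.top_mul_mem (he : IsTorus h e) {α β : ℤ × ℤ} {s r : D} (hs : Top k e s α)
    (hr : r ∈ Fil k e β) : s * r ∈ Fil k e (α + β) := by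
  obtain ⟨c, -, hc⟩ := hs
  have := add_mem (he.fil_mul_fil_mem hc hr) (smul_mem _ c (he.mul_mem_fil (α := α) hr))
  convert this using 1
  rw [sub_mul, smul_mul_assoc, sub_add_cancel]

theorem Top.mul (he : IsTorus h e) {α β : ℤ × ℤ} {s t : D} (hs : Top k e s α)
    (ht : Top k e t β) : Top k e (s * t) (α + β) := by
  obtain ⟨d, hd0, hd⟩ := ht
  have h1 := he.top_mul_mem hs hd
  obtain ⟨c, hc0, hc⟩ := hs
  refine ⟨c * d * h ^ (α.2 * β.1 - α.1 * β.2),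
    mul_ne_zero (mul_ne_zero hc0 hd0) (zpow_ne_zero _ he.h_ne_zero), ?_⟩
  have := add_mem h1 (smul_mem _ d (he.fil_mul_mem (β := β) hc))
  convert this using 1
  simp only [mul_sub, sub_mul, smul_mul_assoc, mul_smul_comm, he.mul]
  module

theorem Top.mem_fil {s : D} {α β : ℤ × ℤ} (hs : Top k e s α) (hab : Below α β) :
    s ∈ Fil k e β := by
  obtain ⟨c, -, hc⟩ := hs
  rw [← sub_add_cancel s (c • e α)]
  refine add_mem (fil_mono ?_ hc) (smul_mem _ _ (QuantumTorus.mem_fil hab))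
  simp only [Below] at *
  omega

theorem IsTorus.top_notMem_fil (he : IsTorus h e) {s : D} {α : ℤ × ℤ} (hs : Top k e s α) :
    s ∉ Fil k e α := by
  intro hm
  obtain ⟨c, hc0, hc⟩ := hs
  have h1 := smul_mem _ c⁻¹ (sub_mem hm hc)
  rw [sub_sub_cancel, smul_smul, inv_mul_cancel₀ hc0, one_smul] at h1
  refine he.linearIndependent.notMem_span_image (s := {v | Below v α}) ?_ h1
  simp [Below]

theorem IsTorus.top_ne_zero (he : IsTorus h e) {s : D} {α : ℤ × ℤ} (hs : Top k e s α) :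
    s ≠ 0 := by
  rintro rfl
  exact he.top_notMem_fil hs (zero_mem _)

theorem Top.unique (he : IsTorus h e) {s : D} {α β : ℤ × ℤ} (hα : Top k e s α)
    (hβ : Top k e s β) : α = β := by
  rcases below_trichotomy α β with h1 | h1 | h1
  · exact absurd (hα.mem_fil h1) (he.top_notMem_fil hβ)
  · exact h1
  · exact absurd (hβ.mem_fil h1) (he.top_notMem_fil hα)

theorem exists_top {s : D} (hs : s ∈ span k (Set.range e)) (h0 : s ≠ 0) :
    ∃ α, Top k e s α := by
  rw [← Finsupp.range_linearCombination] at hs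
  obtain ⟨a, rfl⟩ := hs
  have hne : a.support.Nonempty := by
    rw [Finsupp.support_nonempty_iff]
    rintro rfl
    simp at h0
  obtain ⟨α, hα, hmax⟩ := a.support.exists_max_image (fun v => toLex (v.2, v.1)) hne
  refine ⟨α, a α, Finsupp.mem_support_iff.1 hα, ?_⟩
  rw [Finsupp.linearCombination_apply, Finsupp.sum, ← Finset.sum_erase_add _ _ hα,
    add_sub_cancel_right]
  refine sum_mem fun v hv => smul_mem _ _ (mem_fil ?_)
  rw [Finset.mem_erase] at hv
  have h1 := hmax v hv.2
  have h2 := hv.1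
  rw [Prod.Lex.toLex_le_toLex] at h1
  simp only [Ne, Prod.ext_iff, Below] at *
  omega

variable (k e) in
/-- `v` is the leading exponent of the fraction `d`. -/
def Lead (d : D) (v : ℤ × ℤ) : Prop := ∃ t α, Top k e t α ∧ Top k e (t * d) (α + v)

variable (k e) in
/-- The fraction `d` is zero or has leading exponent below `v`. -/
def LeadLt (d : D) (v : ℤ × ℤ) : Prop := ∃ t α, Top k e t α ∧ t * d ∈ Fil k e (α + v)

theorem top_monomial (v : ℤ × ℤ) : Top k e (e v) v := ⟨1, one_ne_zero, by simp⟩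

theorem Top.lead (he : IsTorus h e) {s : D} {v : ℤ × ℤ} (hs : Top k e s v) : Lead k e s v :=
  ⟨1, 0, he.one ▸ top_monomial 0, by simpa using hs⟩

theorem lead_monomial (he : IsTorus h e) (v : ℤ × ℤ) : Lead k e (e v) v :=
  (top_monomial v).lead he

theorem Lead.ne_zero (he : IsTorus h e) {d : D} {v : ℤ × ℤ} (hd : Lead k e d v) : d ≠ 0 := by
  rintro rfl
  obtain ⟨t, α, -, hs⟩ := hd
  exact he.top_ne_zero hs (mul_zero t)

theorem Top.smul {c : k} (hc : c ≠ 0) {s : D} {v : ℤ × ℤ} (hs : Top k e s v) :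
    Top k e (c • s) v := by
  obtain ⟨d, hd0, hd⟩ := hs
  refine ⟨c * d, mul_ne_zero hc hd0, ?_⟩
  rw [mul_smul, ← smul_sub]
  exact smul_mem _ _ hd

theorem Lead.smul {c : k} (hc : c ≠ 0) {d : D} {v : ℤ × ℤ} (hd : Lead k e d v) :
    Lead k e (c • d) v := by
  obtain ⟨t, α, ht, hs⟩ := hd
  exact ⟨t, α, ht, by rw [mul_smul_comm]; exact hs.smul hc⟩

/-- The left Ore condition together with the leading exponents. -/
theorem IsFrame.ore_top (he : IsFrame h e) {s₁ t₂ : D} {α β : ℤ × ℤ} (hs : Top k e s₁ α)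
    (ht : Top k e t₂ β) :
    ∃ t s τ σ, Top k e t τ ∧ Top k e s σ ∧ t * s₁ = s * t₂ ∧ τ + α = σ + β := by
  have hs0 := he.top_ne_zero hs
  have ht0 := he.top_ne_zero ht
  obtain ⟨t, htm, htn, hsm⟩ := he.frac (s₁ * t₂⁻¹)
  have hn : t * (s₁ * t₂⁻¹) ≠ 0 := mul_ne_zero htn (mul_ne_zero hs0 (inv_ne_zero ht0))
  obtain ⟨τ, hτ⟩ := exists_top htm htn
  obtain ⟨σ, hσ⟩ := exists_top hsm hn
  have heq : t * s₁ = t * (s₁ * t₂⁻¹) * t₂ := by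
    rw [mul_assoc, inv_mul_cancel_right₀ ht0]
  refine ⟨t, _, τ, σ, hτ, hσ, heq, ?_⟩
  have h1 := hτ.mul he.toIsTorus hs
  rw [heq] at h1
  exact h1.unique he.toIsTorus (hσ.mul he.toIsTorus ht)

theorem Lead.mul (he : IsFrame h e) {d g : D} {v w : ℤ × ℤ} (hd : Lead k e d v)
    (hg : Lead k e g w) : Lead k e (d * g) (v + w) := by
  obtain ⟨t₁, α₁, ht₁, hs₁⟩ := hd
  obtain ⟨t₂, α₂, ht₂, hs₂⟩ := hg
  obtain ⟨t, s, τ, σ, hτ, hσ, hts, hdeg⟩ := he.ore_top hs₁ ht₂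
  refine ⟨t * t₁, τ + α₁, hτ.mul he.toIsTorus ht₁, ?_⟩
  have h1 := hσ.mul he.toIsTorus hs₂
  rw [← mul_assoc, ← hts] at h1
  convert h1 using 1
  · simp only [mul_assoc]
  · rw [← add_assoc σ, ← hdeg]
    abel

theorem Lead.inv (he : IsTorus h e) {d : D} {v : ℤ × ℤ} (hd : Lead k e d v) :
    Lead k e d⁻¹ (-v) := by
  have h0 := hd.ne_zero he
  obtain ⟨t, α, ht, hs⟩ := hd
  exact ⟨t * d, α + v, hs, by rw [mul_inv_cancel_right₀ h0, add_neg_cancel_right]; exact ht⟩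

theorem Lead.zpow (he : IsFrame h e) {d : D} {v : ℤ × ℤ} (hd : Lead k e d v) (n : ℤ) :
    Lead k e (d ^ n) (n • v) := by
  have hn (n : ℕ) : Lead k e (d ^ n) (n • v) := by
    induction n with
    | zero =>
      rw [pow_zero, zero_nsmul, ← he.one]
      exact lead_monomial he.toIsTorus 0
    | succ n ih =>
      rw [pow_succ, succ_nsmul]
      exact ih.mul he hd
  cases n with
  | ofNat n => simpa using hn n
  | negSucc n =>
    rw [zpow_negSucc, negSucc_zsmul]
    exact (hn _).inv he.toIsTorus

theorem LeadLt.add (he : IsFrame h e) {d g : D} {v : ℤ × ℤ} (hd : LeadLt k e d v)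
    (hg : LeadLt k e g v) : LeadLt k e (d + g) v := by
  obtain ⟨t₁, α₁, ht₁, hs₁⟩ := hd
  obtain ⟨t₂, α₂, ht₂, hs₂⟩ := hg
  obtain ⟨t, s, τ, σ, hτ, hσ, hts, hdeg⟩ := he.ore_top ht₁ ht₂
  refine ⟨t * t₁, τ + α₁, hτ.mul he.toIsTorus ht₁, ?_⟩
  rw [mul_add]
  refine add_mem ?_ ?_
  · rw [mul_assoc, add_assoc]
    exact he.top_mul_mem hτ hs₁
  · rw [hts, mul_assoc, hdeg, add_assoc]
    exact he.top_mul_mem hσ hs₂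

theorem Lead.add (he : IsFrame h e) {d g : D} {v : ℤ × ℤ} (hd : Lead k e d v)
    (hg : LeadLt k e g v) : Lead k e (d + g) v := by
  obtain ⟨t₁, α₁, ht₁, hs₁⟩ := hd
  obtain ⟨t₂, α₂, ht₂, hs₂⟩ := hg
  obtain ⟨t, s, τ, σ, hτ, hσ, hts, hdeg⟩ := he.ore_top ht₁ ht₂
  refine ⟨t * t₁, τ + α₁, hτ.mul he.toIsTorus ht₁, ?_⟩
  have h1 := he.top_mul_mem hσ hs₂
  obtain ⟨c, hc0, hc⟩ := hτ.mul he.toIsTorus hs₁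
  refine ⟨c, hc0, ?_⟩
  rw [← mul_assoc, ← hts, ← add_assoc, ← hdeg] at h1
  rw [← mul_assoc, ← add_assoc] at hc
  rw [mul_add, add_sub_right_comm]
  exact add_mem hc h1

theorem LeadLt.smul (c : k) {d : D} {v : ℤ × ℤ} (hd : LeadLt k e d v) :
    LeadLt k e (c • d) v := by
  obtain ⟨t, α, ht, hs⟩ := hd
  exact ⟨t, α, ht, by rw [mul_smul_comm]; exact smul_mem _ _ hs⟩

theorem LeadLt.neg {d : D} {v : ℤ × ℤ} (hd : LeadLt k e d v) : LeadLt k e (-d) v := by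
  simpa using hd.smul (-1 : k)

theorem leadLt_zero (v : ℤ × ℤ) : LeadLt k e (0 : D) v :=
  ⟨e 0, 0, top_monomial 0, by simp⟩

theorem Lead.leadLt {d : D} {v w : ℤ × ℤ} (hd : Lead k e d v) (hvw : Below v w) :
    LeadLt k e d w := by
  obtain ⟨t, α, ht, hs⟩ := hd
  exact ⟨t, α, ht, hs.mem_fil (hvw.add_left α)⟩

theorem Lead.not_leadLt (he : IsFrame h e) {d : D} {v : ℤ × ℤ} (hd : Lead k e d v) :
    ¬ LeadLt k e d v := by
  rintro ⟨t₂, α₂, ht₂, hs₂⟩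
  obtain ⟨t₁, α₁, ht₁, hs₁⟩ := hd
  obtain ⟨t, s, τ, σ, hτ, hσ, hts, hdeg⟩ := he.ore_top ht₁ ht₂
  refine he.top_notMem_fil (hτ.mul he.toIsTorus hs₁) ?_
  rw [← mul_assoc, hts, mul_assoc, ← add_assoc, hdeg, add_assoc]
  exact he.top_mul_mem hσ hs₂

theorem IsFrame.linearIndependent_of_lead (he : IsFrame h e) {ι : Type*} {b : ι → D}
    {v : ι → ℤ × ℤ} (hv : Function.Injective v) (hb : ∀ i, Lead k e (b i) (v i)) :
    LinearIndependent k b := by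
  classical
  rw [linearIndependent_iff']
  intro s g hg
  by_contra! hne
  obtain ⟨i₀, hi₀, hgi₀⟩ := hne
  obtain ⟨i, hi, hmax⟩ := (s.filter fun i => g i ≠ 0).exists_max_image
    (fun i => toLex ((v i).2, (v i).1)) ⟨i₀, by simp [hi₀, hgi₀]⟩
  rw [Finset.mem_filter] at hi
  have hrest : LeadLt k e (∑ j ∈ s.erase i, g j • b j) (v i) := by
    refine Finset.sum_induction _ (fun d => LeadLt k e d (v i)) (fun _ _ => LeadLt.add he)
      (leadLt_zero _) fun j hj => ?_
    rw [Finset.mem_erase] at hj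
    by_cases hgj : g j = 0
    · rw [hgj, zero_smul]
      exact leadLt_zero _
    · refine ((hb j).leadLt ?_).smul _
      have h1 := hmax j (by simp [hj.2, hgj])
      have h2 : v j ≠ v i := fun h => hj.1 (hv h)
      rw [Prod.Lex.toLex_le_toLex] at h1
      simp only [Ne, Prod.ext_iff, Below] at *
      omega
  have hi' := ((hb i).smul hi.2)
  rw [← Finset.sum_erase_add _ _ hi.1, ← eq_neg_iff_add_eq_zero] at hg
  refine hi'.not_leadLt he ?_
  have := hrest.neg
  rwa [hg, neg_neg] at this

/-- A pair of `q`-commuting elements with independent leading exponents generates a torus. -/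
theorem IsFrame.isTorus_monomial (he : IsFrame h e) {y x : D} (hr : x * y = h ^ 2 • (y * x))
    {v w : ℤ × ℤ} (hy : Lead k e y v) (hx : Lead k e x w)
    (hdet : v.1 * w.2 - v.2 * w.1 ≠ 0) : IsTorus h (monomial h y x) where
  h_ne_zero := he.h_ne_zero
  mul := monomial_mul he.h_ne_zero (hx.ne_zero he.toIsTorus) (hy.ne_zero he.toIsTorus) hr
  linearIndependent := by
    refine he.linearIndependent_of_lead (v := fun u : ℤ × ℤ => u.1 • v + u.2 • w) ?_
      fun u => ((hy.zpow he u.1).mul he (hx.zpow he u.2)).smul (zpow_ne_zero _ he.h_ne_zero)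
    intro u u' hu
    have h1 := congrArg Prod.fst hu
    have h2 := congrArg Prod.snd hu
    simp at h1 h2
    ext
    · refine mul_right_cancel₀ hdet ?_
      linear_combination w.2 * h1 - w.1 * h2
    · refine mul_right_cancel₀ hdet ?_
      linear_combination v.1 * h2 - v.2 * h1

end Lead

theorem inv_mem_range (F : D →ₐ[k] D) {d : D} (hd : d ∈ F.range) : d⁻¹ ∈ F.range := by
  obtain ⟨a, rfl⟩ := hd
  exact ⟨a⁻¹, map_inv₀ F a⟩

/-- A finitely generated left subspace over the range of `F` which is stable under right
multiplication by generators of `D` is all of `D`. -/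
theorem eq_top_of_mul_mem (F : D →ₐ[k] D) (V : Submodule F.range D) (hfg : V.FG)
    (h1 : (1 : D) ∈ V) (S : Set D)
    (hS : ∀ C : Subalgebra k D, (∀ d ∈ C, d⁻¹ ∈ C) → S ⊆ C → C = ⊤)
    (hV : ∀ s ∈ S, ∀ v ∈ V, v * s ∈ V) : V = ⊤ := by
  have : IsArtinianRing F.range :=
    (F.rangeRestrict_surjective).isArtinianRing (f := F.rangeRestrict.toRingHom)
  have : Module.Finite F.range V := Module.Finite.iff_fg.2 hfg
  let C : Subalgebra k D :=
    { carrier := {d | ∀ v ∈ V, v * d ∈ V}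
      mul_mem' := fun {a b} ha hb v hv => by rw [← mul_assoc]; exact hb _ (ha _ hv)
      add_mem' := fun {a b} ha hb v hv => by rw [mul_add]; exact add_mem (ha _ hv) (hb _ hv)
      algebraMap_mem' := fun r v hv => by
        rw [← Algebra.commutes]
        exact V.smul_mem (algebraMap k F.range r) hv }
  have hC := hS C (fun d hd => by
    by_cases h0 : d = 0
    · simp [h0]
    let f : V →ₗ[F.range] V :=
      { toFun := fun v => ⟨v * d, hd v v.2⟩
        map_add' := fun a b => by ext; simp [add_mul]
        map_smul' := fun r a => by ext; simp [Subalgebra.smul_def, mul_assoc] }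
    have hf : Function.Injective f := fun a b hab => by
      ext
      exact mul_right_cancel₀ h0 (congrArg Subtype.val hab)
    have hf' : Function.Surjective f := IsArtinian.surjective_of_injective_endomorphism f hf
    intro v hv
    obtain ⟨w, hw⟩ := hf' ⟨v, hv⟩
    have hw' : (w : D) * d = v := congrArg Subtype.val hw
    rw [← hw', mul_inv_cancel_right₀ h0]
    exact w.2) hV
  refine eq_top_iff.2 fun d _ => ?_
  have hd : d ∈ C := hC ▸ Algebra.mem_top
  simpa using hd 1 h1

/-- Relations between two `q`-commuting elements `y`, `x` and scalar multiples `y'`, `x'` of their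
inverses, together with the invariants `f`, `G` of the involution `y ↔ y'`, `x ↔ x'`. -/
structure InversionData (q ε c : k) (y y' x x' f G : D) : Prop where
  q_ne_zero : q ≠ 0
  yy : y * y' = ε • 1
  yy' : y' * y = ε • 1
  xx : x * x' = c • 1
  xx' : x' * x = c • 1
  xy : x * y = q • (y * x)
  xy' : x * y' = q⁻¹ • (y' * x)
  x'y : x' * y = q⁻¹ • (y * x')
  x'y' : x' * y' = q • (y' * x')
  z_ne_zero : y - y' ≠ 0
  zf : (y - y') * f = x - x'
  zG : (y - y') * G = y * x - y' * x'

namespace InversionData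

variable {q ε c : k} {y y' x x' f G : D} (H : InversionData q ε c y y' x x' f G)
include H

theorem y_mul_f : y * f = G - x' := by
  refine mul_left_cancel₀ H.z_ne_zero ?_
  have h1 : (y - y') * (y * f) = y * ((y - y') * f) := by
    rw [← mul_assoc, ← mul_assoc]
    congr 1
    rw [sub_mul, mul_sub, H.yy, H.yy']
  rw [h1, H.zf, mul_sub, mul_sub, H.zG, sub_mul]
  abel

theorem y'_mul_f : y' * f = G - x := by
  have h1 := H.y_mul_f
  have h2 := H.zf
  rw [sub_mul, h1] at h2
  linear_combination (norm := module) -h2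

theorem f_mul_G : f * G = q • (G * f) := by
  have hz := H.z_ne_zero
  set w := (y - y')⁻¹ with hw
  have hyz : Commute y (y - y') := by
    rw [Commute, SemiconjBy, mul_sub, sub_mul, H.yy, H.yy']
  have hyz' : Commute y' (y - y') := by
    rw [Commute, SemiconjBy, mul_sub, sub_mul, H.yy, H.yy']
  have hwy : w * y = y * w := (hyz.inv_right₀).eq.symm
  have hwy' : w * y' = y' * w := (hyz'.inv_right₀).eq.symm
  have hf : f = w * (x - x') := by rw [← H.zf, hw, inv_mul_cancel_left₀ hz]
  have hG : G = w * (y * x - y' * x') := by rw [← H.zG, hw, inv_mul_cancel_left₀ hz]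
  have a1 (t : D) : w * (y * t) = y * (w * t) := by rw [← mul_assoc, hwy, mul_assoc]
  have a2 (t : D) : w * (y' * t) = y' * (w * t) := by rw [← mul_assoc, hwy', mul_assoc]
  have a3 (t : D) : x * (y * t) = q • (y * (x * t)) := by
    rw [← mul_assoc, H.xy, smul_mul_assoc, mul_assoc]
  have a4 (t : D) : x * (y' * t) = q⁻¹ • (y' * (x * t)) := by
    rw [← mul_assoc, H.xy', smul_mul_assoc, mul_assoc]
  have a5 (t : D) : x' * (y * t) = q⁻¹ • (y * (x' * t)) := by
    rw [← mul_assoc, H.x'y, smul_mul_assoc, mul_assoc]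
  have a6 (t : D) : x' * (y' * t) = q • (y' * (x' * t)) := by
    rw [← mul_assoc, H.x'y', smul_mul_assoc, mul_assoc]
  have b1 : q • (y * (x * (w * x'))) - q⁻¹ • (y' * (x * (w * x'))) = c • 1 := by
    rw [← a3, ← a4, ← mul_sub, ← sub_mul, mul_inv_cancel_left₀ hz, H.xx]
  have b2 : q⁻¹ • (y * (x' * (w * x))) - q • (y' * (x' * (w * x))) = c • 1 := by
    rw [← a5, ← a6, ← mul_sub, ← sub_mul, mul_inv_cancel_left₀ hz, H.xx']
  have hq := H.q_ne_zero
  have key : (x - x') * (w * (y * x - y' * x')) =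
      q • ((y * x - y' * x') * (w * (x - x'))) := by
    simp only [mul_sub, sub_mul, mul_assoc, a1, a2, a3, a4, a5, a6, smul_sub]
    linear_combination (norm := (match_scalars <;> field_simp <;> ring)) b1 - b2
  rw [hf, hG, mul_assoc, key, mul_smul_comm, mul_assoc]

theorem sum_mul : (y + y') * (f * G) = G * G + (q * ε) • (f * f) - c • 1 := by
  have h1 := H.y_mul_f
  have h2 := H.y'_mul_f
  have h3 := H.f_mul_G
  have e1 : y * f * G = G * G - x' * G := by rw [h1, sub_mul]
  have e2 : y' * f * G = q • (y' * (G * f)) := by rw [mul_assoc, h3, mul_smul_comm]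
  have e3 : x' * G = c • 1 + q • (y' * (x' * f)) := by
    have : G = x + y' * f := by rw [h2]; abel
    rw [this, mul_add, H.xx', ← mul_assoc x', H.x'y', smul_mul_assoc, mul_assoc]
  have e4 : y' * (G * f) - y' * (x' * f) = ε • (f * f) := by
    rw [← mul_sub, ← sub_mul, ← h1, ← mul_assoc, ← mul_assoc, H.yy', smul_mul_assoc, one_mul,
      smul_mul_assoc]
  rw [add_mul, ← mul_assoc, ← mul_assoc, e1, e2, e3]
  linear_combination (norm := module) q • e4

theorem add_x : x + x' = (2 : k) • G - (y + y') * f := by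
  rw [add_mul, H.y_mul_f, H.y'_mul_f]
  module

variable (E : Subalgebra k D) (hE : ∀ d ∈ E, d⁻¹ ∈ E) (hf : f ∈ E) (hG : G ∈ E)
  (hf0 : f ≠ 0) (hG0 : G ≠ 0)
include hE hf hG hf0 hG0

theorem sum_mem : y + y' ∈ E := by
  have h1 := H.sum_mul
  rw [← eq_mul_inv_iff_mul_eq₀ (mul_ne_zero hf0 hG0)] at h1
  rw [h1]
  exact mul_mem (sub_mem (add_mem (mul_mem hG hG) (E.smul_mem (mul_mem hf hf) _))
    (E.smul_mem (one_mem _) _)) (hE _ (mul_mem hf hG))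

theorem sum_x_mem : x + x' ∈ E := by
  rw [H.add_x]
  exact sub_mem (E.smul_mem hG _) (mul_mem (H.sum_mem E hE hf hG hf0 hG0) hf)

theorem sq_mem : (y - y') * (y - y') ∈ E := by
  have hs := H.sum_mem E hE hf hG hf0 hG0
  have : (y - y') * (y - y') = (y + y') * (y + y') - (4 * ε) • 1 := by
    simp only [mul_sub, sub_mul, mul_add, add_mul, H.yy, H.yy']
    module
  rw [this]
  exact sub_mem (mul_mem hs hs) (E.smul_mem (one_mem _) _)

theorem mem_of_mul_mul {r : D} (hr : (y - y') * r * (y - y') ∈ E) :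
    ∃ r' ∈ E, (y - y') * r = r' * (y - y') := by
  have h2 := H.sq_mem E hE hf hG hf0 hG0
  refine ⟨(y - y') * r * (y - y') * ((y - y') * (y - y'))⁻¹, mul_mem hr (hE _ h2), ?_⟩
  simp only [mul_inv_rev, mul_assoc, inv_mul_cancel₀ H.z_ne_zero, mul_one,
    mul_inv_cancel₀ H.z_ne_zero]

variable [CharZero k]

theorem P_mem : y * x + y' * x' ∈ E ∧ y * x' + y' * x ∈ E := by
  have hs := H.sum_mem E hE hf hG hf0 hG0
  have ht := H.sum_x_mem E hE hf hG hf0 hG0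
  have h2 := H.sq_mem E hE hf hG hf0 hG0
  have h3 : (y - y') * (y - y') * f ∈ E := mul_mem h2 hf
  rw [mul_assoc, H.zf] at h3
  have h4 := mul_mem hs ht
  have e1 : y * x + y' * x' = (2⁻¹ : k) • ((y + y') * (x + x') + (y - y') * (x - x')) := by
    simp only [mul_sub, sub_mul, mul_add, add_mul]
    module
  have e2 : y * x' + y' * x = (2⁻¹ : k) • ((y + y') * (x + x') - (y - y') * (x - x')) := by
    simp only [mul_sub, sub_mul, mul_add, add_mul]
    module
  rw [e1, e2]
  exact ⟨E.smul_mem (add_mem h4 h3) _, E.smul_mem (sub_mem h4 h3) _⟩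

theorem zf_mem : ∃ r ∈ E, (y - y') * f = r * (y - y') := by
  obtain ⟨hP, hQ⟩ := H.P_mem E hE hf hG hf0 hG0
  refine H.mem_of_mul_mul E hE hf hG hf0 hG0 ?_
  have : (y - y') * f * (y - y') = q • (y * x + y' * x') - q⁻¹ • (y * x' + y' * x) := by
    rw [H.zf]
    simp only [mul_sub, sub_mul, H.xy, H.xy', H.x'y, H.x'y']
    module
  rw [this]
  exact sub_mem (E.smul_mem hP _) (E.smul_mem hQ _)

theorem zG_mem : ∃ r ∈ E, (y - y') * G = r * (y - y') := by
  obtain ⟨hP, hQ⟩ := H.P_mem E hE hf hG hf0 hG0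
  have hs := H.sum_mem E hE hf hG hf0 hG0
  have ht := H.sum_x_mem E hE hf hG hf0 hG0
  refine H.mem_of_mul_mul E hE hf hG hf0 hG0 ?_
  have a1 (t : D) : y * (y' * t) = ε • t := by rw [← mul_assoc, H.yy, smul_mul_assoc, one_mul]
  have a2 (t : D) : y' * (y * t) = ε • t := by rw [← mul_assoc, H.yy', smul_mul_assoc, one_mul]
  have : (y - y') * G * (y - y') = q • ((y + y') * (y * x + y' * x') - ε • (x + x')) -
      (q⁻¹ * ε) • (x + x') := by
    rw [H.zG]
    simp only [mul_sub, sub_mul, mul_add, add_mul, mul_assoc, H.xy, H.xy', H.x'y, H.x'y',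
      mul_smul_comm, a1, a2]
    module
  rw [this]
  exact sub_mem (E.smul_mem (sub_mem (mul_mem hs hP) (E.smul_mem ht _)) _) (E.smul_mem ht _)

end InversionData

theorem inversionData {q ε c : k} (hq : q ≠ 0) {y x : D} (hy0 : y ≠ 0) (hx0 : x ≠ 0)
    (hz0 : y - ε • y⁻¹ ≠ 0) (hxy : x * y = q • (y * x)) :
    InversionData q ε c y (ε • y⁻¹) x (c • x⁻¹) ((y - ε • y⁻¹)⁻¹ * (x - c • x⁻¹))
      ((y - ε • y⁻¹)⁻¹ * (y * x - ε • y⁻¹ * c • x⁻¹)) where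
  q_ne_zero := hq
  yy := by rw [mul_smul_comm, mul_inv_cancel₀ hy0]
  yy' := by rw [smul_mul_assoc, inv_mul_cancel₀ hy0]
  xx := by rw [mul_smul_comm, mul_inv_cancel₀ hx0]
  xx' := by rw [smul_mul_assoc, inv_mul_cancel₀ hx0]
  xy := hxy
  xy' := by
    have := zpow_comm_of_rel hxy (-1) 1
    simp only [zpow_neg, zpow_one, neg_mul, one_mul] at this
    rw [mul_smul_comm, this, smul_mul_assoc, smul_comm]
  x'y := by
    have := zpow_comm_of_rel hxy 1 (-1)
    simp only [zpow_neg, zpow_one, one_mul] at this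
    rw [smul_mul_assoc, this, mul_smul_comm, smul_comm]
  x'y' := by
    have := zpow_comm_of_rel hxy (-1) (-1)
    simp only [zpow_neg, zpow_one, neg_mul, one_mul, neg_neg] at this
    rw [smul_mul_smul_comm, this, smul_mul_smul_comm, smul_comm, mul_comm]
  z_ne_zero := hz0
  zf := mul_inv_cancel_left₀ hz0 _
  zG := mul_inv_cancel_left₀ hz0 _

/-- The fixed ring of an involution inverting, up to scalars, two `q`-commuting generators. -/
theorem IsFrame.exists_fixed_of_inversion [CharZero k] {h : k} {e : ℤ × ℤ → D}
    (he : IsFrame h e) {τ : D →ₐ[k] D} {y x : D} {n : ℤ} {ε c : k} (hε : ε ≠ 0) (hc : c ≠ 0)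
    (hxy : x * y = h ^ 2 • (y * x)) (hτy : τ y = ε • y⁻¹) (hτx : τ x = c • x⁻¹)
    (ly : Lead k e y (1, 0)) (lx : Lead k e x (n, 1))
    (hgen : ∀ C : Subalgebra k D, (∀ d ∈ C, d⁻¹ ∈ C) → ({y, x} : Set D) ⊆ C → C = ⊤) :
    ∃ F : D →ₐ[k] D,
      F (e (1, 0)) = (y - ε • y⁻¹)⁻¹ * (y * x - ε • y⁻¹ * c • x⁻¹) ∧
      F (e (0, 1)) = (y - ε • y⁻¹)⁻¹ * (x - c • x⁻¹) ∧
      ∀ d, d ∈ F.range ↔ τ d = d := by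
  have hy0 := ly.ne_zero he.toIsTorus
  have hx0 := lx.ne_zero he.toIsTorus
  have hh := he.h_ne_zero
  have hq : h ^ 2 ≠ 0 := pow_ne_zero 2 hh
  have lyi : Lead k e (ε • y⁻¹) (-1, 0) := (ly.inv he.toIsTorus).smul hε
  have lxi : Lead k e (c • x⁻¹) (-n, -1) := (lx.inv he.toIsTorus).smul hc
  have lz : Lead k e (y - ε • y⁻¹) (1, 0) := by
    rw [sub_eq_add_neg]
    exact ly.add he (lyi.leadLt (by simp [Below])).neg
  have lz' := lz.inv he.toIsTorus
  have lf := lz'.mul he (show Lead k e (x - c • x⁻¹) (n, 1) by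
    rw [sub_eq_add_neg]
    exact lx.add he (lxi.leadLt (by simp [Below])).neg)
  have lG := lz'.mul he (show Lead k e (y * x - ε • y⁻¹ * c • x⁻¹) (n + 1, 1) by
    rw [sub_eq_add_neg]
    have := ly.mul he lx
    rw [Prod.mk_add_mk, zero_add, add_comm] at this
    exact this.add he ((lyi.mul he lxi).leadLt (by simp [Below])).neg)
  set f := (y - ε • y⁻¹)⁻¹ * (x - c • x⁻¹) with hf
  set G := (y - ε • y⁻¹)⁻¹ * (y * x - ε • y⁻¹ * c • x⁻¹) with hG
  have hz0 := lz.ne_zero he.toIsTorus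
  have H : InversionData (h ^ 2) ε c y (ε • y⁻¹) x (c • x⁻¹) f G :=
    inversionData hq hy0 hx0 hz0 hxy
  have hf0 := lf.ne_zero he.toIsTorus
  have hG0 := lG.ne_zero he.toIsTorus
  have hT := he.isTorus_monomial H.f_mul_G lG lf (by simp)
  obtain ⟨F, hF⟩ := he.exists_algHom hT
  have hF1 : F (e (1, 0)) = G := by simp [hF, monomial]
  have hF2 : F (e (0, 1)) = f := by simp [hF, monomial]
  refine ⟨F, hF1, hF2, ?_⟩
  have hfE : f ∈ F.range := ⟨_, hF2⟩
  have hGE : G ∈ F.range := ⟨_, hF1⟩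
  have hE : ∀ d ∈ F.range, d⁻¹ ∈ F.range := fun d => inv_mem_range F
  have hs := H.sum_mem F.range hE hfE hGE hf0 hG0
  have ht := H.sum_x_mem F.range hE hfE hGE hf0 hG0
  have hzz := H.sq_mem F.range hE hfE hGE hf0 hG0
  obtain ⟨r₁, hr₁, hzf⟩ := H.zf_mem F.range hE hfE hGE hf0 hG0
  obtain ⟨r₂, hr₂, hzG⟩ := H.zG_mem F.range hE hfE hGE hf0 hG0
  have hzs : (y - ε • y⁻¹) * (y + ε • y⁻¹) = (y + ε • y⁻¹) * (y - ε • y⁻¹) := by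
    simp only [mul_sub, sub_mul, mul_add, add_mul, H.yy, H.yy']
    abel
  have hzt : (y - ε • y⁻¹) * (x + c • x⁻¹) =
      ((2 : k) • r₂ - (y + ε • y⁻¹) * r₁) * (y - ε • y⁻¹) := by
    rw [H.add_x, mul_sub, mul_smul_comm, hzG, ← mul_assoc, hzs, mul_assoc, hzf,
      sub_mul ((2 : k) • r₂), smul_mul_assoc, mul_assoc]
  have hzf' := H.zf
  have hyz : y = (2⁻¹ : k) • ((y + ε • y⁻¹) + (y - ε • y⁻¹)) := by module
  have hxt : x = (2⁻¹ : k) • ((x + c • x⁻¹) + (y - ε • y⁻¹) * f) := by rw [hzf']; module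
  set z := y - ε • y⁻¹ with hz
  set s := y + ε • y⁻¹ with hs'
  set t := x + c • x⁻¹ with ht'
  have hmem (d : D) : d ∈ span F.range ({1, z} : Set D) ↔
      ∃ a ∈ F.range, ∃ b ∈ F.range, a + b * z = d := by
    rw [mem_span_pair]
    constructor
    · rintro ⟨a, b, rfl⟩
      exact ⟨a, a.2, b, b.2, by simp [Subalgebra.smul_def]⟩
    · rintro ⟨a, ha, b, hb, rfl⟩
      exact ⟨⟨a, ha⟩, ⟨b, hb⟩, by simp [Subalgebra.smul_def]⟩
  have htop : span F.range ({1, z} : Set D) = ⊤ := by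
    refine eq_top_of_mul_mem F _ (fg_span (by simp)) (subset_span (by simp)) {y, x} hgen ?_
    intro g hg v hv
    rw [hmem] at hv ⊢
    obtain ⟨a, ha, b, hb, rfl⟩ := hv
    rcases hg with rfl | rfl
    · refine ⟨(2⁻¹ : k) • (a * s + b * (z * z)),
        Subalgebra.smul_mem _ (add_mem (mul_mem ha hs) (mul_mem hb hzz)) _,
        (2⁻¹ : k) • (a + b * s), Subalgebra.smul_mem _ (add_mem ha (mul_mem hb hs)) _, ?_⟩
      conv_rhs => rw [hyz]
      simp only [mul_smul_comm, smul_mul_assoc, mul_add, add_mul, mul_assoc, hzs]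
      module
    · have hzzf : b * z * (z * f) = b * (z * z) * f := by simp only [mul_assoc]
      refine ⟨(2⁻¹ : k) • (a * t + b * (z * z) * f),
        Subalgebra.smul_mem _ (add_mem (mul_mem ha ht) (mul_mem (mul_mem hb hzz) hfE)) _,
        (2⁻¹ : k) • (a * r₁ + b * ((2 : k) • r₂ - s * r₁)),
        Subalgebra.smul_mem _ (add_mem (mul_mem ha hr₁) (mul_mem hb (sub_mem
          (Subalgebra.smul_mem _ hr₂ _) (mul_mem hs hr₁)))) _, ?_⟩
      conv_rhs => rw [hxt]
      rw [mul_smul_comm, mul_add (a + b * z), add_mul a (b * z) (z * f), hzzf, hzf,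
        add_mul a (b * z) t, mul_assoc b z t, hzt]
      simp only [smul_mul_assoc, add_mul, mul_assoc]
      module
  have hτy' : τ (ε • y⁻¹) = y := by
    rw [map_smul, map_inv₀, hτy, smul_inv₀, inv_inv, smul_smul, mul_inv_cancel₀ hε, one_smul]
  have hτx' : τ (c • x⁻¹) = x := by
    rw [map_smul, map_inv₀, hτx, smul_inv₀, inv_inv, smul_smul, mul_inv_cancel₀ hc, one_smul]
  have hτz : τ z = -z := by rw [hz, map_sub, hτy', hτy, neg_sub]
  have hτf : τ f = f := by
    rw [hf, map_mul, map_inv₀, hτz, map_sub, hτx, hτx', inv_neg, neg_mul, ← mul_neg, neg_sub]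
  have hτG : τ G = G := by
    rw [hG, map_mul, map_inv₀, hτz, map_sub, map_mul, map_mul, hτx, hτx', hτy, hτy', inv_neg,
      neg_mul, ← mul_neg, neg_sub]
  have hτF : τ.comp F = F := he.algHom_ext (by simp [hF1, hτG]) (by simp [hF2, hτf])
  have hτE : ∀ d ∈ F.range, τ d = d := by
    rintro _ ⟨a, rfl⟩
    exact DFunLike.congr_fun hτF a
  intro d
  refine ⟨hτE d, fun hd => ?_⟩
  have hdm : d ∈ span F.range ({1, z} : Set D) := htop ▸ mem_top
  obtain ⟨a, ha, b, hb, rfl⟩ := (hmem d).1 hdm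
  rw [map_add, map_mul, hτE a ha, hτE b hb, hτz] at hd
  have : b * z = 0 := by
    have h1 : (2 : k) • (b * z) = 0 := by
      linear_combination (norm := (simp only [mul_neg]; module)) -hd
    exact (smul_eq_zero.1 h1).resolve_left two_ne_zero
  rw [this, add_zero]
  exact ha

/-- An endomorphism preserving the range of `F` can be transported along `F`. -/
theorem exists_conj (F ψ : D →ₐ[k] D) (hψ : ∀ d ∈ F.range, ψ d ∈ F.range) :
    ∃ ψ' : D →ₐ[k] D, ∀ d, F (ψ' d) = ψ (F d) := by
  refine ⟨((AlgEquiv.ofInjective F F.toRingHom.injective).symm : F.range →ₐ[k] D).comp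
    ((ψ.comp F).codRestrict F.range fun d => hψ _ ⟨d, rfl⟩), fun d => ?_⟩
  have := congrArg Subtype.val ((AlgEquiv.ofInjective F F.toRingHom.injective).apply_symm_apply
    ((ψ.comp F).codRestrict F.range (fun d => hψ _ ⟨d, rfl⟩) d))
  exact this

theorem mem_range_comp_iff {F F' ψ ψ' : D →ₐ[k] D} (hψ : ∀ d, F (ψ' d) = ψ (F d))
    (hF' : ∀ d, d ∈ F'.range ↔ ψ' d = d) (d : D) :
    d ∈ (F.comp F').range ↔ d ∈ F.range ∧ ψ d = d := by
  constructor
  · rintro ⟨a, rfl⟩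
    refine ⟨⟨F' a, rfl⟩, ?_⟩
    simp only [AlgHom.toRingHom_eq_coe, RingHom.coe_coe, AlgHom.comp_apply]
    rw [← hψ, (hF' (F' a)).1 ⟨a, rfl⟩]
  · rintro ⟨⟨a, rfl⟩, ha⟩
    simp only [AlgHom.toRingHom_eq_coe, RingHom.coe_coe] at ha
    rw [← hψ] at ha
    obtain ⟨b, hb⟩ := (hF' a).2 (F.toRingHom.injective ha)
    exact ⟨b, congrArg F hb⟩

section Fixed

variable {h : k} {e : ℤ × ℤ → D}

theorem IsFrame.generators (he : IsFrame h e) (C : Subalgebra k D) (hC : ∀ d ∈ C, d⁻¹ ∈ C)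
    (hs : ({e (1, 0), e (0, 1)} : Set D) ⊆ C) : C = ⊤ :=
  he.eq_top C hC (hs (by simp)) (hs (by simp))

theorem IsFrame.exists_fixed_two [CharZero k] (he : IsFrame h e) {τ : D →ₐ[k] D}
    (h1 : τ (e (1, 0)) = (e (1, 0))⁻¹) (h2 : τ (e (0, 1)) = (e (0, 1))⁻¹) :
    ∃ F : D →ₐ[k] D,
      F (e (1, 0)) = (e (1, 0) - (1 : k) • (e (1, 0))⁻¹)⁻¹ *
        (e (1, 0) * e (0, 1) - (1 : k) • (e (1, 0))⁻¹ * (1 : k) • (e (0, 1))⁻¹) ∧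
      F (e (0, 1)) = (e (1, 0) - (1 : k) • (e (1, 0))⁻¹)⁻¹ *
        (e (0, 1) - (1 : k) • (e (0, 1))⁻¹) ∧
      ∀ d, d ∈ F.range ↔ τ d = d :=
  he.exists_fixed_of_inversion (n := 0) one_ne_zero one_ne_zero he.rel (by rw [h1, one_smul])
    (by rw [h2, one_smul]) (lead_monomial he.toIsTorus _) (lead_monomial he.toIsTorus _)
    he.generators

theorem IsFrame.exists_fixed_inversion_four [CharZero k] (he : IsFrame h e) {ρ : D →ₐ[k] D}
    (h1 : ρ (e (1, 0)) * e (1, 0) = e (0, 1) - (h ^ 2)⁻¹ • (e (0, 1))⁻¹)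
    (h2 : ρ (e (0, 1)) = -(e (0, 1))⁻¹) :
    ∃ F : D →ₐ[k] D, ∀ d, d ∈ F.range ↔ ρ d = d := by
  have hh := he.h_ne_zero
  have he' := he.comp (u := (0, -1)) (w := (1, 0)) (by norm_num)
  set e' : ℤ × ℤ → D := fun v => e (v.1 • ((0, -1) : ℤ × ℤ) + v.2 • ((1, 0) : ℤ × ℤ)) with he'e
  have hrel := he.rel
  have hx : Lead k e' (e (0, 1)) (-1, 0) := by
    have := lead_monomial he'.toIsTorus (-1, 0)
    simpa [he'e] using this
  have hy : Lead k e' (e (1, 0)) (0, 1) := by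
    have := lead_monomial he'.toIsTorus (0, 1)
    simpa [he'e] using this
  have h10 : Lead k e' (1 : D) (0, 0) := by
    have := lead_monomial he'.toIsTorus (0 : ℤ × ℤ)
    rwa [he'.one] at this
  set x := e (0, 1) with hxe
  set y := e (1, 0) with hye
  have hxi : Lead k e' x⁻¹ (1, 0) := hx.inv he'.toIsTorus
  have hw : Lead k e' (1 + h⁻¹ • x) (0, 0) :=
    h10.add he' ((hx.smul (inv_ne_zero hh)).leadLt (by simp [Below]))
  have hw' : Lead k e' (1 - h⁻¹ • x⁻¹) (1, 0) := by
    have := (hxi.smul (neg_ne_zero.2 (inv_ne_zero hh))).add he' (h10.leadLt (by simp [Below]))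
    rwa [show -h⁻¹ • x⁻¹ + 1 = 1 - h⁻¹ • x⁻¹ by module] at this
  have hx0 : x ≠ 0 := he.ne_zero (0, 1)
  have hy0 : y ≠ 0 := he.ne_zero (1, 0)
  have hw0 := hw.ne_zero he'.toIsTorus
  have hw0' := hw'.ne_zero he'.toIsTorus
  have hwx : (1 + h⁻¹ • x)⁻¹ * x⁻¹ = x⁻¹ * (1 + h⁻¹ • x)⁻¹ := by
    rw [← mul_inv_rev, ← mul_inv_rev]
    congr 1
    simp [mul_add, add_mul]
  have hyx : y * x⁻¹ = h ^ 2 • (x⁻¹ * y) := by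
    have := zpow_comm_of_rel hrel 1 (-1)
    simp only [zpow_neg, zpow_one, one_mul] at this
    rw [this, smul_smul, mul_inv_cancel₀ (pow_ne_zero 2 hh), one_smul]
  have hyx' : y⁻¹ * x = h ^ 2 • (x * y⁻¹) := by
    have := zpow_comm_of_rel hrel (-1) 1
    simp only [zpow_neg, zpow_one, neg_mul, one_mul] at this
    rw [this, smul_smul, mul_inv_cancel₀ (pow_ne_zero 2 hh), one_smul]
  have hρy : ρ y = (1 - h⁻¹ • x⁻¹) * ((x + h⁻¹ • 1) * y⁻¹) := by
    rw [eq_mul_inv_iff_mul_eq₀ hy0 |>.2 h1, ← mul_assoc]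
    congr 1
    simp only [sub_mul, mul_add, smul_mul_assoc, mul_smul_comm, inv_mul_cancel₀ hx0, one_mul,
      mul_one]
    match_scalars <;> field_simp
    ring
  obtain ⟨F, -, -, hF⟩ := he'.exists_fixed_of_inversion (τ := ρ) (y := x⁻¹)
    (x := (1 + h⁻¹ • x)⁻¹ * y) (n := 0) (ε := -1) (c := h⁻¹) (by simp) (inv_ne_zero hh)
    (by rw [mul_assoc, hyx, mul_smul_comm, ← mul_assoc, hwx, mul_assoc])
    (by simp [h2])
    (by
      rw [map_mul, hρy, map_inv₀, map_add, map_one, map_smul, h2, smul_neg, ← sub_eq_add_neg,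
        inv_mul_cancel_left₀ hw0', mul_inv_rev, inv_inv, mul_add, mul_smul_comm, hyx', mul_one,
        add_mul, smul_mul_assoc, one_mul]
      match_scalars <;> field_simp)
    hxi (by
      have := (hw.inv he'.toIsTorus).mul he' hy
      simpa using this)
    (by
      intro C hC hs
      have hxC : x ∈ C := by
        have := hC _ (hs (Set.mem_insert _ _))
        rwa [inv_inv] at this
      refine he.eq_top C hC ?_ hxC
      have := mul_mem (add_mem (one_mem C) (C.smul_mem hxC h⁻¹))
        (hs (Set.mem_insert_of_mem _ rfl))
      rwa [mul_inv_cancel_left₀ hw0] at this)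
  exact ⟨F, hF⟩

theorem IsFrame.exists_fixed_four [CharZero k] (he : IsFrame h e) {ρ : D →ₐ[k] D}
    (h1 : ρ (e (1, 0)) = e (0, 1)) (h2 : ρ (e (0, 1)) = (e (1, 0))⁻¹) :
    ∃ F : D →ₐ[k] D, ∀ d, d ∈ F.range ↔ ρ d = d := by
  obtain ⟨F₁, hG, hf, hF₁⟩ := he.exists_fixed_two (τ := ρ.comp ρ) (by simp [h1, h2])
    (by simp [h1, h2])
  obtain ⟨ρ', hρ'⟩ := exists_conj F₁ ρ (fun d hd => by
    rw [hF₁] at hd ⊢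
    exact congrArg ρ hd)
  have hz0 : e (1, 0) - (1 : k) • (e (1, 0))⁻¹ ≠ 0 := by
    intro h0
    rw [h0, inv_zero, zero_mul] at hG
    exact he.ne_zero (1, 0) (F₁.toRingHom.injective (hG.trans (map_zero F₁).symm))
  have H := inversionData (c := 1) (pow_ne_zero 2 he.h_ne_zero) (he.ne_zero (1, 0))
    (he.ne_zero (0, 1)) hz0 he.rel
  rw [← hf, ← hG] at H
  have hf0 : F₁ (e (0, 1)) ≠ 0 := (map_ne_zero F₁).2 (he.ne_zero _)
  have hG0 : F₁ (e (1, 0)) ≠ 0 := (map_ne_zero F₁).2 (he.ne_zero _)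
  have hsum := H.sum_mul
  have hzf := H.zf
  have hzG := H.zG
  have hrel' := zpow_comm_of_rel he.rel
  simp only [one_smul, mul_one] at hz0 hsum hzf hzG
  set x := e (0, 1) with hxe
  set y := e (1, 0) with hye
  set z := y - y⁻¹ with hz
  set f := F₁ x with hfx
  set G := F₁ y with hGy
  have hρz : ρ z = z * f := by rw [hz, map_sub, map_inv₀, h1, hzf]
  have hρf : ρ f = -f⁻¹ := by
    have h3 := congrArg ρ hzf
    rw [map_mul, hρz, map_sub, map_inv₀, h2, inv_inv, ← neg_sub, ← hz] at h3
    rw [← mul_right_inj' (mul_ne_zero hz0 hf0), h3, mul_neg, mul_inv_cancel_right₀ hf0]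
  have hρG : ρ G * G = f - (h ^ 2)⁻¹ • f⁻¹ := by
    have h3 := congrArg ρ hzG
    rw [map_mul, hρz, map_sub, map_mul, map_mul, map_inv₀, map_inv₀, h1, h2, inv_inv] at h3
    have e1 : x * y⁻¹ = (h ^ 2)⁻¹ • (y⁻¹ * x) := by simpa using hrel' (-1) 1
    have e2 : x⁻¹ * y = (h ^ 2)⁻¹ • (y * x⁻¹) := by simpa using hrel' 1 (-1)
    have e3 : z * ((y + y⁻¹) * f - G) = y⁻¹ * x - y * x⁻¹ := by
      have : z * (y + y⁻¹) = (y + y⁻¹) * z := by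
        rw [hz]
        have hy0 : y ≠ 0 := he.ne_zero (1, 0)
        simp only [mul_sub, sub_mul, mul_add, add_mul]
        rw [mul_inv_cancel₀ hy0, inv_mul_cancel₀ hy0]
        abel
      rw [mul_sub, ← mul_assoc, this, mul_assoc, hzf, hzG]
      noncomm_ring
    rw [e1, e2, ← smul_sub, ← e3, ← mul_smul_comm, mul_assoc] at h3
    have h4 := mul_left_cancel₀ hz0 h3
    rw [← mul_right_inj' hf0, ← mul_assoc, h4, smul_mul_assoc, sub_mul, mul_assoc, hsum,
      mul_sub, mul_smul_comm, mul_inv_cancel₀ hf0]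
    have := he.h_ne_zero
    match_scalars <;> field_simp
    ring
  obtain ⟨F₂, hF₂⟩ := he.exists_fixed_inversion_four (ρ := ρ')
    (F₁.toRingHom.injective (by
      simp only [AlgHom.toRingHom_eq_coe, RingHom.coe_coe, map_mul, hρ', map_sub, map_smul,
        map_inv₀]
      exact hρG))
    (F₁.toRingHom.injective (by
      simp only [AlgHom.toRingHom_eq_coe, RingHom.coe_coe, hρ', map_neg, map_inv₀]
      exact hρf))
  refine ⟨F₁.comp F₂, fun d => ?_⟩
  rw [mem_range_comp_iff hρ' hF₂, hF₁, AlgHom.comp_apply, and_iff_right_iff_imp]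
  intro hd
  rw [hd, hd]

end Fixed

/-- The action of the matrix of order three on exponents. -/
def rot (v : ℤ × ℤ) : ℤ × ℤ := (-v.2, v.1 - v.2)

/-- The `ζ`-weighted sum over the orbit of a monomial under `rot`. -/
def orb (e : ℤ × ℤ → D) (ζ : k) (v : ℤ × ℤ) : D :=
  e v + ζ • e (rot v) + ζ ^ 2 • e (rot (rot v))

section Identities

variable {h ω : k} {e : ℤ × ℤ → D} (he : IsTorus h e) (hω : ω ^ 2 + ω + 1 = 0)

variable (e h ω) in
/-- An invariant Laurent polynomial whose quotient by `polyA` measures `b * a⁻¹`, where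
`a = orb e ω (1, 0)` and `b = orb e ω (-1, 0)`. -/
def polyB : D := orb e (1 : k) (-2, 0) + (ω ^ 2 * (h ^ 5)⁻¹ + ω * h ^ 5) • orb e (1 : k) (1, 0)

variable (e h ω) in
/-- The denominator matching `polyB`. -/
def polyA : D := (ω ^ 2 * h ^ 3) • orb e (1 : k) (1, -1) +
  (ω * (h ^ 3)⁻¹) • orb e (1 : k) (-1, 1) +
  ((h ^ 6)⁻¹ + ω * (h ^ 4)⁻¹ + (1 + ω) * (h ^ 2)⁻¹ + 1 - ω * h ^ 2 - (1 + ω) * h ^ 4 + h ^ 6) •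
    (1 : D)

variable (e h ω) in
/-- An auxiliary invariant Laurent polynomial. -/
def polyR : D := (ω * (h ^ 4)⁻¹) • orb e (1 : k) (-2, -2) +
  (ω ^ 2 * h ^ 3) • orb e (1 : k) (1, -2) +
  (ω * (h ^ 3)⁻¹ + (1 + ω) * h⁻¹ - ω * h - (1 + ω) * h ^ 3 + h ^ 7) • orb e (1 : k) (-1, 0)

variable (e h ω) in
/-- An auxiliary invariant Laurent polynomial. -/
def polyR' : D := h⁻¹ • orb e (1 : k) (-1, -3) + (ω * h ^ 6) • orb e (1 : k) (-2, -2) +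
  (-(1 + ω) * (h ^ 5)⁻¹ + h⁻¹ - ω * h - h ^ 3 + ω * h ^ 5) • orb e (1 : k) (-1, 0)

include he hω

theorem orb_one_mul_orb_neg : orb e (1 : k) (1, 0) * orb e ω (-1, 0) =
    h⁻¹ • orb e ω (-1, 1) + (h * ω) • orb e ω (1, -1) := by
  have hh := he.h_ne_zero
  simp only [orb, rot, mul_add, add_mul, smul_add,
    mul_smul_comm, smul_mul_assoc, smul_smul, he.mul, Prod.mk_add_mk]
  norm_num
  match_scalars <;> field_simp <;> grind

theorem orb_one_neg_mul_orb : orb e (1 : k) (-1, 0) * orb e ω (1, 0) =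
    h⁻¹ • orb e ω (1, -1) + (h * ω) • orb e ω (-1, 1) := by
  have hh := he.h_ne_zero
  simp only [orb, rot, mul_add, add_mul, smul_add,
    mul_smul_comm, smul_mul_assoc, smul_smul, he.mul, Prod.mk_add_mk]
  norm_num
  match_scalars <;> field_simp <;> grind

theorem orb_neg_mul_orb_one : orb e ω (-1, 0) * orb e (1 : k) (1, 0) =
    h • orb e ω (-1, 1) + (h⁻¹ * ω) • orb e ω (1, -1) := by
  have hh := he.h_ne_zero
  simp only [orb, rot, mul_add, add_mul, smul_add,
    mul_smul_comm, smul_mul_assoc, smul_smul, he.mul, Prod.mk_add_mk]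
  norm_num
  match_scalars <;> field_simp <;> grind

theorem orb_mul_orb_one_neg : orb e ω (1, 0) * orb e (1 : k) (-1, 0) =
    h • orb e ω (1, -1) + (h⁻¹ * ω) • orb e ω (-1, 1) := by
  have hh := he.h_ne_zero
  simp only [orb, rot, mul_add, add_mul, smul_add,
    mul_smul_comm, smul_mul_assoc, smul_smul, he.mul, Prod.mk_add_mk]
  norm_num
  match_scalars <;> field_simp <;> grind

theorem orb_mul_polyB : orb e ω (1, 0) * polyB h ω e = orb e ω (-1, 0) * polyA h ω e := by
  have hh := he.h_ne_zero
  simp only [orb, polyA, polyB, rot, ← he.one, mul_add, add_mul, smul_add,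
    mul_smul_comm, smul_mul_assoc, smul_smul, he.mul, Prod.mk_add_mk, ← Prod.mk_zero_zero]
  norm_num
  match_scalars <;> field_simp <;> grind

theorem orb_mul_polyR : orb e ω (1, 0) * polyR h ω e =
    h ^ 2 • (orb e ω (1, -1) * polyA h ω e) -
      (h ^ 2 - 1) • (orb e ω (-1, 0) * polyB h ω e) := by
  have hh := he.h_ne_zero
  simp only [orb, polyA, polyB, polyR, rot, ← he.one, mul_add, add_mul, smul_add,
    mul_smul_comm, smul_mul_assoc, smul_smul, he.mul, Prod.mk_add_mk, ← Prod.mk_zero_zero]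
  norm_num
  match_scalars <;> field_simp <;> grind

theorem orb_neg_mul_polyR : orb e ω (-1, 0) * polyR h ω e =
    orb e ω (1, -1) * polyB h ω e + ((h ^ 2 - 1) * ω ^ 2) • (orb e ω (1, 0) * polyA h ω e) := by
  have hh := he.h_ne_zero
  simp only [orb, polyA, polyB, polyR, rot, ← he.one, mul_add, add_mul, smul_add,
    mul_smul_comm, smul_mul_assoc, smul_smul, he.mul, Prod.mk_add_mk, ← Prod.mk_zero_zero]
  norm_num
  match_scalars <;> field_simp <;> grind

theorem orb_mul_polyR' : orb e ω (1, 0) * polyR' h ω e =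
    orb e ω (-1, 1) * polyA h ω e + ((h ^ 2 - 1) * ω ^ 2) • (orb e ω (-1, 0) * polyB h ω e) := by
  have hh := he.h_ne_zero
  simp only [orb, polyA, polyB, polyR', rot, ← he.one, mul_add, add_mul, smul_add,
    mul_smul_comm, smul_mul_assoc, smul_smul, he.mul, Prod.mk_add_mk, ← Prod.mk_zero_zero]
  norm_num
  match_scalars <;> field_simp <;> grind

theorem orb_neg_mul_polyR' : orb e ω (-1, 0) * polyR' h ω e =
    h ^ 2 • (orb e ω (-1, 1) * polyB h ω e) - (h ^ 2 - 1) • (orb e ω (1, 0) * polyA h ω e) := by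
  have hh := he.h_ne_zero
  simp only [orb, polyA, polyB, polyR', rot, ← he.one, mul_add, add_mul, smul_add,
    mul_smul_comm, smul_mul_assoc, smul_smul, he.mul, Prod.mk_add_mk, ← Prod.mk_zero_zero]
  norm_num
  match_scalars <;> field_simp <;> grind

set_option maxHeartbeats 1000000 in
theorem orb_mul_polyR'_eq : orb e ω (1, -1) * polyR' h ω e =
    (ω ^ 2 * h⁻¹) • (orb e ω (1, 0) * orb e (1 : k) (1, 0) * polyA h ω e) -
    ((h ^ 2 - 1) * h ^ 2 * ω) • (orb e ω (-1, 0) * polyA h ω e) -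
    (h ^ 2 - 1) • (orb e ω (1, 0) * polyB h ω e) +
    (ω ^ 2 * (2 + h ^ 2) + 1 - (h ^ 2)⁻¹) • (orb e ω (1, 0) * polyB h ω e) +
    (ω ^ 2 * h ^ 3) • (orb e ω (-1, 0) * orb e (1 : k) (-1, 0) * polyB h ω e) := by
  have hh := he.h_ne_zero
  simp only [orb, polyA, polyB, polyR', rot, ← he.one, mul_add, add_mul, smul_add,
    mul_smul_comm, smul_mul_assoc, smul_smul, he.mul, Prod.mk_add_mk, ← Prod.mk_zero_zero]
  norm_num
  match_scalars <;> field_simp <;> grind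

end Identities

section Relations

variable {h ω : k} {e : ℤ × ℤ → D} (he : IsTorus h e) (hω : ω ^ 2 + ω + 1 = 0)
  (ha : orb e ω (1, 0) ≠ 0) (hA : polyA h ω e ≠ 0)

include he hω ha hA

theorem orb_ratio_rel {g θ : D} (hg : g * orb e ω (1, 0) = orb e ω (-1, 0))
    (hθ : θ * orb e ω (1, 0) = orb e ω (1, -1)) :
    θ * g = h ^ 2 • (g * θ) - (h ^ 2 - 1) • (g * g * g) - ((h ^ 2 - 1) * ω ^ 2) • 1 := by
  have h1 := orb_mul_polyB he hω
  have h2 := orb_mul_polyR he hω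
  have h3 := orb_neg_mul_polyR he hω
  rw [← hg, ← hθ] at *
  set a := orb e ω (1, 0)
  refine mul_right_cancel₀ (mul_ne_zero ha hA) ?_
  rw [mul_assoc] at h1
  simp only [mul_assoc, h1] at h2
  rw [mul_assoc, h2, mul_assoc, h1] at h3
  simp only [mul_assoc, sub_mul, mul_sub, smul_mul_assoc, mul_smul_comm, one_mul] at h3 ⊢
  linear_combination (norm := module) -h3

theorem orb_ratio_rel' {g θ' : D} (hg : g * orb e ω (1, 0) = orb e ω (-1, 0))
    (hθ' : θ' * orb e ω (1, 0) = orb e ω (-1, 1)) :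
    h ^ 2 • (θ' * g) = g * θ' + (h ^ 2 - 1) • 1 + ((h ^ 2 - 1) * ω ^ 2) • (g * g * g) := by
  have h1 := orb_mul_polyB he hω
  have h2 := orb_mul_polyR' he hω
  have h3 := orb_neg_mul_polyR' he hω
  rw [← hg, ← hθ'] at *
  set a := orb e ω (1, 0)
  refine mul_right_cancel₀ (mul_ne_zero ha hA) ?_
  rw [mul_assoc] at h1
  simp only [mul_assoc, h1] at h2
  rw [mul_assoc, h2, mul_assoc, h1] at h3
  simp only [mul_assoc, add_mul, mul_add, smul_mul_assoc, mul_smul_comm, one_mul] at h3 ⊢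
  linear_combination (norm := module) -h3

theorem orb_ratio_mul {g θ θ' : D} (hg : g * orb e ω (1, 0) = orb e ω (-1, 0))
    (hθ : θ * orb e ω (1, 0) = orb e ω (1, -1)) (hθ' : θ' * orb e ω (1, 0) = orb e ω (-1, 1))
    (hg0 : g ≠ 0) :
    θ * θ' = g⁻¹ * (ω ^ 2 • θ' + (h ^ 2)⁻¹ • θ) - ((h ^ 2 - 1) * ω ^ 2) • (θ * g * g) +
      (ω ^ 2 * (2 + h ^ 2) + 2 - (h ^ 2)⁻¹ - h ^ 2 - (h ^ 2 - 1) * h ^ 2 * ω) • g +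
      g * ((h ^ 4 * ω ^ 2) • θ + h ^ 2 • θ') * g := by
  have h1 := orb_mul_polyB he hω
  have h2 := orb_mul_polyR' he hω
  have h3 := orb_mul_polyR'_eq he hω
  have h4 := orb_neg_mul_orb_one he hω
  have h5 := orb_mul_orb_one_neg he hω
  have hh := he.h_ne_zero
  have hω3 : ω ^ 3 = 1 := by linear_combination (ω - 1) * hω
  rw [← hg, ← hθ, ← hθ'] at *
  set a := orb e ω (1, 0)
  refine mul_right_cancel₀ (mul_ne_zero ha hA) ?_
  rw [mul_assoc] at h1
  simp only [mul_assoc, h1] at h2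
  have h6 : a * orb e (1 : k) (1, 0) * polyA h ω e =
      g⁻¹ * ((h • θ' + (h⁻¹ * ω) • θ) * (a * polyA h ω e)) := by
    rw [← mul_assoc _ a, add_mul, smul_mul_assoc, smul_mul_assoc, ← h4]
    simp only [mul_assoc, inv_mul_cancel_left₀ hg0]
  have h7 : g * a * orb e (1 : k) (-1, 0) * polyB h ω e =
      g * ((h • θ + (h⁻¹ * ω) • θ') * (g * (a * polyA h ω e))) := by
    rw [← h1, ← mul_assoc _ a, add_mul, smul_mul_assoc, smul_mul_assoc, ← h5]
    simp only [mul_assoc]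
  rw [h6, h7, mul_assoc, h2, h1] at h3
  simp only [mul_assoc, add_mul, mul_add, sub_mul, smul_mul_assoc, mul_smul_comm, one_mul,
    smul_add, smul_smul] at h3 ⊢
  have e1 : ω ^ 2 * (h⁻¹ * h) = ω ^ 2 := by field_simp
  have e2 : ω ^ 2 * (h⁻¹ * (h⁻¹ * ω)) = (h ^ 2)⁻¹ := by field_simp; exact hω3
  have e3 : ω ^ 2 * (h ^ 3 * h) = h ^ 4 * ω ^ 2 := by ring
  have e4 : ω ^ 2 * (h ^ 3 * (h⁻¹ * ω)) = h ^ 2 := by field_simp; exact hω3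
  rw [e1, e2, e3, e4] at h3
  linear_combination (norm := module) h3

end Relations

section Abstract

variable {q ω : k} {g θ θ' : D}

theorem ratio_commute (hg0 : g ≠ 0)
    (h1 : θ * g = q • (g * θ) - (q - 1) • (g * g * g) - ((q - 1) * ω ^ 2) • 1) :
    (θ - g * g - ω ^ 2 • g⁻¹) * g = q • (g * (θ - g * g - ω ^ 2 • g⁻¹)) := by
  simp only [sub_mul, mul_sub, h1, smul_mul_assoc, mul_smul_comm, inv_mul_cancel₀ hg0,
    mul_inv_cancel₀ hg0, mul_assoc]
  module

theorem ratio_commute' (hg0 : g ≠ 0)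
    (h1 : q • (θ' * g) = g * θ' + (q - 1) • 1 + ((q - 1) * ω ^ 2) • (g * g * g)) :
    g * (θ' * g⁻¹ - g⁻¹ * g⁻¹ - ω ^ 2 • g) =
      q • ((θ' * g⁻¹ - g⁻¹ * g⁻¹ - ω ^ 2 • g) * g) := by
  have h2 : g * θ' = q • (θ' * g) - (q - 1) • 1 - ((q - 1) * ω ^ 2) • (g * g * g) := by
    rw [h1]; module
  simp only [sub_mul, mul_sub, smul_mul_assoc, mul_smul_comm, inv_mul_cancel₀ hg0,
    mul_assoc, mul_inv_cancel_left₀ hg0, mul_one]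
  rw [← mul_assoc, h2]
  simp only [sub_mul, smul_mul_assoc, mul_inv_cancel₀ hg0, mul_assoc, mul_one, one_mul]
  module

theorem ratio_mul (hω : ω ^ 2 + ω + 1 = 0) (hq : q ≠ 0) (hg0 : g ≠ 0)
    (h1 : θ * g = q • (g * θ) - (q - 1) • (g * g * g) - ((q - 1) * ω ^ 2) • 1)
    (h2 : q • (θ' * g) = g * θ' + (q - 1) • 1 + ((q - 1) * ω ^ 2) • (g * g * g))
    (h3 : θ * θ' = g⁻¹ * (ω ^ 2 • θ' + q⁻¹ • θ) - ((q - 1) * ω ^ 2) • (θ * g * g) +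
      (ω ^ 2 * (2 + q) + 2 - q⁻¹ - q - (q - 1) * q * ω) • g +
      g * ((q ^ 2 * ω ^ 2) • θ + q • θ') * g) :
    (θ - g * g - ω ^ 2 • g⁻¹) * (θ' * g⁻¹ - g⁻¹ * g⁻¹ - ω ^ 2 • g) =
      (ω ^ 2 * q⁻¹) • (g⁻¹ * g⁻¹ * g⁻¹) + (ω ^ 2 * (1 + q)) • 1 +
        (ω ^ 2 * q ^ 2) • (g * g * g) := by
  have h2' : θ' * g = q⁻¹ • (g * θ' + (q - 1) • 1 + ((q - 1) * ω ^ 2) • (g * g * g)) := by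
    rw [← h2, smul_smul, inv_mul_cancel₀ hq, one_smul]
  have h4 : θ * g⁻¹ = q⁻¹ • (g⁻¹ * θ) + (1 - q⁻¹) • g + ((1 - q⁻¹) * ω ^ 2) • (g⁻¹ * g⁻¹) := by
    rw [mul_inv_eq_iff_eq_mul₀ hg0]
    simp only [add_mul, smul_mul_assoc, mul_assoc, inv_mul_cancel₀ hg0, h1, mul_sub,
      mul_smul_comm, inv_mul_cancel_left₀ hg0, mul_one]
    match_scalars <;> field_simp <;> ring
  have hω3 : ω ^ 3 = 1 := by linear_combination (ω - 1) * hω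
  refine mul_right_cancel₀ hg0 ?_
  simp only [mul_add, add_mul, sub_mul, mul_sub, smul_mul_assoc, mul_smul_comm, mul_assoc,
    inv_mul_cancel₀ hg0, mul_inv_cancel₀ hg0, mul_one, one_mul, h3]
  simp only [h1, h2', h4, ← mul_assoc θ g]
  simp only [mul_add, sub_mul, mul_sub, smul_mul_assoc, mul_smul_comm, mul_assoc, h1,
    mul_one, one_mul]
  match_scalars <;> field_simp <;> grind

end Abstract

/-- A set of exponents containing a `3 × 3` box and closed under completing triangles around its
members is everything. -/
theorem forall_of_triangles {P : ℤ → ℤ → Prop}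
    (hbox : ∀ i j, |i| ≤ 1 → |j| ≤ 1 → P i j)
    (h₁ : ∀ i j, P i j → P (i + 1) j → P i (j + 1) → P (i - 1) (j - 1))
    (h₂ : ∀ i j, P i j → P (i + 1) j → P (i - 1) (j - 1) → P i (j + 1))
    (h₃ : ∀ i j, P i j → P i (j + 1) → P (i - 1) (j - 1) → P (i + 1) j)
    (h₁' : ∀ i j, P i j → P (i - 1) j → P i (j - 1) → P (i + 1) (j + 1))
    (h₂' : ∀ i j, P i j → P (i - 1) j → P (i + 1) (j + 1) → P i (j - 1))
    (h₃' : ∀ i j, P i j → P i (j - 1) → P (i + 1) (j + 1) → P (i - 1) j) (i j : ℤ) : P i j := by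
  have hcol (i : ℤ) : ∀ a b, |a| ≤ 1 → |b| ≤ 1 → P (i + a) b := by
    induction i using Int.induction_on with
    | zero => simpa using hbox
    | succ i ih =>
      have ih' (a b : ℤ) (ha : |a - i| ≤ 1) (hb : |b| ≤ 1) : P a b := by
        simpa using ih (a - i) b ha hb
      clear ih hbox
      have q1 := h₃ (i + 1) 0 (ih' _ _ (by simp) (by simp)) (ih' _ _ (by simp) (by simp))
        (ih' _ _ (by simp) (by simp))
      have q2 := h₁' (i + 1) 0 (ih' _ _ (by simp) (by simp)) (ih' _ _ (by simp) (by simp))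
        (ih' _ _ (by simp) (by simp))
      have q3 := h₂' i (-1) (ih' _ _ (by simp) (by simp)) (ih' _ _ (by simp) (by simp))
        (ih' _ _ (by simp) (by simp))
      have q4 := h₃ (i + 1) (-1) (ih' _ _ (by simp) (by simp)) (ih' _ _ (by simp) (by simp))
        (by simpa using q3)
      intro a b ha hb
      rcases eq_or_ne a 1 with rfl | ha'
      · obtain rfl | rfl | rfl : b = -1 ∨ b = 0 ∨ b = 1 := by rw [abs_le] at hb; omega
        · exact q4
        · exact q1
        · simpa using q2
      · exact ih' _ _ (by rw [abs_le] at *; omega) hb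
    | pred i ih =>
      have ih' (a b : ℤ) (ha : |a + i| ≤ 1) (hb : |b| ≤ 1) : P a b := by
        have := ih (a + i) b ha hb
        rwa [show -(i : ℤ) + (a + i) = a by ring] at this
      clear ih hbox
      have q1 := h₃' (-i - 1) 0 (ih' _ _ (by rw [abs_le]; omega) (by rw [abs_le]; omega))
        (ih' _ _ (by rw [abs_le]; omega) (by rw [abs_le]; omega))
        (ih' _ _ (by rw [abs_le]; omega) (by rw [abs_le]; omega))
      have q2 := h₁ (-i - 1) 0 (ih' _ _ (by rw [abs_le]; omega) (by rw [abs_le]; omega))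
        (ih' _ _ (by rw [abs_le]; omega) (by rw [abs_le]; omega))
        (ih' _ _ (by rw [abs_le]; omega) (by rw [abs_le]; omega))
      have q3 := h₂ (-i) 1 (ih' _ _ (by rw [abs_le]; omega) (by rw [abs_le]; omega))
        (ih' _ _ (by rw [abs_le]; omega) (by rw [abs_le]; omega))
        (ih' _ _ (by rw [abs_le]; omega) (by rw [abs_le]; omega))
      have q4 := h₃' (-i - 1) 1 (ih' _ _ (by rw [abs_le]; omega) (by rw [abs_le]; omega))
        (ih' _ _ (by rw [abs_le]; omega) (by rw [abs_le]; omega))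
        (by convert q3 using 1; ring)
      intro a b ha hb
      rcases eq_or_ne a (-1) with rfl | ha'
      · obtain rfl | rfl | rfl : b = -1 ∨ b = 0 ∨ b = 1 := by rw [abs_le] at hb; omega
        · rw [← sub_eq_add_neg]; exact q2
        · rw [← sub_eq_add_neg]; exact q1
        · rw [← sub_eq_add_neg]; exact q4
      · exact ih' _ _ (by rw [abs_le] at *; omega) hb
  have hrow (j : ℤ) : ∀ i, P i j ∧ P i (j + 1) := by
    induction j using Int.induction_on with
    | zero => exact fun i => ⟨by simpa using hcol i 0 0, by simpa using hcol i 0 1⟩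
    | succ j ih =>
      refine fun i => ⟨(ih i).2, h₂ i _ (ih i).2 (ih _).2 ?_⟩
      simpa using (ih (i - 1)).1
    | pred j ih =>
      refine fun i => ⟨?_, by simpa using (ih i).1⟩
      exact h₂' i _ (ih i).1 (ih _).1 (ih _).2
  exact (hrow j i).1

theorem rot_rot_rot (v : ℤ × ℤ) : rot (rot (rot v)) = v := by
  ext <;> simp [rot]
  ring

section Orb

variable {h : k} {e : ℤ × ℤ → D}

theorem orb_rot {ζ : k} (hζ : ζ ^ 3 = 1) (v : ℤ × ℤ) : orb e ζ (rot v) = ζ ^ 2 • orb e ζ v := by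
  simp only [orb, rot_rot_rot, smul_add, smul_smul, ← pow_succ, hζ]
  rw [show ζ ^ 2 * ζ ^ 2 = ζ by linear_combination ζ * hζ]
  module

theorem map_orb {ρ : D →ₐ[k] D} (hρ : ∀ v, ρ (e v) = e (rot v)) {ζ : k} (hζ : ζ ^ 3 = 1)
    (v : ℤ × ℤ) : ρ (orb e ζ v) = ζ ^ 2 • orb e ζ v := by
  rw [← orb_rot hζ]
  simp only [orb, map_add, map_smul, hρ]

theorem map_orb_neg {κ : D →ₐ[k] D} (hκ : ∀ v, κ (e v) = e (-v)) {ζ : k}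
    (v : ℤ × ℤ) : κ (orb e ζ v) = orb e ζ (-v) := by
  have (v : ℤ × ℤ) : -rot v = rot (-v) := by ext <;> simp [rot]; ring
  simp only [orb, map_add, map_smul, hκ, this]

theorem orb_mul_orb (he : IsTorus h e) {ζ η : k} (hζ : ζ ^ 3 = 1) (u v : ℤ × ℤ) :
    orb e ζ u * orb e η v = h ^ (u.2 * v.1 - u.1 * v.2) • orb e (ζ * η) (u + v) +
      (ζ * h ^ ((rot u).2 * v.1 - (rot u).1 * v.2)) • orb e (ζ * η) (rot u + v) +
      (ζ ^ 2 * h ^ ((rot (rot u)).2 * v.1 - (rot (rot u)).1 * v.2)) •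
        orb e (ζ * η) (rot (rot u) + v) := by
  obtain ⟨a, b⟩ := u
  obtain ⟨c, d⟩ := v
  simp only [orb, rot, mul_add, add_mul, smul_mul_assoc, mul_smul_comm, he.mul, Prod.mk_add_mk]
  ring_nf
  have h4 : ζ ^ 4 = ζ := by linear_combination ζ * hζ
  simp only [smul_add, smul_smul]
  ring_nf
  simp only [hζ, h4]
  module

theorem map_eq_rot (he : IsTorus h e) {ρ : D →ₐ[k] D} (h1 : ρ (e (1, 0)) = e (0, 1))
    (h2 : ρ (e (0, 1)) = e (-1, -1)) (v : ℤ × ℤ) : ρ (e v) = e (rot v) := by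
  have hh := he.h_ne_zero
  conv_lhs => rw [he.eq_monomial]
  rw [map_monomial, h1, h2, monomial, he.zpow, he.zpow, he.mul, smul_smul, ← zpow_add₀ hh]
  simp [rot, sub_eq_add_neg]

theorem top_orb_right {ω : k} (hω : ω ≠ 0) : Top k e (orb e ω (1, 0)) (0, 1) := by
  refine ⟨ω, hω, ?_⟩
  rw [show orb e ω (1, 0) - ω • e (0, 1) = e (1, 0) + ω ^ 2 • e (-1, -1) by
    simp only [orb, rot]; norm_num; abel]
  exact add_mem (mem_fil (by simp [Below])) (smul_mem _ _ (mem_fil (by simp [Below])))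

theorem top_orb_left {ω : k} (hω : ω ≠ 0) : Top k e (orb e ω (-1, 0)) (1, 1) := by
  refine ⟨ω ^ 2, pow_ne_zero 2 hω, ?_⟩
  rw [show orb e ω (-1, 0) - ω ^ 2 • e (1, 1) = e (-1, 0) + ω • e (0, -1) by
    simp only [orb, rot]; norm_num]
  exact add_mem (mem_fil (by simp [Below])) (smul_mem _ _ (mem_fil (by simp [Below])))

theorem top_orb_diagonal {ω : k} (hω : ω ≠ 0) : Top k e (orb e ω (1, -1)) (1, 2) := by
  refine ⟨ω, hω, ?_⟩
  rw [show orb e ω (1, -1) - ω • e (1, 2) = e (1, -1) + ω ^ 2 • e (-2, -1) by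
    simp only [orb, rot]; norm_num; abel]
  exact add_mem (mem_fil (by simp [Below])) (smul_mem _ _ (mem_fil (by simp [Below])))

theorem top_polyA (he : IsTorus h e) {ω : k} (hω : ω ≠ 0) : Top k e (polyA h ω e) (1, 2) := by
  have hh := he.h_ne_zero
  refine ⟨ω ^ 2 * h ^ 3, mul_ne_zero (pow_ne_zero 2 hω) (pow_ne_zero 3 hh), ?_⟩
  have h1 : orb e (1 : k) (1, -1) - e (1, 2) ∈ Fil k e (1, 2) := by
    rw [show orb e (1 : k) (1, -1) - e (1, 2) = e (1, -1) + e (-2, -1) by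
      simp only [orb, rot]; norm_num; abel]
    exact add_mem (mem_fil (by simp [Below])) (mem_fil (by simp [Below]))
  have h2 : orb e (1 : k) (-1, 1) ∈ Fil k e (1, 2) := by
    simp only [orb, rot, one_smul, one_pow]
    exact add_mem (add_mem (mem_fil (by simp [Below])) (mem_fil (by simp [Below])))
      (mem_fil (by simp [Below]))
  have h3 : (1 : D) ∈ Fil k e (1, 2) := he.one ▸ mem_fil (by simp [Below])
  rw [polyA, add_assoc, add_sub_right_comm, ← smul_sub]
  exact add_mem (smul_mem _ _ h1) (add_mem (smul_mem _ _ h2) (smul_mem _ _ h3))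

theorem orb_mul_inv_mem (he : IsTorus h e) {ω : k} (hω : ω ^ 2 + ω + 1 = 0) (E : Subalgebra k D)
    (ha : orb e ω (1, 0) ≠ 0)
    (hb : orb e ω (-1, 0) * (orb e ω (1, 0))⁻¹ ∈ E)
    (hc : orb e ω (1, -1) * (orb e ω (1, 0))⁻¹ ∈ E)
    (hc' : orb e ω (-1, 1) * (orb e ω (1, 0))⁻¹ ∈ E)
    (h₁ : orb e (1 : k) (1, 0) ∈ E) (h₂ : orb e (1 : k) (-1, 0) ∈ E) (i j : ℤ) :
    orb e ω (i, j) * (orb e ω (1, 0))⁻¹ ∈ E := by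
  have hh := he.h_ne_zero
  have hω0 : ω ≠ 0 := by rintro rfl; simp at hω
  have hω3 : ω ^ 3 = 1 := by linear_combination (ω - 1) * hω
  have haa : orb e ω (1, 0) * (orb e ω (1, 0))⁻¹ ∈ E := by
    rw [mul_inv_cancel₀ ha]; exact one_mem E
  have hrot (v : ℤ × ℤ) (hv : orb e ω v * (orb e ω (1, 0))⁻¹ ∈ E) :
      orb e ω (rot v) * (orb e ω (1, 0))⁻¹ ∈ E := by
    rw [orb_rot hω3, smul_mul_assoc]
    exact E.smul_mem hv _
  have hzero : orb e ω (0, 0) = 0 := by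
    simp only [orb, rot]
    norm_num
    rw [show e (0, 0) + ω • e (0, 0) + ω ^ 2 • e (0, 0) = (ω ^ 2 + ω + 1) • e (0, 0) by module,
      hω, zero_smul]
  set a' := (orb e ω (1, 0))⁻¹
  have solve {s t r₁ r₂ r₃ : D} {c₁ c₂ c₃ : k} (hs : s ∈ E) (ht : t * a' ∈ E)
      (hsum : s * t = c₁ • r₁ + c₂ • r₂ + c₃ • r₃) :
      (c₁ ≠ 0 → r₂ * a' ∈ E → r₃ * a' ∈ E → r₁ * a' ∈ E) ∧
      (c₂ ≠ 0 → r₁ * a' ∈ E → r₃ * a' ∈ E → r₂ * a' ∈ E) ∧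
      (c₃ ≠ 0 → r₁ * a' ∈ E → r₂ * a' ∈ E → r₃ * a' ∈ E) := by
    have h0 : c₁ • (r₁ * a') + c₂ • (r₂ * a') + c₃ • (r₃ * a') ∈ E := by
      have := mul_mem hs ht
      rwa [← mul_assoc, hsum, add_mul, add_mul, smul_mul_assoc, smul_mul_assoc,
        smul_mul_assoc] at this
    have hE {c : k} {r : D} (hc : c ≠ 0) (hr : c • r ∈ E) : r ∈ E := by
      have := E.smul_mem hr c⁻¹
      rwa [smul_smul, inv_mul_cancel₀ hc, one_smul] at this
    refine ⟨fun hc h2 h3 => hE hc ?_, fun hc h2 h3 => hE hc ?_, fun hc h2 h3 => hE hc ?_⟩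
    · convert sub_mem (sub_mem h0 (E.smul_mem h2 c₂)) (E.smul_mem h3 c₃) using 1
      abel
    · convert sub_mem (sub_mem h0 (E.smul_mem h2 c₁)) (E.smul_mem h3 c₃) using 1
      abel
    · convert sub_mem (sub_mem h0 (E.smul_mem h2 c₁)) (E.smul_mem h3 c₂) using 1
      abel
  have S₁ (i j : ℤ) := fun ht => solve h₁ ht (orb_mul_orb he (one_pow 3) (η := ω) (1, 0) (i, j))
  have S₂ (i j : ℤ) := fun ht => solve h₂ ht (orb_mul_orb he (one_pow 3) (η := ω) (-1, 0) (i, j))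
  have hz (n : ℤ) : h ^ n ≠ 0 := zpow_ne_zero n hh
  simp only [rot, one_mul, one_pow, ne_eq, hz, not_false_eq_true, true_imp_iff, Prod.mk_add_mk,
    neg_zero, zero_add, sub_zero, zero_sub, neg_neg, add_comm (1 : ℤ), add_comm (-1 : ℤ),
    ← sub_eq_add_neg] at S₁ S₂
  refine forall_of_triangles (P := fun i j => orb e ω (i, j) * a' ∈ E) ?_
    (fun i j h h1 h2 => (S₁ i j h).2.2 h1 h2) (fun i j h h1 h2 => (S₁ i j h).2.1 h1 h2)
    (fun i j h h1 h2 => (S₁ i j h).1 h1 h2) (fun i j h h1 h2 => (S₂ i j h).2.2 h1 h2)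
    (fun i j h h1 h2 => (S₂ i j h).2.1 h1 h2) (fun i j h h1 h2 => (S₂ i j h).1 h1 h2) i j
  intro i j hi hj
  rw [abs_le] at hi hj
  have e1 := hrot _ haa
  have e2 := hrot _ e1
  have e3 := hrot _ hb
  have e4 := hrot _ e3
  simp only [rot] at e1 e2 e3 e4
  norm_num at e1 e2 e3 e4
  obtain rfl | rfl | rfl : i = -1 ∨ i = 0 ∨ i = 1 := by omega
  all_goals obtain rfl | rfl | rfl : j = -1 ∨ j = 0 ∨ j = 1 := by omega
  all_goals first | assumption | (rw [hzero, zero_mul]; exact zero_mem E)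

end Orb

section Three

variable {h ω : k} {e : ℤ × ℤ → D}

theorem orb_one_mem (he : IsTorus h e) (E : Subalgebra k D) (ha : orb e ω (1, 0) ≠ 0)
    (hE : ∀ v, orb e ω v * (orb e ω (1, 0))⁻¹ ∈ E) (v : ℤ × ℤ) : orb e (1 : k) v ∈ E := by
  have : orb e (1 : k) v = orb e (1 : k) v * orb e ω (1, 0) * (orb e ω (1, 0))⁻¹ := by
    rw [mul_inv_cancel_right₀ ha]
  rw [this, orb_mul_orb he (one_pow 3), one_mul, add_mul, add_mul, smul_mul_assoc, smul_mul_assoc,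
    smul_mul_assoc]
  exact add_mem (add_mem (E.smul_mem (hE _) _) (E.smul_mem (hE _) _)) (E.smul_mem (hE _) _)

theorem orb_sq_mul_mem (he : IsTorus h e) (hω : ω ^ 3 = 1) (E : Subalgebra k D)
    (hE : ∀ v, orb e (1 : k) v ∈ E) (v : ℤ × ℤ) : orb e (ω ^ 2) v * orb e ω (1, 0) ∈ E := by
  rw [orb_mul_orb he (by rw [← pow_mul, mul_comm, pow_mul, hω, one_pow]), ← pow_succ, hω]
  exact add_mem (add_mem (E.smul_mem (hE _) _) (E.smul_mem (hE _) _)) (E.smul_mem (hE _) _)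

theorem three_smul_eq_orb (hω : ω ^ 2 + ω + 1 = 0) (v : ℤ × ℤ) :
    (3 : k) • e v = orb e (1 : k) v + orb e ω v + orb e (ω ^ 2) v := by
  simp only [orb]
  match_scalars <;> grind

theorem IsFrame.mem_range_iff_of_orb [CharZero k] (he : IsFrame h e) (hω : ω ^ 2 + ω + 1 = 0)
    {ρ F : D →ₐ[k] D} (hρ : ∀ v, ρ (e v) = e (rot v)) (hF : ∀ d ∈ F.range, ρ d = d)
    (ha : orb e ω (1, 0) ≠ 0)
    (hE : ∀ v, orb e ω v * (orb e ω (1, 0))⁻¹ ∈ F.range) (d : D) :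
    d ∈ F.range ↔ ρ d = d := by
  have hω3 : ω ^ 3 = 1 := by linear_combination (ω - 1) * hω
  have h1 := orb_one_mem he.toIsTorus F.range ha hE
  have h2 := orb_sq_mul_mem he.toIsTorus hω3 F.range h1
  have hρa := map_orb hρ hω3 (1, 0)
  set a := orb e ω (1, 0) with hadef
  have hspan (v : ℤ × ℤ) : e v ∈ span F.range ({1, a, a⁻¹} : Set D) := by
    have : e v = (3⁻¹ : k) • (orb e (1 : k) v * 1 + orb e ω v * a⁻¹ * a +
        orb e (ω ^ 2) v * a * a⁻¹) := by
      rw [mul_one, inv_mul_cancel_right₀ ha, mul_inv_cancel_right₀ ha, ← three_smul_eq_orb hω,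
        smul_smul, inv_mul_cancel₀ three_ne_zero, one_smul]
    rw [this]
    have hs {r s : D} (hr : r ∈ F.range) (hs : s ∈ ({1, a, a⁻¹} : Set D)) :
        r * s ∈ span F.range ({1, a, a⁻¹} : Set D) :=
      smul_mem _ (⟨r, hr⟩ : F.range) (subset_span hs)
    rw [← algebraMap_smul F.range (3⁻¹ : k)]
    exact smul_mem _ _ (add_mem (add_mem (hs (h1 v) (by simp)) (hs (hE v) (by simp)))
      (hs (h2 v) (by simp)))
  have : IsNoetherianRing F.range :=
    isNoetherianRing_of_surjective D F.range F.rangeRestrict.toRingHom F.rangeRestrict_surjective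
  have hfg : (span F.range (Set.range e)).FG :=
    Submodule.FG.of_le (fg_span (by simp : ({1, a, a⁻¹} : Set D).Finite))
      (span_le.2 (by rintro _ ⟨v, rfl⟩; exact hspan v))
  have htop : span F.range (Set.range e) = ⊤ := by
    refine eq_top_of_mul_mem F _ hfg (subset_span ⟨0, he.one⟩) _ he.generators ?_
    intro s hs v hv
    have hmul (w : ℤ × ℤ) : v * e w ∈ span F.range (Set.range e) := by
      induction hv using span_induction with
      | mem x hx =>
        obtain ⟨u, rfl⟩ := hx
        rw [he.mul, ← algebraMap_smul F.range]
        exact smul_mem _ _ (subset_span ⟨_, rfl⟩)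
      | zero => simp
      | add x y _ _ hx hy => rw [add_mul]; exact add_mem hx hy
      | smul r x _ hx => rw [smul_mul_assoc]; exact smul_mem _ _ hx
    rcases hs with rfl | rfl <;> exact hmul _
  have hall : d ∈ span F.range ({1, a, a⁻¹} : Set D) := by
    refine span_le.2 ?_ (htop ▸ mem_top : d ∈ span F.range (Set.range e))
    rintro _ ⟨v, rfl⟩
    exact hspan v
  refine ⟨hF d, fun hd => ?_⟩
  rw [mem_span_triple] at hall
  obtain ⟨r₀, r₁, r₂, rfl⟩ := hall
  have e0 := hF _ r₀.2
  have e1 := hF _ r₁.2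
  have e2 := hF _ r₂.2
  have hω0 : ω ≠ 0 := by rintro rfl; simp at hω
  have hinv : (ω ^ 2)⁻¹ = ω := inv_eq_of_mul_eq_one_right (by linear_combination hω3)
  have hρd := congrArg ρ hd
  simp only [Subalgebra.smul_def, smul_eq_mul, map_add, map_mul, map_inv₀, e0, e1, e2, hρa,
    map_smul, smul_inv₀, hinv, mul_smul_comm, mul_one] at hd hρd ⊢
  have h3 : (3 : k) • ((r₀ : D) + r₁ * a + r₂ * a⁻¹) = (3 : k) • (r₀ : D) := by
    linear_combination (norm := skip) -hρd - (2 : k) • hd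
    match_scalars <;> grind
  rw [smul_right_injective D (three_ne_zero : (3 : k) ≠ 0) h3]
  exact r₀.2

theorem IsFrame.exists_fixed_three [CharZero k] (he : IsFrame h e) (hω : ω ^ 2 + ω + 1 = 0)
    {ρ : D →ₐ[k] D} (h1 : ρ (e (1, 0)) = e (0, 1)) (h2 : ρ (e (0, 1)) = e (-1, -1)) :
    ∃ F : D →ₐ[k] D, (∀ d, d ∈ F.range ↔ ρ d = d) ∧
      ∀ κ : D →ₐ[k] D, (∀ v, κ (e v) = e (-v)) → κ (F (e (1, 0))) = (F (e (1, 0)))⁻¹ ∧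
        F (e (0, 1)) * κ (F (e (0, 1))) =
          (ω ^ 2 * (h ^ 2)⁻¹) • ((F (e (1, 0)))⁻¹ * (F (e (1, 0)))⁻¹ * (F (e (1, 0)))⁻¹) +
          (ω ^ 2 * (1 + h ^ 2)) • 1 +
          (ω ^ 2 * (h ^ 2) ^ 2) • (F (e (1, 0)) * F (e (1, 0)) * F (e (1, 0))) := by
  have hh := he.h_ne_zero
  have hω0 : ω ≠ 0 := by rintro rfl; simp at hω
  have hω3 : ω ^ 3 = 1 := by linear_combination (ω - 1) * hω
  have hρ := map_eq_rot he.toIsTorus h1 h2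
  have hA := he.top_ne_zero (top_polyA he.toIsTorus hω0)
  have la := (top_orb_right (e := e) hω0).lead he.toIsTorus
  have lb := (top_orb_left (e := e) hω0).lead he.toIsTorus
  have lc := (top_orb_diagonal (e := e) hω0).lead he.toIsTorus
  have ha := la.ne_zero he.toIsTorus
  have hb := lb.ne_zero he.toIsTorus
  have lg := lb.mul he (la.inv he.toIsTorus)
  have lθ := lc.mul he (la.inv he.toIsTorus)
  obtain ⟨g, hgdef⟩ : ∃ g, g = orb e ω (-1, 0) * (orb e ω (1, 0))⁻¹ := ⟨_, rfl⟩
  obtain ⟨θ, hθdef⟩ : ∃ θ, θ = orb e ω (1, -1) * (orb e ω (1, 0))⁻¹ := ⟨_, rfl⟩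
  obtain ⟨θ', hθdef'⟩ : ∃ θ', θ' = orb e ω (-1, 1) * (orb e ω (1, 0))⁻¹ := ⟨_, rfl⟩
  rw [← hgdef] at lg
  rw [← hθdef] at lθ
  have hg : g * orb e ω (1, 0) = orb e ω (-1, 0) := by rw [hgdef, inv_mul_cancel_right₀ ha]
  have hθ : θ * orb e ω (1, 0) = orb e ω (1, -1) := by rw [hθdef, inv_mul_cancel_right₀ ha]
  have hθ' : θ' * orb e ω (1, 0) = orb e ω (-1, 1) := by rw [hθdef', inv_mul_cancel_right₀ ha]
  have hg0 := lg.ne_zero he.toIsTorus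
  have R1 := orb_ratio_rel he.toIsTorus hω ha hA hg hθ
  have R2 := orb_ratio_rel' he.toIsTorus hω ha hA hg hθ'
  have R3 := orb_ratio_mul he.toIsTorus hω ha hA hg hθ hθ' hg0
  rw [show h ^ 4 = (h ^ 2) ^ 2 by ring] at R3
  have C1 := ratio_commute hg0 R1
  have C2 := ratio_commute' hg0 R2
  have C3 := ratio_mul hω (pow_ne_zero 2 hh) hg0 R1 R2 R3
  have lf : Lead k e (θ - g * g - ω ^ 2 • g⁻¹) (1, 1) := by
    have := (lθ.add he ((lg.mul he lg).leadLt (by simp [Below])).neg).add he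
      (((lg.inv he.toIsTorus).smul (pow_ne_zero 2 hω0)).leadLt (by simp [Below])).neg
    simpa [sub_eq_add_neg] using this
  have hT := he.isTorus_monomial C1 lg lf (by simp)
  obtain ⟨F, hF⟩ := he.exists_algHom hT
  have hF1 : F (e (1, 0)) = g := by simp [hF, monomial]
  have hF2 : F (e (0, 1)) = θ - g * g - ω ^ 2 • g⁻¹ := by simp [hF, monomial]
  have hab : orb e ω (1, 0) * (orb e ω (-1, 0))⁻¹ = g⁻¹ := by
    rw [hgdef, mul_inv_rev, inv_inv]
  have κg (κ : D →ₐ[k] D) (hκ : ∀ v, κ (e v) = e (-v)) : κ g = g⁻¹ := by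
    rw [← hab, hgdef, map_mul, map_inv₀, map_orb_neg hκ, map_orb_neg hκ]
    simp
  have κf (κ : D →ₐ[k] D) (hκ : ∀ v, κ (e v) = e (-v)) :
      κ (θ - g * g - ω ^ 2 • g⁻¹) = θ' * g⁻¹ - g⁻¹ * g⁻¹ - ω ^ 2 • g := by
    have : κ θ = θ' * g⁻¹ := by
      rw [← hab, hθdef, hθdef', map_mul, map_inv₀, map_orb_neg hκ, map_orb_neg hκ, ← mul_assoc,
        inv_mul_cancel_right₀ ha]
      simp
    rw [map_sub, map_sub, map_mul, map_smul, map_inv₀, κg κ hκ, this, inv_inv]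
  have hquot (v : ℤ × ℤ) : ρ (orb e ω v * (orb e ω (1, 0))⁻¹) =
      orb e ω v * (orb e ω (1, 0))⁻¹ := by
    rw [map_mul, map_inv₀, map_orb hρ hω3, map_orb hρ hω3, smul_inv₀, smul_mul_smul_comm,
      mul_inv_cancel₀ (pow_ne_zero 2 hω0), one_smul]
  have ρg : ρ g = g := by rw [hgdef, hquot]
  have ρθ : ρ θ = θ := by rw [hθdef, hquot]
  have hρF : ρ.comp F = F := he.algHom_ext (by simp [hF1, ρg]) (by simp [hF2, ρg, ρθ])
  have hfix : ∀ d ∈ F.range, ρ d = d := by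
    rintro _ ⟨r, rfl⟩
    exact DFunLike.congr_fun hρF r
  have mg : g ∈ F.range := ⟨_, hF1⟩
  have mg' : g⁻¹ ∈ F.range := inv_mem_range F mg
  have mf : θ - g * g - ω ^ 2 • g⁻¹ ∈ F.range := ⟨_, hF2⟩
  have mθ : θ ∈ F.range := by
    have := add_mem (add_mem mf (F.range.smul_mem mg' (ω ^ 2))) (mul_mem mg mg)
    rwa [sub_add_cancel, sub_add_cancel] at this
  have mf' : θ' * g⁻¹ - g⁻¹ * g⁻¹ - ω ^ 2 • g ∈ F.range := by
    rw [← inv_mul_cancel_left₀ (lf.ne_zero he.toIsTorus) (θ' * g⁻¹ - g⁻¹ * g⁻¹ - ω ^ 2 • g), C3]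
    exact mul_mem (inv_mem_range F mf) (add_mem (add_mem
      (F.range.smul_mem (mul_mem (mul_mem mg' mg') mg') _) (F.range.smul_mem (one_mem _) _))
      (F.range.smul_mem (mul_mem (mul_mem mg mg) mg) _))
  have mθ' : θ' ∈ F.range := by
    have := mul_mem (add_mem (add_mem mf' (F.range.smul_mem mg (ω ^ 2))) (mul_mem mg' mg')) mg
    rwa [sub_add_cancel, sub_add_cancel, inv_mul_cancel_right₀ hg0] at this
  have m₁ : orb e (1 : k) (1, 0) ∈ F.range := by
    rw [← mul_inv_cancel_right₀ hb (orb e (1 : k) (1, 0)), orb_one_mul_orb_neg he.toIsTorus hω,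
      ← hθ, ← hθ', ← smul_mul_assoc, ← smul_mul_assoc, ← add_mul, mul_assoc, hab]
    exact mul_mem (add_mem (F.range.smul_mem mθ' _) (F.range.smul_mem mθ _)) mg'
  have m₂ : orb e (1 : k) (-1, 0) ∈ F.range := by
    rw [← mul_inv_cancel_right₀ ha (orb e (1 : k) (-1, 0)), orb_one_neg_mul_orb he.toIsTorus hω,
      ← hθ, ← hθ', ← smul_mul_assoc, ← smul_mul_assoc, ← add_mul, mul_inv_cancel_right₀ ha]
    exact add_mem (F.range.smul_mem mθ _) (F.range.smul_mem mθ' _)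
  refine ⟨F, he.mem_range_iff_of_orb hω hρ hfix ha fun v => orb_mul_inv_mem he.toIsTorus hω F.range
    ha (hgdef ▸ mg) (hθdef ▸ mθ) (hθdef' ▸ mθ') m₁ m₂ v.1 v.2, fun κ hκ => ?_⟩
  rw [hF1, hF2, κg κ hκ, κf κ hκ]
  exact ⟨rfl, C3⟩

end Three

section Six

variable {h ω : k} {e : ℤ × ℤ → D}

theorem IsFrame.exists_fixed_inversion_six [CharZero k] (he : IsFrame h e) (hω : ω ≠ 0)
    {κ : D →ₐ[k] D} (h1 : κ (e (1, 0)) = (e (1, 0))⁻¹)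
    (h2 : e (0, 1) * κ (e (0, 1)) =
      (ω ^ 2 * (h ^ 2)⁻¹) • ((e (1, 0))⁻¹ * (e (1, 0))⁻¹ * (e (1, 0))⁻¹) +
        (ω ^ 2 * (1 + h ^ 2)) • 1 + (ω ^ 2 * (h ^ 2) ^ 2) • (e (1, 0) * e (1, 0) * e (1, 0))) :
    ∃ F : D →ₐ[k] D, ∀ d, d ∈ F.range ↔ κ d = d := by
  have hh := he.h_ne_zero
  have hY : e (1, 0) * e (1, 0) * e (1, 0) = e (3, 0) := by simp [he.mul]
  have hY' : (e (1, 0))⁻¹ * (e (1, 0))⁻¹ * (e (1, 0))⁻¹ = e (-3, 0) := by simp [he.inv, he.mul]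
  have hκY : κ (e (3, 0)) = e (-3, 0) := by rw [← hY, ← hY', map_mul, map_mul, h1]
  have lone : Lead k e (1 : D) (0, 0) := by
    rw [← he.one]
    exact lead_monomial he.toIsTorus _
  have lu : Lead k e (1 + h ^ 4 • e (3, 0)) (3, 0) := by
    rw [add_comm]
    exact ((lead_monomial he.toIsTorus _).smul (pow_ne_zero 4 hh)).add he
      (lone.leadLt (by simp [Below]))
  have lw : Lead k e (1 + h ^ 4 • e (-3, 0)) (0, 0) :=
    lone.add he (((lead_monomial he.toIsTorus _).smul (pow_ne_zero 4 hh)).leadLt (by simp [Below]))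
  have hu0 := lu.ne_zero he.toIsTorus
  have hw0 := lw.ne_zero he.toIsTorus
  have hx0 := he.ne_zero (0, 1)
  have hκx : κ (e (0, 1)) =
      ω ^ 2 • ((1 + h ^ 4 • e (-3, 0)) * ((e (0, 1))⁻¹ * (1 + h ^ 4 • e (3, 0)))) := by
    have hc : e (0, 1) * (1 + h ^ 4 • e (-3, 0)) = (1 + (h ^ 2)⁻¹ • e (-3, 0)) * e (0, 1) := by
      simp only [mul_add, add_mul, mul_one, one_mul, mul_smul_comm, smul_mul_assoc, he.mul,
        smul_smul]
      norm_num
      match_scalars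
      field_simp
    refine mul_left_cancel₀ hx0 ?_
    rw [h2, hY, hY', mul_smul_comm, ← mul_assoc, hc, ← mul_assoc, mul_inv_cancel_right₀ hx0]
    simp only [mul_add, add_mul, mul_one, one_mul, mul_smul_comm, smul_mul_assoc, he.mul, smul_smul]
    norm_num
    rw [← Prod.zero_eq_mk, he.one]
    match_scalars <;> field_simp
  have huy : (1 + h ^ 4 • e (3, 0))⁻¹ * e (1, 0) = e (1, 0) * (1 + h ^ 4 • e (3, 0))⁻¹ := by
    refine (Commute.inv_left₀ ?_).eq
    simp [Commute, SemiconjBy, mul_add, add_mul, he.mul]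
  obtain ⟨F, -, -, hF⟩ := he.exists_fixed_of_inversion (τ := κ) (y := e (1, 0)) (n := -3)
    (x := (1 + h ^ 4 • e (3, 0))⁻¹ * e (0, 1)) (ε := 1) (c := ω ^ 2) one_ne_zero
    (pow_ne_zero 2 hω) (by rw [mul_assoc, he.rel, mul_smul_comm, ← mul_assoc, huy, mul_assoc])
    (by rw [h1, one_smul])
    (by
      rw [map_mul, map_inv₀, map_add, map_one, map_smul, hκY, hκx, mul_smul_comm,
        inv_mul_cancel_left₀ hw0, mul_inv_rev, inv_inv])
    (lead_monomial he.toIsTorus _)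
    (by simpa using (lu.inv he.toIsTorus).mul he (lead_monomial he.toIsTorus (0, 1)))
    (by
      intro C hC hs
      have hyC : e (1, 0) ∈ C := hs (Set.mem_insert _ _)
      refine he.eq_top C hC hyC ?_
      have := mul_mem (add_mem (one_mem C) (C.smul_mem (mul_mem (mul_mem hyC hyC) hyC) (h ^ 4)))
        (hs (Set.mem_insert_of_mem _ rfl))
      rwa [hY, mul_inv_cancel_left₀ hu0] at this)
  exact ⟨F, hF⟩

theorem IsFrame.exists_fixed_six [CharZero k] (he : IsFrame h e) (hω : ω ^ 2 + ω + 1 = 0)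
    {ρ κ : D →ₐ[k] D} (h1 : ρ (e (1, 0)) = e (0, 1)) (h2 : ρ (e (0, 1)) = e (-1, -1))
    (hκ : ∀ v, κ (e v) = e (-v)) :
    ∃ F : D →ₐ[k] D, ∀ d, d ∈ F.range ↔ ρ d = d ∧ κ d = d := by
  have hω0 : ω ≠ 0 := by rintro rfl; simp at hω
  have hρ := map_eq_rot he.toIsTorus h1 h2
  obtain ⟨F₁, hF₁, hκF⟩ := he.exists_fixed_three hω h1 h2
  obtain ⟨hκy, hκx⟩ := hκF κ hκ
  have hcomm : κ.comp ρ = ρ.comp κ := he.algHom_ext (by simp [hρ, hκ, rot]) (by simp [hρ, hκ, rot])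
  obtain ⟨κ', hκ'⟩ := exists_conj F₁ κ (fun d hd => by
    rw [hF₁] at hd ⊢
    conv_rhs => rw [← hd]
    exact (DFunLike.congr_fun hcomm d).symm)
  obtain ⟨F₂, hF₂⟩ := he.exists_fixed_inversion_six (ω := ω) (κ := κ') hω0
    (F₁.toRingHom.injective (by simpa [hκ'] using hκy))
    (F₁.toRingHom.injective (by simpa [hκ'] using hκx))
  refine ⟨F₁.comp F₂, fun d => ?_⟩
  rw [mem_range_comp_iff hκ' hF₂, hF₁]

end Six

/-- An integral binary quadratic form of discriminant `-3` or `-4` represents `1` or `-1`. -/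
theorem exists_abs_form_eq_one (A B C : ℤ)
    (hdisc : B ^ 2 - 4 * A * C = -3 ∨ B ^ 2 - 4 * A * C = -4) :
    ∃ i j : ℤ, |A * i ^ 2 + B * i * j + C * j ^ 2| = 1 := by
  induction hN : A.natAbs using Nat.strong_induction_on generalizing A B C with
  | _ N ih =>
  have hA0 : A ≠ 0 := by
    rintro rfl
    rcases hdisc with h | h <;> nlinarith [sq_nonneg B]
  by_cases hA1 : |A| = 1
  · exact ⟨1, 0, by simpa using hA1⟩
  have hA2 : 2 ≤ |A| := by
    have := abs_pos.2 hA0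
    omega
  obtain ⟨n, hn⟩ : ∃ n : ℤ, |B - 2 * A * n| ≤ |A| := by
    have h1 := Int.emod_add_mul_ediv (B + |A|) (2 * |A|)
    have h2 := Int.emod_nonneg (B + |A|) (show 2 * |A| ≠ 0 by omega)
    have h3 := Int.emod_lt_of_pos (B + |A|) (show 0 < 2 * |A| by omega)
    generalize (B + |A|) % (2 * |A|) = r at h1 h2 h3
    generalize (B + |A|) / (2 * |A|) = m at h1
    rcases abs_choice A with hA | hA
    · exact ⟨m, by rw [abs_le]; rw [hA] at h1 h3 ⊢; constructor <;> linarith⟩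
    · exact ⟨-m, by rw [abs_le]; rw [hA] at h1 h3 ⊢; constructor <;> linarith⟩
  obtain ⟨B', hB'⟩ : ∃ B', B' = B - 2 * A * n := ⟨_, rfl⟩
  obtain ⟨C', hC'⟩ : ∃ C', C' = A * n ^ 2 - B * n + C := ⟨_, rfl⟩
  rw [← hB'] at hn
  have hdisc' : B' ^ 2 - 4 * C' * A = -3 ∨ B' ^ 2 - 4 * C' * A = -4 := by
    have : B' ^ 2 - 4 * C' * A = B ^ 2 - 4 * A * C := by rw [hB', hC']; ring
    rwa [this]
  have hlt : |C'| < |A| := by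
    have h1 : B' ^ 2 ≤ |A| ^ 2 := by
      rw [← sq_abs B']
      exact pow_le_pow_left₀ (abs_nonneg _) hn 2
    have h2 : 4 * (|C'| * |A|) ≤ |A| ^ 2 + 4 := by
      rw [← abs_mul, ← abs_of_pos (show (0 : ℤ) < 4 by norm_num), ← abs_mul, abs_le,
        abs_of_pos (show (0 : ℤ) < 4 by norm_num)]
      constructor <;> rcases hdisc' with h | h <;> nlinarith [sq_nonneg B', sq_nonneg |A|]
    by_contra! hle
    nlinarith
  obtain ⟨i, j, hij⟩ := ih C'.natAbs (by rw [← hN]; zify; exact hlt) C' B' A hdisc' rfl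
  refine ⟨j - n * i, i, ?_⟩
  rw [← hij, hB', hC']
  congr 1
  ring

/-- A sequence satisfying the recursion of powers of a non-elliptic matrix grows linearly. -/
theorem mul_abs_le_of_recurrence {u : ℕ → ℤ} {t : ℤ} (ht : 2 ≤ |t|) (h0 : u 0 = 0)
    (hrec : ∀ n, u (n + 2) = t * u (n + 1) - u n) (n : ℕ) : n * |u 1| ≤ |u n| := by
  have hstep (n : ℕ) : |u n| + |u 1| ≤ |u (n + 1)| := by
    induction n with
    | zero => simp [h0]
    | succ n ih =>
      have h1 : |t| * |u (n + 1)| - |u n| ≤ |u (n + 2)| := by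
        rw [hrec, ← abs_mul]
        exact abs_sub_abs_le_abs_sub _ _
      nlinarith [abs_nonneg (u (n + 1))]
  induction n with
  | zero => simp [h0]
  | succ n ih =>
    have := hstep n
    push_cast
    linarith

section Action

variable {h : k} {e : ℤ × ℤ → D}

variable (e) in
/-- `ψ` acts on the exponents of the monomials `e` by the matrix `(a b; c d)`. -/
def ActsBy (ψ : D ≃ₐ[k] D) (a b c d : ℤ) : Prop :=
  a * d - b * c = 1 ∧ ∀ i j, ψ (e (i, j)) = e (a * i + b * j, c * i + d * j)

theorem ActsBy.mul {ψ φ : D ≃ₐ[k] D} {a b c d a' b' c' d' : ℤ} (hψ : ActsBy e ψ a b c d)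
    (hφ : ActsBy e φ a' b' c' d') : ActsBy e (ψ * φ) (a * a' + b * c') (a * b' + b * d')
      (c * a' + d * c') (c * b' + d * d') := by
  refine ⟨?_, fun i j => ?_⟩
  · linear_combination hφ.1 * (a * d - b * c) + hψ.1
  · rw [AlgEquiv.mul_apply, hφ.2, hψ.2]
    congr 2 <;> ring

theorem ActsBy.inv {ψ : D ≃ₐ[k] D} {a b c d : ℤ} (hψ : ActsBy e ψ a b c d) :
    ActsBy e ψ⁻¹ d (-b) (-c) a := by
  refine ⟨by linear_combination hψ.1, fun i j => ?_⟩
  apply ψ.injective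
  rw [← AlgEquiv.mul_apply, mul_inv_cancel, AlgEquiv.one_apply, hψ.2]
  congr 2
  · linear_combination (-i) * hψ.1
  · linear_combination (-j) * hψ.1

theorem ActsBy.apply_eq (he : IsFrame h e) {ψ φ : D ≃ₐ[k] D} {a b c d : ℤ}
    (hψ : ActsBy e ψ a b c d) (hφ : ActsBy e φ a b c d) (r : D) : ψ r = φ r := by
  have : (ψ : D →ₐ[k] D) = φ := he.algHom_ext (by simp [hψ.2, hφ.2]) (by simp [hψ.2, hφ.2])
  exact DFunLike.congr_fun this r

theorem actsBy_one : ActsBy e (1 : D ≃ₐ[k] D) 1 0 0 1 := ⟨by norm_num, fun i j => by simp⟩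

theorem ActsBy.apply_of_one (he : IsFrame h e) {ψ : D ≃ₐ[k] D} (hψ : ActsBy e ψ 1 0 0 1) (r : D) :
    ψ r = r :=
  hψ.apply_eq he actsBy_one r

theorem ActsBy.comp {ψ : D ≃ₐ[k] D} {a b c d : ℤ} (hψ : ActsBy e ψ a b c d) {u w : ℤ × ℤ}
    (hdet : u.1 * w.2 - u.2 * w.1 = 1) :
    ∃ a' b' c' d', ActsBy (fun v => e (v.1 • u + v.2 • w)) ψ a' b' c' d' := by
  obtain ⟨u₁, u₂⟩ := u
  obtain ⟨w₁, w₂⟩ := w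
  simp only at hdet
  refine ⟨w₂ * (a * u₁ + b * u₂) - w₁ * (c * u₁ + d * u₂),
    w₂ * (a * w₁ + b * w₂) - w₁ * (c * w₁ + d * w₂),
    u₁ * (c * u₁ + d * u₂) - u₂ * (a * u₁ + b * u₂),
    u₁ * (c * w₁ + d * w₂) - u₂ * (a * w₁ + b * w₂), ?_, fun i j => ?_⟩
  · linear_combination (a * d - b * c) * (u₁ * w₂ - u₂ * w₁ + 1) * hdet + hψ.1
  · simp only [Prod.smul_mk, Prod.mk_add_mk, smul_eq_mul, hψ.2]
    congr 2
    · linear_combination (-(a * (i * u₁ + j * w₁) + b * (i * u₂ + j * w₂))) * hdet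
    · linear_combination (-(c * (i * u₁ + j * w₁) + d * (i * u₂ + j * w₂))) * hdet

theorem ActsBy.eq_one_or_neg_one_or_abs_trace_le (he : IsTorus h e) {ψ : D ≃ₐ[k] D}
    {a b c d : ℤ} (hψ : ActsBy e ψ a b c d) (hfin : IsOfFinOrder ψ) :
    (a = 1 ∧ b = 0 ∧ c = 0 ∧ d = 1) ∨ (a = -1 ∧ b = 0 ∧ c = 0 ∧ d = -1) ∨ |a + d| ≤ 1 := by
  by_cases ht : |a + d| ≤ 1
  · exact .inr (.inr ht)
  obtain ⟨n, hn, hψn⟩ := isOfFinOrder_iff_pow_eq_one.1 hfin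
  have key (v : ℤ × ℤ) : v.1 * (c * v.1 + d * v.2) - v.2 * (a * v.1 + b * v.2) = 0 := by
    obtain ⟨M, hM⟩ : ∃ M : ℤ × ℤ → ℤ × ℤ, M = fun v => (a * v.1 + b * v.2, c * v.1 + d * v.2) :=
      ⟨_, rfl⟩
    have hpow (m : ℕ) : (ψ ^ m) (e v) = e (M^[m] v) := by
      induction m with
      | zero => simp
      | succ m ih => rw [pow_succ', AlgEquiv.mul_apply, ih, Function.iterate_succ_apply', hM,
          ← hψ.2]
    have hfix : M^[n] v = v := by
      apply he.linearIndependent.injective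
      rw [← hpow, hψn, AlgEquiv.one_apply]
    have := mul_abs_le_of_recurrence (t := a + d)
      (u := fun m => v.1 * (M^[m] v).2 - v.2 * (M^[m] v).1) (by omega) (by simp [mul_comm])
      (fun m => by
        simp only [Function.iterate_succ_apply']
        set w := M^[m] v
        simp only [hM]
        linear_combination (v.2 * w.1 - v.1 * w.2) * hψ.1) n
    simp only [hfix, Function.iterate_one] at this
    rw [mul_comm v.1 v.2, sub_self, abs_zero] at this
    have h0 : |v.1 * (M v).2 - v.2 * (M v).1| ≤ 0 := by
      have hn' : (0 : ℤ) < n := by exact_mod_cast hn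
      nlinarith
    rw [hM] at h0
    exact abs_nonpos_iff.1 h0
  have h1 := key (1, 0)
  have h2 := key (0, 1)
  have h3 := key (1, 1)
  simp only [mul_one, mul_zero, add_zero, zero_add, one_mul, zero_mul, sub_zero, zero_sub,
    neg_eq_zero] at h1 h2 h3
  obtain rfl : d = a := by omega
  have := hψ.1
  rw [h2, zero_mul, sub_zero] at this
  rcases Int.mul_eq_one_iff_eq_one_or_neg_one.1 this with ⟨h, -⟩ | ⟨h, -⟩ <;> simp [h, h1, h2]

end Action

section Group

variable {h ω : k} {e : ℤ × ℤ → D} {G : Subgroup (D ≃ₐ[k] D)}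

theorem ActsBy.exists_companion_of_eq_one (he : IsFrame h e)
    (hG : ∀ ψ ∈ G, ∃ a b c d, ActsBy e ψ a b c d) {ψ : D ≃ₐ[k] D}
    {a b c d : ℤ} (hψ : ActsBy e ψ a b c d) {i j : ℤ}
    (hij : c * i ^ 2 + (d - a) * i * j + -b * j ^ 2 = 1) :
    ∃ e' : ℤ × ℤ → D, IsFrame h e' ∧ (∀ ψ ∈ G, ∃ a b c d, ActsBy e' ψ a b c d) ∧
      ActsBy e' ψ 0 (-1) 1 (a + d) := by
  have hdet : i * (c * i + d * j) - j * (a * i + b * j) = 1 := by linear_combination hij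
  refine ⟨_, he.comp (u := (i, j)) (w := (a * i + b * j, c * i + d * j)) hdet, ?_, ?_, ?_⟩
  · intro φ hφ
    obtain ⟨a', b', c', d', hφ'⟩ := hG φ hφ
    exact hφ'.comp hdet
  · ring
  · intro m n
    simp only [Prod.smul_mk, Prod.mk_add_mk, smul_eq_mul, hψ.2]
    congr 2
    · linear_combination (-(n * i)) * hψ.1
    · linear_combination (-(n * j)) * hψ.1

theorem ActsBy.exists_companion (he : IsFrame h e)
    (hG : ∀ ψ ∈ G, ∃ a b c d, ActsBy e ψ a b c d) {ψ : D ≃ₐ[k] D} (hψG : ψ ∈ G)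
    {a b c d : ℤ} (hψ : ActsBy e ψ a b c d) (ht : a + d = 0 ∨ a + d = -1) :
    ∃ e' : ℤ × ℤ → D, IsFrame h e' ∧ (∀ ψ ∈ G, ∃ a b c d, ActsBy e' ψ a b c d) ∧
      ∃ ψ' ∈ G, ActsBy e' ψ' 0 (-1) 1 (a + d) := by
  obtain ⟨i, j, hij⟩ := exists_abs_form_eq_one c (d - a) (-b) (by
    have : (d - a) ^ 2 - 4 * c * -b = (a + d) ^ 2 - 4 := by linear_combination (-4) * hψ.1
    rw [this]
    rcases ht with ht | ht <;> simp [ht])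
  rcases (abs_eq zero_le_one).1 hij with h1 | h1
  · obtain ⟨e', he', hG', h'⟩ := hψ.exists_companion_of_eq_one he hG h1
    exact ⟨e', he', hG', ψ, hψG, h'⟩
  · obtain ⟨e', he', hG', h'⟩ := hψ.inv.exists_companion_of_eq_one he hG (i := i) (j := j)
      (by linear_combination -h1)
    exact ⟨e', he', hG', ψ⁻¹, inv_mem hψG, add_comm a d ▸ h'⟩

variable [CharZero k]

theorem exists_fixed_of_trace_zero (he : IsFrame h e) (hfin : ∀ ψ ∈ G, IsOfFinOrder ψ)
    (hG : ∀ ψ ∈ G, ∃ a b c d, ActsBy e ψ a b c d) {ψ : D ≃ₐ[k] D} (hψG : ψ ∈ G)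
    (hψ : ActsBy e ψ 0 (-1) 1 0) :
    ∃ F : D →ₐ[k] D, ∀ r, r ∈ F.range ↔ ∀ φ ∈ G, φ r = r := by
  obtain ⟨F, hF⟩ := he.exists_fixed_four (ρ := ψ) (by simp [hψ.2]) (by simp [hψ.2, he.inv])
  refine ⟨F, fun r => (hF r).trans ⟨fun hr φ hφ => ?_, fun hr => hr ψ hψG⟩⟩
  have hψr : ψ r = r := hr
  have hψψ : ActsBy e (ψ * ψ) (-1) 0 0 (-1) := by simpa using hψ.mul hψ
  have hneg {χ : D ≃ₐ[k] D} (hχ : ActsBy e χ (-1) 0 0 (-1)) : χ r = r := by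
    rw [hχ.apply_eq he hψψ, AlgEquiv.mul_apply, hψr, hψr]
  obtain ⟨a, b, c, d, hact⟩ := hG φ hφ
  have hact' := hact.mul hψ
  have hr' : (φ * ψ) r = φ r := by rw [AlgEquiv.mul_apply, hψr]
  rcases hact.eq_one_or_neg_one_or_abs_trace_le he.toIsTorus (hfin φ hφ) with
    ⟨rfl, rfl, rfl, rfl⟩ | ⟨rfl, rfl, rfl, rfl⟩ | h1
  · exact hact.apply_of_one he r
  · exact hneg hact
  rcases hact'.eq_one_or_neg_one_or_abs_trace_le he.toIsTorus (hfin _ (mul_mem hφ hψG)) with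
    ⟨h1, h2, h3, h4⟩ | ⟨h1, h2, h3, h4⟩ | h2
  · rw [h1, h2, h3, h4] at hact'
    rw [← hr', hact'.apply_of_one he r]
  · rw [h1, h2, h3, h4] at hact'
    rw [← hr', hneg hact']
  · exfalso
    rw [abs_le] at h1 h2
    nlinarith [hact.1, sq_nonneg (a - d), sq_nonneg (b + c)]

theorem exists_fixed_of_trace_neg_one (he : IsFrame h e) (hω : ω ^ 2 + ω + 1 = 0)
    (hfin : ∀ ψ ∈ G, IsOfFinOrder ψ)
    (hG : ∀ ψ ∈ G, ∃ a b c d, ActsBy e ψ a b c d) {ψ : D ≃ₐ[k] D} (hψG : ψ ∈ G)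
    (hψ : ActsBy e ψ 0 (-1) 1 (-1)) :
    ∃ F : D →ₐ[k] D, ∀ r, r ∈ F.range ↔ ∀ φ ∈ G, φ r = r := by
  have main (r : D) (hψr : ψ r = r)
      (hneg : ∀ χ ∈ G, ActsBy e χ (-1) 0 0 (-1) → χ r = r) : ∀ φ ∈ G, φ r = r := by
    intro φ hφ
    obtain ⟨a, b, c, d, h0⟩ := hG φ hφ
    have hφψ := mul_mem hφ hψG
    have hφψψ := mul_mem hφψ hψG
    have h1 := h0.mul hψ
    have h2 := h1.mul hψ
    have hpm {χ : D ≃ₐ[k] D} (hχG : χ ∈ G) {a b c d : ℤ} (hχ : ActsBy e χ a b c d)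
        (hr : χ r = φ r) : φ r = r ∨ |a + d| ≤ 1 := by
      rcases hχ.eq_one_or_neg_one_or_abs_trace_le he.toIsTorus (hfin χ hχG) with
        ⟨rfl, rfl, rfl, rfl⟩ | ⟨rfl, rfl, rfl, rfl⟩ | h1
      · exact .inl (by rw [← hr, hχ.apply_of_one he])
      · exact .inl (by rw [← hr, hneg χ hχG hχ])
      · exact .inr h1
    rcases hpm hφ h0 rfl with h | t0
    · exact h
    rcases hpm hφψ h1 (by rw [AlgEquiv.mul_apply, hψr]) with h | t1
    · exact h
    rcases hpm hφψψ h2 (by simp only [AlgEquiv.mul_apply, hψr]) with h | t2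
    · exact h
    exfalso
    have hsum : 3 ≤ (a + d) ^ 2 + (a + d) * (b - c - d) + (b - c - d) ^ 2 := by
      nlinarith [h0.1, sq_nonneg (2 * (a - d) + (b - c)), sq_nonneg (b + c)]
    rw [abs_le] at t0 t1 t2
    obtain ⟨s, hs⟩ : ∃ s, s = a + d := ⟨_, rfl⟩
    obtain ⟨t, ht⟩ : ∃ t, t = b - c - d := ⟨_, rfl⟩
    rw [← hs, ← ht] at hsum
    have hs1 : -1 ≤ s ∧ s ≤ 1 := by omega
    have ht1 : -1 ≤ t ∧ t ≤ 1 := by omega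
    have hst : -1 ≤ s + t ∧ s + t ≤ 1 := by omega
    nlinarith
  by_cases hneg : ∃ κ ∈ G, ActsBy e κ (-1) 0 0 (-1)
  · obtain ⟨κ, hκG, hκ⟩ := hneg
    obtain ⟨F, hF⟩ := he.exists_fixed_six hω (ρ := ψ) (κ := κ) (by simp [hψ.2]) (by simp [hψ.2])
      (fun ⟨i, j⟩ => by simp [hκ.2])
    refine ⟨F, fun r => (hF r).trans ⟨fun hr => main r hr.1 fun χ _ hχ => ?_,
      fun hr => ⟨hr ψ hψG, hr κ hκG⟩⟩⟩
    rw [hχ.apply_eq he hκ]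
    exact hr.2
  · push Not at hneg
    obtain ⟨F, hF, -⟩ := he.exists_fixed_three hω (ρ := ψ) (by simp [hψ.2]) (by simp [hψ.2])
    exact ⟨F, fun r => (hF r).trans ⟨fun hr => main r hr fun χ hχG hχ => absurd hχ (hneg χ hχG),
      fun hr => hr ψ hψG⟩⟩

theorem exists_fixed_of_neg_one (he : IsFrame h e)
    (hG : ∀ ψ ∈ G, ActsBy e ψ 1 0 0 1 ∨ ActsBy e ψ (-1) 0 0 (-1)) :
    ∃ F : D →ₐ[k] D, ∀ r, r ∈ F.range ↔ ∀ φ ∈ G, φ r = r := by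
  by_cases hneg : ∃ κ ∈ G, ActsBy e κ (-1) 0 0 (-1)
  · obtain ⟨κ, hκG, hκ⟩ := hneg
    obtain ⟨F, -, -, hF⟩ := he.exists_fixed_two (τ := κ) (by simp [hκ.2, he.inv])
      (by simp [hκ.2, he.inv])
    refine ⟨F, fun r => (hF r).trans ⟨fun hr φ hφ => ?_, fun hr => hr κ hκG⟩⟩
    rcases hG φ hφ with h1 | h1
    · exact h1.apply_of_one he r
    · exact (h1.apply_eq he hκ r).trans hr
  · push Not at hneg
    refine ⟨AlgHom.id k D, fun r => ⟨fun _ φ hφ => ?_, fun _ => ⟨r, rfl⟩⟩⟩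
    exact ((hG φ hφ).resolve_right (hneg φ hφ)).apply_of_one he r

theorem IsFrame.exists_fixed (he : IsFrame h e) (hω : ω ^ 2 + ω + 1 = 0)
    (hfin : ∀ ψ ∈ G, IsOfFinOrder ψ) (hG : ∀ ψ ∈ G, ∃ a b c d, ActsBy e ψ a b c d) :
    ∃ F : D →ₐ[k] D, ∀ r, r ∈ F.range ↔ ∀ φ ∈ G, φ r = r := by
  by_cases h0 : ∃ ψ ∈ G, ∃ a b c d, ActsBy e ψ a b c d ∧ a + d = 0
  · obtain ⟨ψ, hψG, a, b, c, d, hψ, ht⟩ := h0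
    obtain ⟨e', he', hG', ψ', hψG', hψ'⟩ := hψ.exists_companion he hG hψG (.inl ht)
    rw [ht] at hψ'
    exact exists_fixed_of_trace_zero he' hfin hG' hψG' hψ'
  by_cases h1 : ∃ ψ ∈ G, ∃ a b c d, ActsBy e ψ a b c d ∧ a + d = -1
  · obtain ⟨ψ, hψG, a, b, c, d, hψ, ht⟩ := h1
    obtain ⟨e', he', hG', ψ', hψG', hψ'⟩ := hψ.exists_companion he hG hψG (.inr ht)
    rw [ht] at hψ'
    exact exists_fixed_of_trace_neg_one he' hω hfin hG' hψG' hψ'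
  push Not at h0 h1
  refine exists_fixed_of_neg_one he fun ψ hψG => ?_
  obtain ⟨a, b, c, d, hψ⟩ := hG ψ hψG
  rcases hψ.eq_one_or_neg_one_or_abs_trace_le he.toIsTorus (hfin ψ hψG) with
    ⟨rfl, rfl, rfl, rfl⟩ | ⟨rfl, rfl, rfl, rfl⟩ | ht
  · exact .inl hψ
  · exact .inr hψ
  have h2 := h0 ψ hψG a b c d hψ
  have h3 := h1 ψ hψG a b c d hψ
  rw [abs_le] at ht
  have ht1 : a + d = 1 := by omega
  refine absurd ?_ (h1 (ψ * ψ) (mul_mem hψG hψG) _ _ _ _ (hψ.mul hψ))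
  linear_combination (a + d + 1) * ht1 - 2 * hψ.1

end Group

theorem actsBy_of_isMonomialAut {h : k} {x y : D} (he : IsFrame h (monomial h y x))
    {ψ : D ≃ₐ[k] D} {a b c d : ℤ} (hdet : a * d - b * c = 1)
    (hy : ψ y = algebraMap k D (h ^ (a * c)) * (y ^ a * x ^ c))
    (hx : ψ x = algebraMap k D (h ^ (b * d)) * (y ^ b * x ^ d)) :
    ActsBy (monomial h y x) ψ a b c d := by
  refine ⟨hdet, fun i j => ?_⟩
  rw [← Algebra.smul_def] at hx hy
  have he' := he.comp (u := (a, c)) (w := (b, d)) (by simpa [mul_comm] using hdet)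
  have h1 := congrFun he'.toIsTorus.eq_monomial (i, j)
  have h2 := map_monomial (h := h) (ψ : D →ₐ[k] D) y x (i, j)
  rw [AlgEquiv.coe_toAlgHom, hx, hy] at h2
  simp only [Prod.smul_mk, Prod.mk_add_mk, smul_eq_mul, one_mul, zero_mul, add_zero, zero_add] at h1
  rw [h2, mul_comm a i, mul_comm b j, mul_comm c i, mul_comm d j, h1]
  rfl

end QuantumTorus

/-- If `G` is any finite group of monomial automorphisms of `D`, then the fixed ring
`D^G = {r ∈ D : g(r) = r for all g ∈ G}` is isomorphic to `D = k_q(x,y)` as a `k`-algebra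
(for the same `q`): there is an injective `k`-algebra endomorphism of `D` whose range is
exactly `D^G`. -/
theorem stmt13 (k : Type*) [Field k] [CharZero k] (q : k) (hq : q ≠ 0)
    (ω : k) (hω : IsPrimitiveRoot ω 3) (qh : k) (hqh : qh ^ 2 = q)
    (p : k) (hp : p ^ 3 = q)
    (D : Type*) [DivisionRing D] [Algebra k D] (x y : D)
    (hD : IsQDivisionRing k D q x y)
    (G : Subgroup (D ≃ₐ[k] D)) (hGfin : (G : Set (D ≃ₐ[k] D)).Finite)
    (hGmono : ∀ ψ ∈ G, IsMonomialAut k qh x y ψ) :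
    ∃ F : D →ₐ[k] D, Function.Injective F ∧
      Set.range F = {r : D | ∀ ψ ∈ G, ψ r = r} := by
  subst hqh
  have hqh0 : qh ≠ 0 := fun h => hq (by simp [h])
  have he := QuantumTorus.isFrame_monomial hqh0 hD
  have hω' : ω ^ 2 + ω + 1 = 0 := by
    refine (mul_eq_zero.1 ?_).resolve_left (sub_ne_zero.2 (hω.ne_one (by norm_num)))
    linear_combination hω.pow_eq_one
  have : Finite G := hGfin.to_subtype
  obtain ⟨F, hF⟩ := he.exists_fixed hω' (G := G)
    (fun ψ hψ => G.subtype.isOfFinOrder (isOfFinOrder_of_finite (⟨ψ, hψ⟩ : G)))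
    fun ψ hψ => by
      obtain ⟨a, b, c, d, hdet, hy, hx⟩ := hGmono ψ hψ
      exact ⟨a, b, c, d, QuantumTorus.actsBy_of_isMonomialAut he hdet hy hx⟩
  exact ⟨F, F.toRingHom.injective, Set.ext hF⟩
end

section
/- Let E = D^φ be the fixed ring of φ and let b = y + y⁻¹ ∈ D. Then b ∉ E while b² ∈ E, the conjugation map γ : r ↦ brb⁻¹ restricts to a k-algebra automorphism of E, and γ is not an inner automorphism of E: there is no nonzero u ∈ E with γ(r) = uru⁻¹ for all r ∈ E. -/
/-- Simultaneous eigenvectors of two endomorphisms with pairwise distinct pairs of eigenvalues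
are independent. -/
theorem eq_zero_of_sum_joint_eigenvectors_eq_zero {k V ι : Type*} [Field k] [AddCommGroup V]
    [Module k V] (f g : V →ₗ[k] V) (a b : ι → k)
    (hab : ∀ i j, a i = a j → b i = b j → i = j) (S : Finset ι) :
    ∀ v : ι → V, (∀ i ∈ S, f (v i) = a i • v i) → (∀ i ∈ S, g (v i) = b i • v i) →
      ∑ i ∈ S, v i = 0 → ∀ i ∈ S, v i = 0 := by
  classical
  induction S using Finset.induction_on with
  | empty => simp
  | insert j S hj ih =>
    intro v hf hg hsum
    have hfS : ∀ i ∈ S, f (v i) = a i • v i := fun i hi => hf i (Finset.mem_insert_of_mem hi)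
    have hgS : ∀ i ∈ S, g (v i) = b i • v i := fun i hi => hg i (Finset.mem_insert_of_mem hi)
    rw [Finset.sum_insert hj] at hsum
    have hjS : v j = -∑ i ∈ S, v i := eq_neg_of_add_eq_zero_left hsum
    have hfz : ∀ i ∈ S, (a i - a j) • v i = 0 := by
      refine ih _ ?_ ?_ ?_
      · intro i hi
        rw [map_smul, hfS i hi, smul_comm]
      · intro i hi
        rw [map_smul, hgS i hi, smul_comm]
      · have h := hf j (Finset.mem_insert_self _ _)
        rw [hjS, map_neg, map_sum, Finset.sum_congr rfl hfS, smul_neg, neg_inj,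
          Finset.smul_sum] at h
        simp only [sub_smul, Finset.sum_sub_distrib, h, sub_self]
    have hgz : ∀ i ∈ S, (b i - b j) • v i = 0 := by
      refine ih _ ?_ ?_ ?_
      · intro i hi
        rw [map_smul, hfS i hi, smul_comm]
      · intro i hi
        rw [map_smul, hgS i hi, smul_comm]
      · have h := hg j (Finset.mem_insert_self _ _)
        rw [hjS, map_neg, map_sum, Finset.sum_congr rfl hgS, smul_neg, neg_inj,
          Finset.smul_sum] at h
        simp only [sub_smul, Finset.sum_sub_distrib, h, sub_self]
    have hS : ∀ i ∈ S, v i = 0 := by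
      intro i hi
      by_contra hv
      have h1 := (smul_eq_zero.1 (hfz i hi)).resolve_right hv
      have h2 := (smul_eq_zero.1 (hgz i hi)).resolve_right hv
      exact hj (hab i j (sub_eq_zero.1 h1) (sub_eq_zero.1 h2) ▸ hi)
    intro i hi
    rcases Finset.mem_insert.1 hi with rfl | hi
    · rw [hjS, Finset.sum_eq_zero hS, neg_zero]
    · exact hS i hi

theorem pow_injective_of_not_root_of_unity {k : Type*} [Field k] {q : k} (hq : q ≠ 0)
    (hq' : ∀ n : ℕ, 0 < n → q ^ n ≠ 1) : Function.Injective fun n : ℕ => q ^ n := by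
  have key : ∀ m n : ℕ, m < n → q ^ m ≠ q ^ n := by
    intro m n hmn h
    refine hq' (n - m) (by omega) (mul_left_cancel₀ (pow_ne_zero m hq) ?_)
    rw [← pow_add, Nat.add_sub_cancel' hmn.le, mul_one, h]
  intro m n h
  rcases lt_trichotomy m n with hlt | heq | hgt
  · exact absurd h (key m n hlt)
  · exact heq
  · exact absurd h.symm (key n m hgt)

namespace IsQDivisionRing

variable {k D : Type*} [Field k] [DivisionRing D] [Algebra k D] {q : k} {x y : D}

theorem rel_smul (hD : IsQDivisionRing k D q x y) : x * y = q • (y * x) := by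
  rw [hD.rel, Algebra.smul_def]

theorem mul_pow_y (hD : IsQDivisionRing k D q x y) (i : ℕ) :
    x * y ^ i = q ^ i • (y ^ i * x) := by
  induction i with
  | zero => simp
  | succ i ih =>
    rw [pow_succ, ← mul_assoc, ih, smul_mul_assoc, mul_assoc, hD.rel_smul, mul_smul_comm,
      smul_smul, pow_succ, mul_assoc (y ^ i)]

theorem pow_x_mul (hD : IsQDivisionRing k D q x y) (j : ℕ) :
    x ^ j * y = q ^ j • (y * x ^ j) := by
  induction j with
  | zero => simp
  | succ j ih =>
    rw [pow_succ', mul_assoc, ih, mul_smul_comm, ← mul_assoc, hD.rel_smul, smul_mul_assoc,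
      smul_smul, pow_succ, mul_assoc y]

theorem x_mul_monomial (hD : IsQDivisionRing k D q x y) (i j : ℕ) :
    x * (y ^ i * x ^ j) = q ^ i • (y ^ i * x ^ (j + 1)) := by
  rw [← mul_assoc, hD.mul_pow_y, smul_mul_assoc, mul_assoc, ← pow_succ']

theorem x_mul_monomial_mul_inv (hD : IsQDivisionRing k D q x y) (i j : ℕ) :
    x * (y ^ i * x ^ j) * x⁻¹ = q ^ i • (y ^ i * x ^ j) := by
  rw [hD.x_mul_monomial, pow_succ, ← mul_assoc, smul_mul_assoc,
    mul_inv_cancel_right₀ hD.x_ne_zero]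

theorem inv_y_mul_monomial_mul (hD : IsQDivisionRing k D q x y) (i j : ℕ) :
    y⁻¹ * (y ^ i * x ^ j) * y = q ^ j • (y ^ i * x ^ j) := by
  rw [mul_assoc, mul_assoc, hD.pow_x_mul, mul_smul_comm, mul_smul_comm, ← mul_assoc (y ^ i),
    ← pow_succ, pow_succ', mul_assoc y, inv_mul_cancel_left₀ hD.y_ne_zero]

theorem adjoin_le_span (hD : IsQDivisionRing k D q x y) :
    Subalgebra.toSubmodule (Algebra.adjoin k ({x, y} : Set D)) ≤
      Submodule.span k (Set.range fun p : ℕ × ℕ => y ^ p.1 * x ^ p.2) := by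
  rw [Algebra.adjoin_eq_span, Submodule.span_le]
  intro m hm
  suffices h : ∃ (c : k) (i j : ℕ), m = c • (y ^ i * x ^ j) by
    obtain ⟨c, i, j, rfl⟩ := h
    exact Submodule.smul_mem _ _ (Submodule.subset_span ⟨(i, j), rfl⟩)
  induction hm using Submonoid.closure_induction_left with
  | one => exact ⟨1, 0, 0, by simp⟩
  | mul_left a ha m _ ih =>
    obtain ⟨c, i, j, rfl⟩ := ih
    rcases ha with rfl | rfl
    · exact ⟨c * q ^ i, i, j + 1, by rw [mul_smul_comm, hD.x_mul_monomial, smul_smul]⟩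
    · exact ⟨c, i + 1, j, by rw [mul_smul_comm, ← mul_assoc, ← pow_succ']⟩

/-- If `q` is not a root of unity, then the centre of the `q`-division ring is `k`. -/
theorem exists_eq_algebraMap_of_commute (hD : IsQDivisionRing k D q x y) (hq : q ≠ 0)
    (hq' : ∀ n : ℕ, 0 < n → q ^ n ≠ 1) {w : D} (hx : Commute w x) (hy : Commute w y) :
    ∃ c : k, w = algebraMap k D c := by
  classical
  have hinj := pow_injective_of_not_root_of_unity hq hq'
  obtain ⟨s, t, hs, ht, ht0, hw⟩ := hD.exists_frac w
  obtain ⟨cs, rfl⟩ := Finsupp.mem_span_range_iff_exists_finsupp.1 (hD.adjoin_le_span hs)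
  obtain ⟨ct, rfl⟩ := Finsupp.mem_span_range_iff_exists_finsupp.1 (hD.adjoin_le_span ht)
  set m : ℕ × ℕ → D := fun p => y ^ p.1 * x ^ p.2
  set S := cs.support ∪ ct.support
  have hs_sum : (cs.sum fun p c => c • m p) = ∑ p ∈ S, cs p • m p :=
    Finsupp.sum_of_support_subset _ Finset.subset_union_left _ (by simp)
  have ht_sum : (ct.sum fun p c => c • m p) = ∑ p ∈ S, ct p • m p :=
    Finsupp.sum_of_support_subset _ Finset.subset_union_right _ (by simp)
  have htw : (∑ p ∈ S, ct p • m p) * w = ∑ p ∈ S, cs p • m p := by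
    rw [← hs_sum, ← ht_sum, hw, mul_inv_cancel_left₀ ht0]
  have hvanish : ∀ p ∈ S, cs p • m p - ct p • (m p * w) = 0 := by
    refine eq_zero_of_sum_joint_eigenvectors_eq_zero
      (LinearMap.mulRight k x⁻¹ ∘ₗ LinearMap.mulLeft k x)
      (LinearMap.mulRight k y ∘ₗ LinearMap.mulLeft k y⁻¹)
      (fun p => q ^ p.1) (fun p => q ^ p.2) (fun p p' h1 h2 => Prod.ext (hinj h1) (hinj h2))
      S _ ?_ ?_ ?_
    · intro p _
      have h1 : x * m p * x⁻¹ = q ^ p.1 • m p := hD.x_mul_monomial_mul_inv p.1 p.2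
      have h2 : x * (m p * w) * x⁻¹ = q ^ p.1 • (m p * w) := by
        rw [← smul_mul_assoc, ← h1, mul_assoc (x * m p), ← hx.inv_right₀.eq]
        simp only [mul_assoc]
      simp only [LinearMap.comp_apply, LinearMap.mulLeft_apply, LinearMap.mulRight_apply,
        mul_sub, sub_mul, mul_smul_comm, smul_mul_assoc, h1, h2, smul_sub]
      rw [smul_comm (cs p), smul_comm (ct p)]
    · intro p _
      have h1 : y⁻¹ * m p * y = q ^ p.2 • m p := hD.inv_y_mul_monomial_mul p.1 p.2
      have h2 : y⁻¹ * (m p * w) * y = q ^ p.2 • (m p * w) := by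
        rw [← smul_mul_assoc, ← h1, mul_assoc (y⁻¹ * m p), ← hy.eq]
        simp only [mul_assoc]
      simp only [LinearMap.comp_apply, LinearMap.mulLeft_apply, LinearMap.mulRight_apply,
        mul_sub, sub_mul, mul_smul_comm, smul_mul_assoc, h1, h2, smul_sub]
      rw [smul_comm (cs p), smul_comm (ct p)]
    · simp only [← smul_mul_assoc]
      rw [Finset.sum_sub_distrib, ← Finset.sum_mul, htw, sub_self]
  obtain ⟨p, hpS, hp⟩ : ∃ p ∈ S, ct p ≠ 0 := by
    by_contra! hcon
    exact ht0 (ht_sum.trans (Finset.sum_eq_zero fun p hp => by rw [hcon p hp, zero_smul]))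
  have hmp : m p ≠ 0 :=
    mul_ne_zero (pow_ne_zero _ hD.y_ne_zero) (pow_ne_zero _ hD.x_ne_zero)
  refine ⟨(ct p)⁻¹ * cs p, mul_left_cancel₀ hmp ?_⟩
  rw [← Algebra.commutes, ← Algebra.smul_def, mul_smul, sub_eq_zero.1 (hvanish p hpS),
    inv_smul_smul₀ hp]

theorem y_add_inv_ne_zero (hD : IsQDivisionRing k D q x y) : y + y⁻¹ ≠ 0 := by
  intro h
  have h2 : y ^ 2 + 1 = 0 := by
    rw [pow_two, ← mul_inv_cancel₀ hD.y_ne_zero, ← mul_add, h, mul_zero]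
  have hli := (linearIndependent_iff'.1 hD.monomials_linearIndependent) {(2, 0), (0, 0)}
    (fun _ => 1) (by simpa using h2) (0, 0) (by simp)
  exact one_ne_zero hli

/-- The automorphism `φ` squares to the identity on `x`. -/
theorem map_map_x (hD : IsQDivisionRing k D q x y) (hq : q ≠ 0) (φ : D ≃ₐ[k] D)
    (hφx : φ x = (y⁻¹ - (algebraMap k D q)⁻¹ * y) * x⁻¹) (hφy : φ y = -y⁻¹) :
    φ (φ x) = x := by
  have hne : y⁻¹ - (algebraMap k D q)⁻¹ * y ≠ 0 := by
    intro h
    rw [h, zero_mul] at hφx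
    exact hD.x_ne_zero (φ.injective (hφx.trans (map_zero φ).symm))
  have hxy' : x * y⁻¹ = q⁻¹ • (y⁻¹ * x) := by
    rw [eq_inv_smul_iff₀ hq]
    apply mul_left_cancel₀ hD.y_ne_zero
    apply mul_right_cancel₀ hD.y_ne_zero
    rw [mul_inv_cancel_left₀ hD.y_ne_zero, hD.rel_smul, mul_smul_comm, smul_mul_assoc,
      mul_assoc, mul_assoc, inv_mul_cancel₀ hD.y_ne_zero, mul_one]
  simp only [← map_inv₀, ← Algebra.smul_def] at hφx hne
  have hswap : (-y + q⁻¹ • y⁻¹) * x = x * (y⁻¹ - q⁻¹ • y) := by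
    rw [mul_sub, mul_smul_comm, hxy', hD.rel_smul, inv_smul_smul₀ hq, add_mul, neg_mul,
      smul_mul_assoc]
    abel
  have hz : φ (y⁻¹ - q⁻¹ • y) = -y + q⁻¹ • y⁻¹ := by
    simp [hφy, inv_neg]
  rw [hφx, map_mul, map_inv₀, hz, hφx, mul_inv_rev, inv_inv, ← mul_assoc, hswap,
    mul_inv_cancel_right₀ hne]

end IsQDivisionRing

/-- Suppose `q` is not a root of unity.  Let `E = D^φ` be the fixed ring of `φ` and
`b = y + y⁻¹ ∈ D`.  Then `b ∉ E` while `b² ∈ E`; the conjugation map `γ : r ↦ brb⁻¹`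
restricts to a (`k`-algebra) automorphism of `E` (it maps `E` into `E`, bijectively); and
`γ` is not an inner automorphism of `E`: there is no nonzero `u ∈ E` with `γ(r) = uru⁻¹`
for all `r ∈ E`. -/
theorem stmt15 (k : Type*) [Field k] [CharZero k] (q : k) (hq : q ≠ 0)
    (hq' : ∀ n : ℕ, 0 < n → q ^ n ≠ 1)
    (D : Type*) [DivisionRing D] [Algebra k D] (x y : D)
    (hD : IsQDivisionRing k D q x y)
    (φ : D ≃ₐ[k] D)
    (hφx : φ x = (y⁻¹ - (algebraMap k D q)⁻¹ * y) * x⁻¹)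
    (hφy : φ y = -y⁻¹) :
    let b : D := y + y⁻¹
    let E : Set D := {r : D | φ r = r}
    b ∉ E ∧ b ^ 2 ∈ E ∧
    (∀ r ∈ E, b * r * b⁻¹ ∈ E) ∧
    (∀ r ∈ E, ∃ s ∈ E, b * s * b⁻¹ = r) ∧
    ¬ ∃ u ∈ E, u ≠ 0 ∧ ∀ r ∈ E, b * r * b⁻¹ = u * r * u⁻¹ := by
  intro b E
  have hmem : ∀ {r : D}, r ∈ E ↔ φ r = r := Iff.rfl
  have hb0 : b ≠ 0 := hD.y_add_inv_ne_zero
  have hφb : φ b = -b := by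
    simp only [b, map_add, map_inv₀, hφy, inv_neg, inv_inv]
    abel
  have h2 : (2 : D) ≠ 0 := by
    rw [← map_ofNat (algebraMap k D) 2]
    exact (map_ne_zero _).2 two_ne_zero
  have eq_zero_of_neg : ∀ {d : D}, d = -d → d = 0 := by
    intro d hd
    have h : 2 * d = 0 := by rw [two_mul]; nth_rewrite 1 [hd]; exact neg_add_cancel d
    exact (mul_eq_zero.1 h).resolve_left h2
  have hb2 : b ^ 2 ∈ E := by rw [hmem, map_pow, hφb, neg_sq]
  refine ⟨fun hb => hb0 (eq_zero_of_neg ((hmem.1 hb).symm.trans hφb)), hb2, ?_, ?_, ?_⟩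
  · intro r hr
    rw [hmem, map_mul, map_mul, map_inv₀, hφb, hmem.1 hr, inv_neg, neg_mul, neg_mul_neg]
  · intro r hr
    refine ⟨b⁻¹ * r * b, ?_, ?_⟩
    · rw [hmem, map_mul, map_mul, map_inv₀, hφb, hmem.1 hr, inv_neg, neg_mul, neg_mul_neg]
    · rw [← mul_assoc, ← mul_assoc, mul_inv_cancel₀ hb0, one_mul, mul_inv_cancel_right₀ hb0]
  · rintro ⟨u, huE, hu0, hu⟩
    have hwE : ∀ r ∈ E, Commute (u⁻¹ * b) r := by
      intro r hr
      have h := congrArg (fun d => u⁻¹ * d * b) (hu r hr)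
      simp only [mul_assoc, inv_mul_cancel₀ hb0, mul_one, inv_mul_cancel_left₀ hu0] at h
      rw [commute_iff_eq, mul_assoc, h]
    have hbu : Commute b u := by
      have h := hu u huE
      rw [mul_inv_cancel_right₀ hu0] at h
      exact (mul_inv_eq_iff_eq_mul₀ hb0).1 h
    have hwb : Commute (u⁻¹ * b) b := (hbu.symm.inv_left₀).mul_left (Commute.refl b)
    have hwD : ∀ d, φ (φ d) = d → Commute (u⁻¹ * b) d := by
      intro d hd
      have hplus : Commute (u⁻¹ * b) (d + φ d) :=
        hwE _ (by rw [hmem, map_add, hd, add_comm])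
      have hminus : Commute (u⁻¹ * b) (d - φ d) := by
        rw [← mul_inv_cancel_left₀ hb0 (d - φ d)]
        refine hwb.mul_right (hwE _ ?_)
        rw [hmem, map_mul, map_inv₀, hφb, map_sub, hd, inv_neg, neg_mul, ← mul_neg, neg_sub]
      have hsum : 2 * d = (d + φ d) + (d - φ d) := by rw [two_mul]; abel
      have h2d : Commute (u⁻¹ * b) (2⁻¹ * (2 * d)) :=
        ((Commute.ofNat_right _ 2).inv_right₀).mul_right (hsum ▸ hplus.add_right hminus)
      rwa [inv_mul_cancel_left₀ h2] at h2d
    have hwx := hwD x (hD.map_map_x hq φ hφx hφy)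
    have hwy := hwD y (by rw [hφy, map_neg, map_inv₀, hφy, inv_neg, inv_inv, neg_neg])
    obtain ⟨c, hc⟩ := hD.exists_eq_algebraMap_of_commute hq hq' hwx hwy
    have hfix : φ (u⁻¹ * b) = u⁻¹ * b := by rw [hc, AlgEquiv.commutes]
    have hneg : φ (u⁻¹ * b) = -(u⁻¹ * b) := by
      rw [map_mul, map_inv₀, hmem.1 huE, hφb, mul_neg]
    exact mul_ne_zero (inv_ne_zero hu0) hb0 (eq_zero_of_neg (hfix.symm.trans hneg))
end

section
/- D admits a k-algebra endomorphism that is injective but not surjective; indeed, there is an injective k-algebra homomorphism θ : D → D whose image is the fixed ring D^φ, which is a proper subring of D. -/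
open OreLocalization in
/-- A pair of embeddings of a ring `P` into division rings, the first of which exhibits its target
as the division ring of left fractions of `P`, extends to a homomorphism of division rings. -/
theorem exists_algHom_of_fractions {k P D E : Type*} [Field k] [Ring P] [Algebra k P]
    [DivisionRing D] [Algebra k D] [DivisionRing E] [Algebra k E]
    (f : P →ₐ[k] D) (g : P →ₐ[k] E) (hf : Function.Injective f) (hg : Function.Injective g)
    (hfrac : ∀ d : D, ∃ s t : P, t ≠ 0 ∧ d = (f t)⁻¹ * f s) :
    ∃ h : D →ₐ[k] E, ∀ p, h (f p) = g p := by
  have : IsDomain P := hf.isDomain f.toRingHom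
  have hf0 (t : nonZeroDivisors P) : f t ≠ 0 := by
    rw [map_ne_zero_iff f hf]; exact nonZeroDivisors.ne_zero t.2
  have hg0 (t : nonZeroDivisors P) : g t ≠ 0 := by
    rw [map_ne_zero_iff g hg]; exact nonZeroDivisors.ne_zero t.2
  have ore (r : P) (s : nonZeroDivisors P) :
      ∃ (r' : P) (s' : nonZeroDivisors P), s' * r = r' * s := by
    obtain ⟨a, t, ht, h⟩ := hfrac (f r * (f s)⁻¹)
    refine ⟨a, ⟨t, mem_nonZeroDivisors_of_ne_zero ht⟩, hf ?_⟩
    have ht' : f t ≠ 0 := by rwa [map_ne_zero_iff f hf]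
    simp only [map_mul]
    rw [eq_inv_mul_iff_mul_eq₀ ht'] at h
    rw [← h, mul_assoc, mul_assoc, inv_mul_cancel₀ (hf0 s), mul_one]
  choose num den hore using ore
  let _ : OreSet (nonZeroDivisors P) := oreSetOfNoZeroDivisors num den hore
  obtain ⟨fS, hfS⟩ : ∃ fS : nonZeroDivisors P →* Dˣ,
      ∀ t : nonZeroDivisors P, f.toRingHom t = fS t :=
    ⟨IsUnit.liftRight ((f : P →* D).comp (nonZeroDivisors P).subtype) fun t => (hf0 t).isUnit,
      fun _ => rfl⟩
  obtain ⟨gS, hgS⟩ : ∃ gS : nonZeroDivisors P →* Eˣ,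
      ∀ t : nonZeroDivisors P, g.toRingHom t = gS t :=
    ⟨IsUnit.liftRight ((g : P →* E).comp (nonZeroDivisors P).subtype) fun t => (hg0 t).isUnit,
      fun _ => rfl⟩
  let F : P[(nonZeroDivisors P)⁻¹] →+* D := universalHom f.toRingHom fS hfS
  let G : P[(nonZeroDivisors P)⁻¹] →+* E := universalHom g.toRingHom gS hgS
  have hF : Function.Bijective F := by
    constructor
    · exact F.injective
    · intro d
      obtain ⟨s, t, ht, rfl⟩ := hfrac d
      refine ⟨s /ₒ ⟨t, mem_nonZeroDivisors_of_ne_zero ht⟩, ?_⟩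
      simp only [F, universalHom_apply]
      rw [Units.val_inv_eq_inv_val, ← hfS]
      rfl
  let e := RingEquiv.ofBijective F hF
  have key (p : P) : G (e.symm (f p)) = g p := by
    have : f p = e (numeratorHom p) := by
      simp only [e, RingEquiv.ofBijective_apply, F]
      rw [universalHom_commutes]; rfl
    rw [this, RingEquiv.symm_apply_apply]
    simp only [G]
    rw [universalHom_commutes]; rfl
  refine ⟨{ G.comp e.symm.toRingHom with commutes' := fun c => ?_ }, key⟩
  have := key (algebraMap k P c)
  rw [f.commutes, g.commutes] at this
  exact this

/-- Ordered monomials in two nonzero `q`-commuting elements are linearly independent: they are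
simultaneous eigenvectors, with distinct eigenvalues, for conjugation by the two elements. -/
theorem linearIndependent_monomials {k D : Type*} [Field k] [DivisionRing D] [Algebra k D]
    {q : k} (hq : q ≠ 0) (hq' : ∀ n : ℕ, 0 < n → q ^ n ≠ 1) {a b : D} (ha : a ≠ 0) (hb : b ≠ 0)
    (hab : a * b = q • (b * a)) :
    LinearIndependent k fun p : ℕ × ℕ => b ^ p.1 * a ^ p.2 := by
  have qinj : Function.Injective fun n : ℕ => q ^ n := by
    intro m n h
    by_contra hne
    wlog hlt : m < n generalizing m n
    · exact this h.symm (Ne.symm hne) (by omega)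
    refine hq' (n - m) (by omega) ?_
    rw [pow_sub₀ q hq hlt.le, ← show q ^ m = q ^ n from h, mul_inv_cancel₀ (pow_ne_zero _ hq)]
  let conj (c : D) : Module.End k D := LinearMap.mulLeft k c * LinearMap.mulRight k c⁻¹
  have conj_apply (c d : D) : conj c d = c * d * c⁻¹ := by simp [conj, mul_assoc]
  have hab' : a * b * a⁻¹ = q • b := by
    rw [hab, smul_mul_assoc, mul_assoc, mul_inv_cancel₀ ha, mul_one]
  have hba' : b * a * b⁻¹ = q⁻¹ • a := by
    rw [← inv_smul_smul₀ hq (b * a), ← hab, smul_mul_assoc, mul_assoc, mul_inv_cancel₀ hb, mul_one]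
  have conj_pow (c d : D) (n : ℕ) (hc : c ≠ 0) : (c * d * c⁻¹) ^ n = c * d ^ n * c⁻¹ := by
    induction n with
    | zero => simp [hc]
    | succ n ih => rw [pow_succ, ih, pow_succ]; simp [mul_assoc, hc]
  have conj_mul (c d d' : D) (hc : c ≠ 0) :
      c * (d * d') * c⁻¹ = (c * d * c⁻¹) * (c * d' * c⁻¹) := by simp [mul_assoc, hc]
  have comm : Commute (conj a) (conj b) := by
    ext d
    simp only [Module.End.mul_apply, conj_apply]
    have h1 : a * (b * d * b⁻¹) * a⁻¹ = (a * b) * d * (a * b)⁻¹ := by simp [mul_assoc]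
    have h2 : b * (a * d * a⁻¹) * b⁻¹ = (b * a) * d * (b * a)⁻¹ := by simp [mul_assoc]
    rw [h1, h2, hab, smul_inv₀, smul_mul_assoc, smul_mul_assoc, mul_smul_comm, smul_smul,
      mul_inv_cancel₀ hq, one_smul]
  let f : Bool → Module.End k D := fun i => if i then conj a else conj b
  have hcomm : ∀ i j, Commute (f i) (f j) := by
    rintro (_ | _) (_ | _)
    · exact Commute.refl _
    · exact comm.symm
    · exact comm
    · exact Commute.refl _
  have hind := Module.End.independent_iInf_maxGenEigenspace_of_forall_mapsTo f
    fun i j μ => Module.End.mapsTo_maxGenEigenspace_of_comm (hcomm j i) μ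
  let χ : ℕ × ℕ → Bool → k := fun p i => if i then q ^ p.1 else (q ^ p.2)⁻¹
  have hχ : Function.Injective χ := by
    intro p p' h
    have h1 := congrFun h true
    have h2 := congrFun h false
    simp only [χ, if_true, Bool.false_eq_true, if_false, inv_inj] at h1 h2
    exact Prod.ext (qinj h1) (qinj h2)
  refine (hind.comp hχ).linearIndependent _ (fun p => ?_)
    fun p => mul_ne_zero (pow_ne_zero _ hb) (pow_ne_zero _ ha)
  simp only [Function.comp, Submodule.mem_iInf]
  have hle (i) : (f i).eigenspace (χ p i) ≤ (f i).maxGenEigenspace (χ p i) :=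
    (f i).eigenspace_le_maxGenEigenspace
  rintro (_ | _) <;> apply hle <;> rw [Module.End.mem_eigenspace_iff]
  · simp only [f, χ, Bool.false_eq_true, if_false, conj_apply]
    rw [conj_mul _ _ _ hb, ← conj_pow _ a _ hb, hba', smul_pow, ← conj_pow _ b _ hb]
    simp [hb, inv_pow]
  · simp only [f, χ, if_true, conj_apply]
    rw [conj_mul _ _ _ ha, ← conj_pow _ b _ ha, hab', smul_pow, ← conj_pow _ a _ ha]
    simp [ha]

/-- The subalgebra generated by two `q`-commuting elements is spanned by ordered monomials. -/
theorem adjoin_le_span_monomials {k A : Type*} [Field k] [Ring A] [Algebra k A]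
    {q : k} {a b : A} (hab : a * b = q • (b * a)) :
    Subalgebra.toSubmodule (Algebra.adjoin k {a, b}) ≤
      Submodule.span k (Set.range fun p : ℕ × ℕ => b ^ p.1 * a ^ p.2) := by
  set M := Submodule.span k (Set.range fun p : ℕ × ℕ => b ^ p.1 * a ^ p.2)
  have hmem (i j : ℕ) : b ^ i * a ^ j ∈ M := Submodule.subset_span ⟨(i, j), rfl⟩
  have hpow (i : ℕ) : a * b ^ i = q ^ i • (b ^ i * a) := by
    induction i with
    | zero => simp
    | succ i ih =>
      rw [pow_succ, ← mul_assoc, ih, smul_mul_assoc, mul_assoc, hab, mul_smul_comm, smul_smul,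
        ← pow_succ, mul_assoc]
  have hleft : ∀ c ∈ ({a, b} : Set A), ∀ m ∈ M, c * m ∈ M := by
    intro c hc m hm
    induction hm using Submodule.span_induction with
    | mem m hm =>
      obtain ⟨⟨i, j⟩, rfl⟩ := hm
      rcases hc with rfl | rfl
      · dsimp only
        rw [← mul_assoc, hpow, smul_mul_assoc, mul_assoc, ← pow_succ']
        exact M.smul_mem _ (hmem _ _)
      · dsimp only
        rw [← mul_assoc, ← pow_succ']
        exact hmem _ _
    | zero => simp
    | add u v _ _ hu hv => rw [mul_add]; exact M.add_mem hu hv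
    | smul r u _ hu => rw [mul_smul_comm]; exact M.smul_mem _ hu
  have hall : ∀ c ∈ Algebra.adjoin k ({a, b} : Set A), ∀ m ∈ M, c * m ∈ M := by
    intro c hc
    induction hc using Algebra.adjoin_induction with
    | mem c hc => exact hleft c hc
    | algebraMap r => intro m hm; rw [← Algebra.smul_def]; exact M.smul_mem _ hm
    | add u v _ _ hu hv => intro m hm; rw [add_mul]; exact M.add_mem (hu m hm) (hv m hm)
    | mul u v _ _ hu hv => intro m hm; rw [mul_assoc]; exact hu _ (hv _ hm)
  intro c hc
  simpa using hall c hc 1 (by simpa using hmem 0 0)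

/-- An algebra homomorphism that sends `q`-commuting elements to nonzero elements of a division
ring is injective on the subalgebra they generate. -/
theorem injective_comp_adjoin_val_of_qCommute {k A D : Type*} [Field k] [Ring A] [Algebra k A]
    [DivisionRing D] [Algebra k D] {q : k} (hq : q ≠ 0) (hq' : ∀ n : ℕ, 0 < n → q ^ n ≠ 1)
    {a b : A} (hab : a * b = q • (b * a)) (f : A →ₐ[k] D) (ha : f a ≠ 0) (hb : f b ≠ 0) :
    Function.Injective (f.comp (Algebra.adjoin k {a, b}).val) := by
  have hfab : f a * f b = q • (f b * f a) := by rw [← map_mul, hab, map_smul, map_mul]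
  have hli := linearIndependent_monomials hq hq' ha hb hfab
  rw [injective_iff_map_eq_zero]
  rintro ⟨c, hc⟩ h0
  have hc' := adjoin_le_span_monomials hab hc
  rw [Finsupp.mem_span_range_iff_exists_finsupp] at hc'
  obtain ⟨s, hs⟩ := hc'
  have h0' : f c = 0 := h0
  have : s = 0 := by
    refine (linearIndependent_iff.mp hli) s ?_
    rw [Finsupp.linearCombination_apply, ← h0', ← hs, map_finsuppSum]
    simp
  subst this
  ext
  simpa using hs.symm

/-- The universal property of the `q`-division ring: any two nonzero `q`-commuting elements of a
division ring are the images of the generators under an algebra homomorphism. -/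
theorem IsQDivisionRing.exists_algHom {k D E : Type*} [Field k] [DivisionRing D] [Algebra k D]
    [DivisionRing E] [Algebra k E] {q : k} (hq : q ≠ 0) (hq' : ∀ n : ℕ, 0 < n → q ^ n ≠ 1)
    {x y : D} (hD : IsQDivisionRing k D q x y) {a b : E} (ha : a ≠ 0) (hb : b ≠ 0)
    (hab : a * b = q • (b * a)) :
    ∃ θ : D →ₐ[k] E, θ x = a ∧ θ y = b := by
  have hxy : x * y = q • (y * x) := by rw [hD.rel, Algebra.smul_def]
  have hpair : (x, a) * (y, b) = q • ((y, b) * (x, a)) := by ext <;> simp [hxy, hab]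
  let P := Algebra.adjoin k {(x, a), (y, b)}
  have hP : P.map (AlgHom.fst k D E) = Algebra.adjoin k {x, y} := by
    rw [AlgHom.map_adjoin]; simp [Set.image_pair]
  have hf := injective_comp_adjoin_val_of_qCommute hq hq' hpair (AlgHom.fst k D E)
    hD.x_ne_zero hD.y_ne_zero
  have hg := injective_comp_adjoin_val_of_qCommute hq hq' hpair (AlgHom.snd k D E) ha hb
  obtain ⟨θ, hθ⟩ := exists_algHom_of_fractions _ _ hf hg fun d => by
    obtain ⟨s, t, hs, ht, ht0, rfl⟩ := hD.exists_frac d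
    rw [← hP, Subalgebra.mem_map] at hs ht
    obtain ⟨s, hs, rfl⟩ := hs
    obtain ⟨t, ht, rfl⟩ := ht
    refine ⟨⟨s, hs⟩, ⟨t, ht⟩, ?_, rfl⟩
    rintro h
    exact ht0 (by rw [show t = 0 from congrArg Subtype.val h, map_zero])
  exact ⟨θ, hθ ⟨(x, a), Algebra.subset_adjoin (by simp)⟩,
    hθ ⟨(y, b), Algebra.subset_adjoin (by simp)⟩⟩

/-- Eigenvectors for conjugation by `y` with eigenvalues `r`, `1` and `r⁻¹` cannot cancel, when
these are distinct. -/
theorem eq_zero_of_add_add_eq_zero {k D : Type*} [Field k] [DivisionRing D] [Algebra k D]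
    {r : k} (hr : r ≠ 0) (hr₁ : r ≠ 1) (hr₂ : r ^ 2 ≠ 1) {y a b c : D} (hy : y ≠ 0)
    (ha : a * y = r • (y * a)) (hb : b * y = y * b) (hc : c * y = r⁻¹ • (y * c))
    (h : a + b + c = 0) : a = 0 := by
  have step (s t : k) (h : s • a + b + t • c = 0) : (r * s) • a + b + (r⁻¹ * t) • c = 0 := by
    refine (mul_eq_zero.mp ?_).resolve_left hy
    have h' := congrArg (· * y) h
    simp only [add_mul, smul_mul_assoc, ha, hb, hc, zero_mul] at h'
    rw [← h']
    simp only [mul_add, mul_smul_comm]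
    module
  have h0 : (1 : k) • a + b + (1 : k) • c = 0 := by simpa using h
  have h1 := step _ _ h0
  have h2 := step _ _ h1
  have : ((r - r⁻¹) * (r - 1)) • a = 0 := by
    linear_combination (norm := skip) (h2 - h1) - r⁻¹ • (h1 - h0)
    match_scalars <;> field_simp <;> ring
  refine (smul_eq_zero.mp this).resolve_left (mul_ne_zero ?_ (sub_ne_zero.mpr hr₁))
  rw [sub_ne_zero]
  intro h
  apply hr₂
  rw [pow_two]
  nth_rw 2 [h]
  exact mul_inv_cancel₀ hr

section WeylPair

variable {k D : Type*} [Field k] [DivisionRing D] [Algebra k D] {q : k} {x x' y : D}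

/-- If `x` and `x'` respectively `q`- and `q⁻¹`-commute with `y`, and have the prescribed products,
then `u = (y + y⁻¹)⁻¹ (x - x')` and `v = (y + y⁻¹)⁻¹ (y⁻¹ x + y x')` satisfy the relation of a
quantum Weyl algebra, `u v ≠ -1`, and `y - y⁻¹` is a rational expression in `u` and `v`. -/
theorem weylPair_relations (hq : q ≠ 0) (hq₂ : q ^ 2 ≠ 1) (hq₄ : (q ^ 2) ^ 2 ≠ 1)
    (hx : x ≠ 0) (hy : y ≠ 0)
    (hxy : x * y = q • (y * x)) (hxy' : x' * y = q⁻¹ • (y * x'))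
    (hx'x : x' * x = y⁻¹ - q⁻¹ • y) (hxx' : x * x' = q⁻¹ • y⁻¹ - y)
    (hQ : y + y⁻¹ ≠ 0) (hQ₁ : q • y + q⁻¹ • y⁻¹ ≠ 0) (hQ₂ : q⁻¹ • y + q • y⁻¹ ≠ 0)
    {u v : D} (hu : u = (y + y⁻¹)⁻¹ * (x - x')) (hv : v = (y + y⁻¹)⁻¹ * (y⁻¹ * x + y * x')) :
    v * u = q • (u * v) + (q - 1) • 1 ∧
    (y - y⁻¹) * (u * v + 1) = q⁻¹ • (u * u) - v * v ∧
    u * v + 1 ≠ 0 := by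
  have yp : y * y⁻¹ = 1 := mul_inv_cancel₀ hy
  have py : y⁻¹ * y = 1 := inv_mul_cancel₀ hy
  have mul_p {z : D} {c : k} (hc : c ≠ 0) (h : z * y = c • (y * z)) :
      z * y⁻¹ = c⁻¹ • (y⁻¹ * z) := by
    rw [eq_inv_smul_iff₀ hc, ← mul_right_inj' hy, ← mul_left_inj' hy, mul_smul_comm,
      mul_inv_cancel_left₀ hy, smul_mul_assoc, mul_assoc, mul_assoc, py, mul_one, h]
  generalize hp : y⁻¹ = p at *
  have hxp := mul_p hq hxy
  have hxp' := mul_p (inv_ne_zero hq) hxy'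
  rw [inv_inv] at hxp'
  set Q := y + p with hQd
  set Q₁ := q • y + q⁻¹ • p with hQ₁d
  set Q₂ := q⁻¹ • y + q • p with hQ₂d
  have hxQ : x * Q⁻¹ = Q₁⁻¹ * x := by
    rw [eq_inv_mul_iff_mul_eq₀ hQ₁, ← mul_assoc, mul_inv_eq_iff_eq_mul₀ hQ, hQd, hQ₁d]
    simp only [mul_add, add_mul, hxy, hxp, smul_mul_assoc]
  have hxQ' : x' * Q⁻¹ = Q₂⁻¹ * x' := by
    rw [eq_inv_mul_iff_mul_eq₀ hQ₂, ← mul_assoc, mul_inv_eq_iff_eq_mul₀ hQ, hQd, hQ₂d]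
    simp only [mul_add, add_mul, hxy', hxp', smul_mul_assoc]
  have cyp : Commute y p := yp.trans py.symm
  have cy₁ : Commute y Q₁⁻¹ :=
    (((Commute.refl y).smul_right q).add_right (cyp.smul_right q⁻¹)).inv_right₀
  have cp₁ : Commute p Q₁⁻¹ :=
    ((cyp.symm.smul_right q).add_right ((Commute.refl p).smul_right q⁻¹)).inv_right₀
  have cy₂ : Commute y Q₂⁻¹ :=
    (((Commute.refl y).smul_right q⁻¹).add_right (cyp.smul_right q)).inv_right₀
  have cp₂ : Commute p Q₂⁻¹ :=
    ((cyp.symm.smul_right q⁻¹).add_right ((Commute.refl p).smul_right q)).inv_right₀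
  have i₁p : Q₁⁻¹ * p = q • 1 - q ^ 2 • (Q₁⁻¹ * y) := by
    have h : Q₁⁻¹ * Q₁ = 1 := inv_mul_cancel₀ hQ₁
    rw [hQ₁d, mul_add, mul_smul_comm, mul_smul_comm, ← hQ₁d] at h
    rw [← h, smul_add, smul_smul, smul_smul, mul_inv_cancel₀ hq]
    module
  have i₂p : Q₂⁻¹ * p = q⁻¹ • 1 - q⁻¹ ^ 2 • (Q₂⁻¹ * y) := by
    have h : Q₂⁻¹ * Q₂ = 1 := inv_mul_cancel₀ hQ₂
    rw [hQ₂d, mul_add, mul_smul_comm, mul_smul_comm, ← hQ₂d] at h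
    rw [← h, smul_add, smul_smul, smul_smul, inv_mul_cancel₀ hq]
    module
  have i₁yy : Q₁⁻¹ * (y * y) = q⁻¹ • y - q⁻¹ ^ 2 • Q₁⁻¹ := by
    have h := congrArg (· * y) i₁p
    simp only [mul_assoc, py, sub_mul, smul_mul_assoc, mul_one, one_mul] at h
    nth_rw 2 [h]
    match_scalars <;> field_simp; ring
  have i₂yy : Q₂⁻¹ * (y * y) = q • y - q ^ 2 • Q₂⁻¹ := by
    have h := congrArg (· * y) i₂p
    simp only [mul_assoc, py, sub_mul, smul_mul_assoc, mul_one, one_mul] at h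
    nth_rw 2 [h]
    match_scalars <;> field_simp; ring
  have hQu : Q * u = x - x' := by rw [hu, mul_inv_cancel_left₀ hQ]
  have hQv : Q * v = p * x + y * x' := by rw [hv, mul_inv_cancel_left₀ hQ]
  have hxu : x * u = Q₁⁻¹ * (x * (x - x')) := by rw [hu, ← mul_assoc, hxQ, mul_assoc]
  have hxv : x * v = Q₁⁻¹ * (x * (p * x + y * x')) := by rw [hv, ← mul_assoc, hxQ, mul_assoc]
  have hxu' : x' * u = Q₂⁻¹ * (x' * (x - x')) := by rw [hu, ← mul_assoc, hxQ', mul_assoc]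
  have hxv' : x' * v = Q₂⁻¹ * (x' * (p * x + y * x')) := by rw [hv, ← mul_assoc, hxQ', mul_assoc]
  clear_value Q₁ Q₂
  have assoc {a b c : D} (h : a * b = c) (t : D) : a * (b * t) = c * t := by rw [← mul_assoc, h]
  have assoc₂ {a b c d : D} (h : a * (b * c) = d) (t : D) : a * (b * (c * t)) = d * t := by
    rw [← h, mul_assoc, mul_assoc]
  have hu_mul (t : D) : Q * (u * t) = (x - x') * t := by rw [← mul_assoc, hQu]
  have hv_mul (t : D) : Q * (v * t) = (p * x + y * x') * t := by rw [← mul_assoc, hQv]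
  have hQg : Commute Q (y - p) :=
    ((Commute.refl y).sub_right cyp).add_left (cyp.symm.sub_right (Commute.refl p))
  refine ⟨mul_left_cancel₀ hQ ?_, mul_left_cancel₀ hQ ?_, fun h => ?_⟩
  · rw [mul_add, mul_smul_comm, hu_mul, hv_mul, mul_smul_comm, mul_one]
    simp only [hQd, mul_add, add_mul, mul_sub, sub_mul, mul_smul_comm, smul_mul_assoc, mul_assoc,
      hxu, hxv, hxu', hxv', hxx', hx'x, assoc hxy, assoc hxp, assoc hxy', assoc hxp', yp, py,
      assoc cy₂.eq, assoc cp₁.eq, i₁p, i₂p, assoc i₁p, assoc i₂p, i₁yy, i₂yy, one_mul, mul_one]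
    match_scalars <;> field_simp <;> ring
  · rw [← mul_assoc, hQg.eq, mul_assoc, mul_add, mul_sub, mul_smul_comm, hu_mul, hu_mul, hv_mul,
      mul_one]
    simp only [hQd, mul_add, add_mul, mul_sub, sub_mul, mul_smul_comm, smul_mul_assoc, mul_assoc,
      hxu, hxv, hxu', hxv', hxx', hx'x, assoc hxy, assoc hxp, assoc hxy', assoc hxp', yp, py,
      cy₁.eq, cy₂.eq, cp₁.eq, cp₂.eq, assoc cy₁.eq, assoc cy₂.eq, assoc cp₁.eq, assoc cp₂.eq, i₁p,
      i₂p, assoc i₁p, assoc i₂p, i₁yy, assoc₂ i₁yy, assoc₂ i₂yy, one_mul, mul_one]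
    match_scalars <;> field_simp <;> ring
  · have hp0 : p ≠ 0 := hp ▸ inv_ne_zero hy
    have ha : q⁻¹ • (Q₁⁻¹ * (p * (x * x))) ≠ 0 :=
      smul_ne_zero (inv_ne_zero hq)
        (mul_ne_zero (inv_ne_zero hQ₁) (mul_ne_zero hp0 (mul_ne_zero hx hx)))
    refine ha (eq_zero_of_add_add_eq_zero (r := q ^ 2)
      (b := Q₁⁻¹ * (q • (y * (x * x'))) - Q₂⁻¹ * (q • (p * (x' * x))) + Q)
      (c := -(q⁻¹ • (Q₂⁻¹ * (y * (x' * x'))))) (pow_ne_zero 2 hq) hq₂ hq₄ hy ?_ ?_ ?_ ?_)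
    · simp only [mul_sub, sub_mul, mul_smul_comm, smul_mul_assoc, mul_assoc, hxy, assoc hxy,
        assoc cy₁.eq, assoc i₁p, assoc₂ i₁yy, one_mul]
      match_scalars <;> field_simp
    · simp only [hQd, mul_add, add_mul, mul_sub, sub_mul, mul_smul_comm, smul_mul_assoc, mul_assoc,
        hxx', hx'x, yp, py, cy₁.eq, cy₂.eq, assoc i₂p, i₁yy, one_mul, mul_one]
    · simp only [sub_mul, mul_smul_comm, smul_mul_assoc, mul_assoc, neg_mul, mul_neg,
        hxy', assoc hxy', assoc cy₂.eq, assoc₂ i₂yy]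
      match_scalars <;> field_simp
    · have e : Q * (u * v + 1) = 0 := by rw [h, mul_zero]
      rw [← e, mul_add, hu_mul, mul_one]
      simp only [hQd, mul_add, mul_sub, sub_mul, mul_smul_comm, smul_mul_assoc, mul_assoc, hxv,
        hxv', hxx', hx'x, assoc hxy, assoc hxp, assoc hxy', assoc hxp', yp, py, assoc i₁p,
        assoc i₂p, i₁yy, one_mul, mul_one]
      match_scalars <;> field_simp

end WeylPair

/-- Algebra homomorphisms out of the `q`-division ring are determined by the images of the two
generators. -/
theorem IsQDivisionRing.algHom_ext {k D E : Type*} [Field k] [DivisionRing D] [Algebra k D]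
    [DivisionRing E] [Algebra k E] {q : k} {x y : D} (hD : IsQDivisionRing k D q x y)
    {f g : D →ₐ[k] E} (hx : f x = g x) (hy : f y = g y) : f = g := by
  have h : Set.EqOn f g (Algebra.adjoin k {x, y}) := by
    have hle : Algebra.adjoin k {x, y} ≤ AlgHom.equalizer f g :=
      Algebra.adjoin_le (by rintro z (rfl | rfl) <;> assumption)
    exact fun z hz => hle hz
  ext d
  obtain ⟨s, t, hs, ht, -, rfl⟩ := hD.exists_frac d
  rw [map_mul, map_mul, map_inv₀, map_inv₀, h hs, h ht]

/-- In a division ring, left multiplication by a nonzero element is surjective on a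
two-dimensional right subspace `E + yE` that it preserves. -/
theorem exists_mul_eq_of_mul_mem {D E : Type*} [DivisionRing D] [DivisionRing E] (θ : E →+* D)
    {y t : D} (hy : ∀ e, θ e ≠ y) (ht : t ≠ 0) {a b c d : E}
    (h₁ : t = θ a + y * θ c) (hty : t * y = θ b + y * θ d) (m n : E) :
    ∃ e₁ e₂ : E, t * (θ e₁ + y * θ e₂) = θ m + y * θ n := by
  have expand (e₁ e₂ : E) : t * (θ e₁ + y * θ e₂) =
      θ (a * e₁ + b * e₂) + y * θ (c * e₁ + d * e₂) := by
    rw [mul_add, ← mul_assoc, hty]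
    nth_rw 1 [h₁]
    simp only [map_add, map_mul]
    noncomm_ring
  have no_kernel (e : E) (ha : a * e + b = 0) (hc : c * e + d = 0) : False := by
    have h := expand e 1
    rw [mul_one, mul_one, ha, hc, map_zero, map_one, mul_one, mul_zero, add_zero] at h
    refine hy (-e) ?_
    rw [map_neg, neg_eq_iff_add_eq_zero]
    exact (mul_eq_zero.mp h).resolve_left ht
  simp only [expand]
  by_cases ha : a = 0
  · subst ha
    have hc : c ≠ 0 := by rintro rfl; exact ht (by simp [h₁])
    have hb : b ≠ 0 := by
      rintro rfl
      exact no_kernel (-(c⁻¹ * d)) (by simp) (by simp [hc])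
    exact ⟨c⁻¹ * (n - d * (b⁻¹ * m)), b⁻¹ * m, by simp [hb, hc]⟩
  · have hd : d - c * (a⁻¹ * b) ≠ 0 := by
      intro h
      refine no_kernel (-(a⁻¹ * b)) (by simp [ha]) ?_
      rw [← h]; noncomm_ring
    set f := (d - c * (a⁻¹ * b))⁻¹ * (n - c * (a⁻¹ * m)) with hf
    have hf' : (d - c * (a⁻¹ * b)) * f = n - c * (a⁻¹ * m) := by
      rw [hf, mul_inv_cancel_left₀ hd]
    refine ⟨a⁻¹ * (m - b * f), f, ?_⟩
    have h₁ : a * (a⁻¹ * (m - b * f)) + b * f = m := by rw [mul_inv_cancel_left₀ ha]; abel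
    have h₂ : c * (a⁻¹ * (m - b * f)) + d * f = n := by
      have : n = (d - c * (a⁻¹ * b)) * f + c * (a⁻¹ * m) := by rw [hf']; abel
      rw [this]; noncomm_ring
    rw [h₁, h₂]

/-- If the image of a division ring `E` contains `u`, `v` and `y - y⁻¹`, and `x = y u + v`, then
the `q`-division ring is spanned by `1` and `y` as a right vector space over `E`. -/
theorem IsQDivisionRing.exists_eq_add_mul {k D E : Type*} [Field k] [DivisionRing D] [Algebra k D]
    [DivisionRing E] [Algebra k E] {q : k} {x y : D} (hD : IsQDivisionRing k D q x y)
    (θ : E →ₐ[k] D) (hy : ∀ e, θ e ≠ y) {u v g : E} (hx : y * θ u + θ v = x)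
    (hg : θ g = y - y⁻¹) (d : D) : ∃ a b : E, d = θ a + y * θ b := by
  have hyy : y * y = 1 + y * θ g := by
    rw [hg, mul_sub, mul_inv_cancel₀ hD.y_ne_zero]; abel
  let M : Submodule k D :=
    LinearMap.range (θ.toLinearMap.coprod (LinearMap.mulLeft k y ∘ₗ θ.toLinearMap))
  have hM (d : D) : d ∈ M ↔ ∃ a b : E, d = θ a + y * θ b := by
    simp [M, LinearMap.mem_range, eq_comm]
  have hymem : ∀ m ∈ M, y * m ∈ M := by
    intro m hm
    rw [hM] at hm ⊢
    obtain ⟨a, b, rfl⟩ := hm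
    refine ⟨b, a + g * b, ?_⟩
    rw [mul_add, ← mul_assoc, hyy, map_add, map_mul]
    noncomm_ring
  have hθx (e : E) : x * θ e ∈ M :=
    (hM _).mpr ⟨v * e, u * e, by rw [← hx, map_mul, map_mul]; noncomm_ring⟩
  have hxmem : ∀ m ∈ M, x * m ∈ M := by
    intro m hm
    obtain ⟨a, b, rfl⟩ := (hM m).mp hm
    rw [mul_add, ← mul_assoc, hD.rel, ← Algebra.smul_def, smul_mul_assoc, mul_assoc]
    exact M.add_mem (hθx a) (M.smul_mem _ (hymem _ (hθx b)))
  have hmem : ∀ c ∈ Algebra.adjoin k ({x, y} : Set D), ∀ m ∈ M, c * m ∈ M := by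
    intro c hc
    induction hc using Algebra.adjoin_induction with
    | mem c hc => rcases hc with rfl | rfl <;> assumption
    | algebraMap r => intro m hm; rw [← Algebra.smul_def]; exact M.smul_mem _ hm
    | add u v _ _ hu hv => intro m hm; rw [add_mul]; exact M.add_mem (hu m hm) (hv m hm)
    | mul u v _ _ hu hv => intro m hm; rw [mul_assoc]; exact hu _ (hv _ hm)
  have h1 : (1 : D) ∈ M := (hM 1).mpr ⟨1, 0, by simp⟩
  have hyM : y ∈ M := by simpa using hymem 1 h1
  obtain ⟨s, t, hs, ht, ht0, rfl⟩ := hD.exists_frac d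
  obtain ⟨m, n, hmn⟩ := (hM s).mp (by simpa using hmem s hs 1 h1)
  obtain ⟨a, c, hac⟩ := (hM t).mp (by simpa using hmem t ht 1 h1)
  obtain ⟨b, d, hbd⟩ := (hM _).mp (hmem t ht y hyM)
  obtain ⟨e₁, e₂, he⟩ := exists_mul_eq_of_mul_mem θ.toRingHom hy ht0 hac hbd m n
  exact ⟨e₁, e₂, by rw [hmn, inv_mul_eq_iff_eq_mul₀ ht0]; exact he.symm⟩

/-- Suppose `q` is not a root of unity.  Then `D` admits a `k`-algebra endomorphism that is
injective but not surjective; indeed there is an injective `k`-algebra homomorphism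
`θ : D → D` whose image is the fixed ring `D^φ`, which is a proper subring of `D`. -/
theorem stmt16 (k : Type*) [Field k] [CharZero k] (q : k) (hq : q ≠ 0)
    (hq' : ∀ n : ℕ, 0 < n → q ^ n ≠ 1)
    (D : Type*) [DivisionRing D] [Algebra k D] (x y : D)
    (hD : IsQDivisionRing k D q x y)
    (φ : D ≃ₐ[k] D)
    (hφx : φ x = (y⁻¹ - (algebraMap k D q)⁻¹ * y) * x⁻¹)
    (hφy : φ y = -y⁻¹) :
    ∃ θ : D →ₐ[k] D, Function.Injective θ ∧ ¬ Function.Surjective θ ∧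
      Set.range θ = {r : D | φ r = r} ∧
      {r : D | φ r = r} ≠ Set.univ := by
  have hx := hD.x_ne_zero
  have hy := hD.y_ne_zero
  have hq2 : q ^ 2 ≠ 1 := hq' 2 two_pos
  have hxy : x * y = q • (y * x) := by rw [hD.rel, Algebra.smul_def]
  have hxp : x * y⁻¹ = q⁻¹ • (y⁻¹ * x) := by
    rw [eq_inv_smul_iff₀ hq, ← mul_right_inj' hy, ← mul_left_inj' hy, mul_smul_comm,
      mul_inv_cancel_left₀ hy, smul_mul_assoc, mul_assoc, mul_assoc, inv_mul_cancel₀ hy, mul_one,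
      hxy]
  have hyy {c : k} (hc : c ≠ 0) : y * y ≠ c • 1 := by
    intro h
    have h' : x * (y * y) = q ^ 2 • ((y * y) * x) := by
      rw [← mul_assoc, hxy, smul_mul_assoc, mul_assoc, hxy, mul_smul_comm, smul_smul, ← pow_two,
        mul_assoc]
    rw [h, mul_smul_comm, smul_mul_assoc, mul_one, one_mul, smul_smul, ← sub_eq_zero, ← sub_smul,
      smul_eq_zero, or_iff_left hx] at h'
    exact hq2 (mul_right_cancel₀ hc (by linear_combination -h'))
  have hφp : φ y⁻¹ = -y := by rw [map_inv₀, hφy, inv_neg, inv_inv]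
  have hx'x : φ x * x = y⁻¹ - q⁻¹ • y := by
    rw [hφx, mul_assoc, inv_mul_cancel₀ hx, mul_one, ← map_inv₀, ← Algebra.smul_def]
  have hx' : φ x ≠ 0 := by simpa using hx
  have hxx' : x * φ x = q⁻¹ • y⁻¹ - y := by
    apply mul_right_cancel₀ hx
    rw [mul_assoc, hx'x, mul_sub, mul_smul_comm, hxp, hxy, inv_smul_smul₀ hq, sub_mul,
      smul_mul_assoc]
  have hφφ : φ (φ x) = x := by
    apply mul_right_cancel₀ hx'
    rw [← map_mul, hx'x, map_sub, map_smul, hφp, hφy, hxx', smul_neg]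
    abel
  have hxy' : φ x * y = q⁻¹ • (y * φ x) := by
    have h := congrArg φ hxp
    rw [map_mul, hφp, map_smul, map_mul, hφp] at h
    simpa using h
  have hQ : y + y⁻¹ ≠ 0 := by
    intro h
    refine hyy (neg_ne_zero.mpr one_ne_zero) ?_
    have := congrArg (y * ·) h
    simp only [mul_add, mul_inv_cancel₀ hy, mul_zero] at this
    rw [neg_smul, one_smul, eq_neg_iff_add_eq_zero, this]
  have hQ₁ : q • y + q⁻¹ • y⁻¹ ≠ 0 := by
    intro h
    have := congrArg (· * x) h
    simp only [add_mul, smul_mul_assoc, zero_mul, ← hxy, ← hxp] at this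
    rw [← mul_add] at this
    exact mul_ne_zero hx hQ this
  have hQ₂ : q⁻¹ • y + q • y⁻¹ ≠ 0 := by
    intro h
    have := congrArg φ h
    simp only [map_add, map_smul, map_zero, hφy, hφp, smul_neg] at this
    apply hQ₁
    rw [← neg_eq_zero, ← this]
    abel
  have hφQ : φ (y + y⁻¹) = -(y + y⁻¹) := by rw [map_add, hφy, hφp]; abel
  obtain ⟨u, hu⟩ : ∃ u, u = (y + y⁻¹)⁻¹ * (x - φ x) := ⟨_, rfl⟩
  obtain ⟨v, hv⟩ : ∃ v, v = (y + y⁻¹)⁻¹ * (y⁻¹ * x + y * φ x) := ⟨_, rfl⟩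
  obtain ⟨hvu, hg, hw0⟩ := weylPair_relations hq hq2 (pow_mul q 2 2 ▸ hq' 4 four_pos) hx hy hxy
    hxy' hx'x hxx' hQ hQ₁ hQ₂ hu hv
  have hφu : φ u = u := by
    rw [hu, map_mul, map_inv₀, hφQ, map_sub, hφφ, inv_neg, ← neg_sub x, neg_mul_neg]
  have hφv : φ v = v := by
    rw [hv, map_mul, map_inv₀, hφQ, map_add, map_mul, map_mul, hφφ, hφp, hφy, inv_neg, neg_mul_comm]
    congr 1
    noncomm_ring
  have hxuv : y * u + v = x := by
    apply mul_left_cancel₀ hQ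
    have hyQ : (y + y⁻¹) * y = y * (y + y⁻¹) := by
      rw [add_mul, mul_add, inv_mul_cancel₀ hy, mul_inv_cancel₀ hy]
    rw [mul_add, ← mul_assoc, hyQ, mul_assoc, hu, hv, mul_inv_cancel_left₀ hQ,
      mul_inv_cancel_left₀ hQ]
    noncomm_ring
  have hu0 : u ≠ 0 := by
    intro h
    rw [hu, mul_eq_zero, or_iff_right (inv_ne_zero hQ), sub_eq_zero] at h
    rw [← h, hxy, ← sub_eq_zero, ← sub_smul, smul_eq_zero, or_iff_left (mul_ne_zero hy hx),
      sub_eq_zero] at hxy'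
    exact hq2 (by rw [pow_two]; nth_rw 2 [hxy']; exact mul_inv_cancel₀ hq)
  have hwu : (u * v + 1) * u = q • (u * (u * v + 1)) := by
    rw [add_mul, mul_assoc, hvu]
    simp only [mul_add, mul_smul_comm, mul_one, one_mul]
    module
  obtain ⟨θ, hθx, hθy⟩ := hD.exists_algHom hq hq' hw0 hu0 hwu
  have hφθ (d : D) : φ (θ d) = θ d := by
    have : (φ : D →ₐ[k] D).comp θ = θ :=
      hD.algHom_ext (by simp [hθx, hφu, hφv]) (by simp [hθy, hφu])
    exact DFunLike.congr_fun this d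
  have hφy_ne : φ y ≠ y := by
    rw [hφy]
    intro h
    apply hQ
    nth_rw 1 [← h]
    exact neg_add_cancel _
  have hyθ (e : D) : θ e ≠ y := by
    rintro h
    exact hφy_ne (by rw [← h, hφθ])
  have hθv : θ (y⁻¹ * (x - 1)) = v := by
    rw [map_mul, map_inv₀, map_sub, map_one, hθx, hθy, add_sub_cancel_right,
      inv_mul_cancel_left₀ hu0]
  have hθg : θ ((q⁻¹ • (y * y) - (y⁻¹ * (x - 1)) * (y⁻¹ * (x - 1))) * x⁻¹) = y - y⁻¹ := by
    rw [map_mul, map_sub, map_smul, map_mul θ y, map_mul θ (_ * _), hθv, map_inv₀, hθx, hθy, ← hg,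
      mul_assoc, mul_inv_cancel₀ hw0, mul_one]
  refine ⟨θ, θ.toRingHom.injective, fun h => ?_, ?_, fun h => ?_⟩
  · obtain ⟨e, he⟩ := h y
    exact hyθ e he
  · ext r
    constructor
    · rintro ⟨e, rfl⟩
      exact hφθ e
    · intro hr
      obtain ⟨a, b, rfl⟩ := hD.exists_eq_add_mul (u := y) (v := y⁻¹ * (x - 1)) θ hyθ
        (by rw [hθy, hθv, hxuv]) hθg r
      have hr' : φ (θ a + y * θ b) = θ a + y * θ b := hr
      rw [map_add, map_mul, hφθ, hφθ, hφy, add_right_inj, neg_mul, eq_comm,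
        ← add_eq_zero_iff_eq_neg, ← add_mul, mul_eq_zero, or_iff_right hQ] at hr'
      exact ⟨a, by rw [hr', mul_zero, add_zero]⟩
  · exact hφy_ne (h.symm ▸ Set.mem_univ y : y ∈ {r : D | φ r = r})
end
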